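/- (Hata) For every integer z with z ≤ −5 or z ≥ 7, the three real numbers 1, Li₁(1/z) and Li₂(1/z) are linearly independent over ℚ. -/

import Mathlib

/-- The polylogarithm `Li_k(x) = ∑_{n ≥ 1} x^n / n^k`. -/
noncomputable def Li (k : ℕ) (x : ℝ) : ℝ := ∑' n : ℕ, x ^ (n + 1) / (n + 1 : ℝ) ^ k

open Filter Topology MeasureTheory Complex in
/-- Fejér kernel. -/
theorem integral_triangle_mul_exp {a t : ℝ} (ha : 0 < a) (ht : t ≠ 0) :
    ∫ u : ℝ, ((max 0 (1 - |u| / a) : ℝ) : ℂ) * cexp (u * t * I)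
      = ((2 * (1 - Real.cos (a * t)) / (a * t ^ 2) : ℝ) : ℂ) := by
  have h0 : ∫ u : ℝ, ((max 0 (1 - |u| / a) : ℝ) : ℂ) * cexp (u * t * I)
      = ∫ u in (-a)..a, ((max 0 (1 - |u| / a) : ℝ) : ℂ) * cexp (u * t * I) := by
    rw [intervalIntegral.integral_of_le (by linarith), ← integral_Icc_eq_integral_Ioc,
      setIntegral_eq_integral_of_forall_compl_eq_zero]
    intro u hu
    have : a ≤ |u| := by
      by_contra h
      push Not at h
      exact hu (abs_le.1 h.le)
    have h1 : 1 ≤ |u| / a := by rwa [one_le_div ha]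
    rw [max_eq_left (by linarith)]; simp
  have hc : Continuous fun u : ℝ => ((max 0 (1 - |u| / a) : ℝ) : ℂ) * cexp (u * t * I) := by
    fun_prop
  have htI : (t * I : ℂ) ≠ 0 := by simp [ht]
  have htC : (t : ℂ) ≠ 0 := by exact_mod_cast ht
  have haC : (a : ℂ) ≠ 0 := by exact_mod_cast ha.ne'
  rw [h0, ← intervalIntegral.integral_add_adjacent_intervals (b := 0)
    (hc.intervalIntegrable _ _) (hc.intervalIntegrable _ _)]
  have e1 : ∫ u in (-a)..0, ((max 0 (1 - |u| / a) : ℝ) : ℂ) * cexp (u * t * I)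
      = ((1 + (0:ℝ) / a) / (t * I) * cexp ((0:ℝ) * t * I) -
          1 / (a * (t * I)^2) * cexp ((0:ℝ) * t * I))
       - ((1 + (-a:ℝ) / a) / (t * I) * cexp ((-a:ℝ) * t * I) -
           1 / (a * (t * I)^2) * cexp ((-a:ℝ) * t * I)) := by
    apply intervalIntegral.integral_eq_sub_of_hasDerivAt
      (f := fun u : ℝ => ((1 + (u:ℂ) / a) / (t * I) * cexp (u * t * I) -
          1 / (a * (t * I)^2) * cexp (u * t * I)))
    · intro u hu
      rw [Set.uIcc_of_le (by linarith)] at hu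
      have hE : HasDerivAt (fun u : ℝ => cexp (u * t * I)) (cexp (u * t * I) * (1 * t * I)) u :=
        (((Complex.ofRealCLM.hasDerivAt (x := u)).mul_const (t : ℂ)).mul_const I).cexp
      have hL : HasDerivAt (fun u : ℝ => (1 + (u:ℂ) / a) / (t * I)) ((1 / a) / (t * I)) u :=
        (((Complex.ofRealCLM.hasDerivAt (x := u)).div_const (a : ℂ)).const_add 1).div_const _
      have := (hL.mul hE).sub (hE.const_mul (1 / (a * (t * I)^2)))
      refine this.congr_deriv ?_
      rw [max_eq_right, abs_of_nonpos hu.2]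
      · push_cast
        field_simp
        ring
      · have : |u| / a ≤ 1 := by rw [div_le_one ha]; exact abs_le.2 ⟨hu.1, by linarith [hu.2]⟩
        linarith
    · exact hc.intervalIntegrable _ _
  have e2 : ∫ u in (0:ℝ)..a, ((max 0 (1 - |u| / a) : ℝ) : ℂ) * cexp (u * t * I)
      = ((1 - (a:ℝ) / a) / (t * I) * cexp ((a:ℝ) * t * I) +
          1 / (a * (t * I)^2) * cexp ((a:ℝ) * t * I))
       - ((1 - (0:ℝ) / a) / (t * I) * cexp ((0:ℝ) * t * I) +
           1 / (a * (t * I)^2) * cexp ((0:ℝ) * t * I)) := by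
    apply intervalIntegral.integral_eq_sub_of_hasDerivAt
      (f := fun u : ℝ => ((1 - (u:ℂ) / a) / (t * I) * cexp (u * t * I) +
          1 / (a * (t * I)^2) * cexp (u * t * I)))
    · intro u hu
      rw [Set.uIcc_of_le (by linarith)] at hu
      have hE : HasDerivAt (fun u : ℝ => cexp (u * t * I)) (cexp (u * t * I) * (1 * t * I)) u :=
        (((Complex.ofRealCLM.hasDerivAt (x := u)).mul_const (t : ℂ)).mul_const I).cexp
      have hL : HasDerivAt (fun u : ℝ => (1 - (u:ℂ) / a) / (t * I)) (-(1 / a) / (t * I)) u :=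
        (((Complex.ofRealCLM.hasDerivAt (x := u)).div_const (a : ℂ)).const_sub 1).div_const _
      have := (hL.mul hE).add (hE.const_mul (1 / (a * (t * I)^2)))
      refine this.congr_deriv ?_
      rw [max_eq_right, abs_of_nonneg hu.1]
      · push_cast
        field_simp
        ring
      · have : |u| / a ≤ 1 := by rw [div_le_one ha]; exact abs_le.2 ⟨by linarith [hu.1], hu.2⟩
        linarith
    · exact hc.intervalIntegrable _ _
  rw [e1, e2]
  have hcos : cexp ((a:ℝ) * t * I) + cexp ((-a:ℝ) * t * I) = 2 * (Real.cos (a * t) : ℝ) := by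
    rw [Complex.ofReal_cos, Complex.cos]
    push_cast
    ring_nf
  push_cast at hcos ⊢
  rw [show (1 + -(a:ℂ) / a) = 0 by field_simp; ring, show (1 - (a:ℂ) / a) = 0 by field_simp; ring]
  simp only [zero_div, zero_mul, Complex.exp_zero, add_zero, sub_zero, mul_one, zero_add, zero_sub]
  rw [mul_pow, I_sq]
  have : (1 - Complex.cos (a * t)) * 2 = 2 - (cexp (a * t * I) + cexp (-a * t * I)) := by
    rw [hcos]; ring
  rw [mul_comm (2:ℂ), this]
  field_simp
  ring

/-- The Fejér kernel with parameter `a`. -/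
noncomputable def fejer (a t : ℝ) : ℝ := 2 * (1 - Real.cos (a * t)) / (a * t ^ 2)

theorem fejer_nonneg {a : ℝ} (ha : 0 < a) (t : ℝ) : 0 ≤ fejer a t := by
  have := Real.cos_le_one (a * t)
  unfold fejer
  have : 0 ≤ 1 - Real.cos (a * t) := by linarith
  positivity

theorem fejer_le {a : ℝ} (ha : 0 < a) (t : ℝ) : fejer a t ≤ (a + 4 / a) * (1 + t ^ 2)⁻¹ := by
  unfold fejer
  rcases eq_or_ne t 0 with rfl | ht
  · simp; positivity
  have h1 := Real.one_sub_sq_div_two_le_cos (x := a * t)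
  have h2 := Real.neg_one_le_cos (a * t)
  rw [← div_eq_mul_inv, div_le_div_iff₀ (by positivity) (by positivity)]
  have e : (a + 4 / a) * (a * t ^ 2) = a ^ 2 * t ^ 2 + 4 * t ^ 2 := by field_simp
  rw [e]
  nlinarith [sq_nonneg t]

theorem measurable_fejer (a : ℝ) : Measurable (fejer a) := by
  unfold fejer; fun_prop

theorem integrable_fejer {a : ℝ} (ha : 0 < a) : MeasureTheory.Integrable (fejer a) := by
  refine (integrable_inv_one_add_sq.const_mul (a + 4 / a)).mono'
    (measurable_fejer a).aestronglyMeasurable (.of_forall fun t => ?_)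
  rw [Real.norm_of_nonneg (fejer_nonneg ha t)]
  exact fejer_le ha t

open Filter Topology MeasureTheory Complex Set in
theorem tendsto_integral_mul_fejer {f : ℝ → ℝ} {C : ℝ} (hf : Measurable f) (hC : ∀ t, |f t| ≤ C)
    (hneg : ∀ t < 0, f t = 0) {g : ℝ × ℝ → ℂ} (hg : ContinuousOn g (Ici 0 ×ˢ univ))
    (hfg : ∀ ε : ℝ, 0 < ε → ∀ u : ℝ, ∫ t : ℝ, (f t : ℂ) * cexp (-(ε + u * I) * t) = g (ε, u))
    {a : ℝ} (ha : 0 < a) :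
    Tendsto (fun y : ℝ => ∫ t : ℝ, f t * fejer a (y - t)) atTop (𝓝 0) := by
  set w : ℝ → ℝ := fun u => max 0 (1 - |u| / a) with hw
  have hwc : Continuous w := by fun_prop
  have hwsupp : ∀ u, u ∉ Icc (-a) a → w u = 0 := by
    intro u hu
    have : a ≤ |u| := by
      by_contra h
      push Not at h
      exact hu (abs_le.1 h.le)
    have h1 : 1 ≤ |u| / a := by rwa [one_le_div ha]
    exact max_eq_left (by linarith)
  have hw1 : ∀ u, |w u| ≤ 1 := by
    intro u
    have : 0 ≤ |u| / a := by positivity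
    rw [abs_of_nonneg (le_max_left _ _)]
    exact max_le zero_le_one (by linarith)
  have hwint : Integrable w :=
    hwc.integrable_of_hasCompactSupport (.intro isCompact_Icc fun u hu => hwsupp u hu)
  have hC0 : 0 ≤ C := (abs_nonneg _).trans (hC 0)
  have key : ∀ y : ℝ, ∫ u : ℝ, cexp (u * y * I) * ((w u : ℂ) * g (0, u))
      = ((∫ t : ℝ, f t * fejer a (y - t) : ℝ) : ℂ) := by
    intro y
    have h_int : ∀ ε : ℝ, 0 < ε → Integrable fun t : ℝ => f t * Real.exp (-ε * t) := by
      intro ε hε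
      have h1 : IntegrableOn (fun t : ℝ => C * Real.exp (-ε * t)) (Ici 0) :=
        (Integrable.const_mul ((integrableOn_Ici_iff_integrableOn_Ioi (by simp)).2
          (integrableOn_exp_mul_Ioi (by linarith) 0)) C)
      refine ((integrable_indicator_iff measurableSet_Ici).2 h1).mono'
        (by fun_prop) (.of_forall fun t => ?_)
      by_cases ht : 0 ≤ t
      · rw [indicator_of_mem (mem_Ici.2 ht), norm_mul, Real.norm_eq_abs, Real.norm_eq_abs,
            Real.abs_exp]
        exact mul_le_mul_of_nonneg_right (hC t) (Real.exp_nonneg _)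
      · rw [indicator_of_notMem (by simpa using ht), hneg t (by linarith)]; simp
    have fub : ∀ ε : ℝ, 0 < ε → ∫ u : ℝ, cexp (u * y * I) * ((w u : ℂ) * g (ε, u))
        = ((∫ t : ℝ, (f t * Real.exp (-ε * t)) * fejer a (y - t) : ℝ) : ℂ) := by
      intro ε hε
      have hprod : Integrable (Function.uncurry fun (u t : ℝ) =>
          cexp (u * y * I) * ((w u : ℂ) * ((f t : ℂ) * cexp (-(ε + u * I) * t))))
          (volume.prod volume) := by
        refine (hwint.norm.mul_prod (h_int ε hε).norm).mono' ?_ (.of_forall fun z => ?_)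
        · apply Measurable.aestronglyMeasurable
          unfold Function.uncurry
          fun_prop
        · simp only [Function.uncurry, norm_mul, Complex.norm_exp, Real.norm_eq_abs,
            Complex.norm_real]
          simp only [mul_re, ofReal_re, ofReal_im, I_re, I_im, neg_re, add_re, mul_im, add_im,
            neg_im]
          rw [Real.abs_exp]
          refine le_of_eq ?_
          ring_nf
          simp
      calc _ = ∫ u : ℝ, ∫ t : ℝ, cexp (u * y * I) *
          ((w u : ℂ) * ((f t : ℂ) * cexp (-(ε + u * I) * t))) := by
            refine integral_congr_ae (.of_forall fun u => ?_)
            simp only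
            rw [← hfg ε hε, integral_const_mul, integral_const_mul]
        _ = ∫ t : ℝ, ∫ u : ℝ, cexp (u * y * I) *
            ((w u : ℂ) * ((f t : ℂ) * cexp (-(ε + u * I) * t))) :=
            integral_integral_swap hprod
        _ = ∫ t : ℝ, (((f t * Real.exp (-ε * t)) * fejer a (y - t) : ℝ) : ℂ) := by
            refine integral_congr_ae ?_
            have : ∀ᵐ t : ℝ, t ≠ y := by simp [ae_iff]
            filter_upwards [this] with t ht
            have h := integral_triangle_mul_exp ha (t := y - t) (sub_ne_zero.2 ht.symm)
            have e : ∀ u : ℝ, cexp (u * y * I) * ((w u : ℂ) * ((f t : ℂ) * cexp (-(ε + u * I) * t)))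
              = ((f t * Real.exp (-ε * t) : ℝ) : ℂ) * ((w u : ℂ) * cexp (u * (y - t : ℝ) * I)) := by
              intro u
              push_cast
              rw [show (-(ε + u * I) * t : ℂ) = -ε * t + (-(u * I * t)) by ring, Complex.exp_add,
                show (u * (y - t) * I : ℂ) = u * y * I + (-(u * I * t)) by ring, Complex.exp_add]
              ring
            simp_rw [e]
            rw [integral_const_mul, hw, h, fejer]
            push_cast; ring
        _ = _ := integral_ofReal
    have hseq : Tendsto (fun n : ℕ => (1 / ((n : ℝ) + 1))) atTop (𝓝 0) :=
      tendsto_one_div_add_atTop_nhds_zero_nat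
    have hpos : ∀ n : ℕ, 0 < (1 / ((n : ℝ) + 1)) := fun n => by positivity
    have hle1 : ∀ n : ℕ, (1 / ((n : ℝ) + 1)) ≤ 1 := fun n => by
      rw [div_le_one (by positivity)]; linarith [n.cast_nonneg (α := ℝ)]
    obtain ⟨M, hM⟩ := ((isCompact_Icc (a := (0:ℝ)) (b := 1)).prod
        (isCompact_Icc (a := -a) (b := a))).exists_bound_of_continuousOn
      (hg.mono (prod_mono Icc_subset_Ici_self (subset_univ _)))
    have hgc : ∀ ε ≥ 0, Continuous fun u : ℝ => g (ε, u) := by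
      intro ε hε
      rw [← continuousOn_univ]
      exact hg.comp (by fun_prop) fun u _ => ⟨hε, mem_univ _⟩
    have L1 : Tendsto (fun n : ℕ => ∫ u : ℝ, cexp (u * y * I) *
        ((w u : ℂ) * g (1 / ((n : ℝ) + 1), u)))
        atTop (𝓝 (∫ u : ℝ, cexp (u * y * I) * ((w u : ℂ) * g (0, u)))) := by
      refine tendsto_integral_of_dominated_convergence (fun u => |w u| * M) ?_ ?_ ?_ ?_
      · intro n
        have hgn := hgc _ (hpos n).le
        have : Continuous fun u : ℝ => cexp (u * y * I) * ((w u : ℂ) * g (1 / ((n : ℝ) + 1), u)) :=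
          (by fun_prop : Continuous fun u : ℝ => cexp (u * y * I)).mul
            ((by fun_prop : Continuous fun u : ℝ => (w u : ℂ)).mul hgn)
        exact this.aestronglyMeasurable
      · exact hwint.abs.mul_const M
      · intro n
        refine .of_forall fun u => ?_
        rw [norm_mul, norm_mul, Complex.norm_real, Real.norm_eq_abs,
          show (u * y * I : ℂ) = ((u * y : ℝ) : ℂ) * I by push_cast; ring,
          Complex.norm_exp_ofReal_mul_I, one_mul]
        by_cases hu : u ∈ Icc (-a) a
        · exact mul_le_mul_of_nonneg_left (hM _ ⟨⟨(hpos n).le, hle1 n⟩, hu⟩) (abs_nonneg _)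
        · simp [hwsupp u hu]
      · refine .of_forall fun u => ?_
        have := (hg (0, u) ⟨mem_Ici.2 le_rfl, mem_univ _⟩).tendsto
        refine (Tendsto.const_mul _ (Tendsto.const_mul _ (this.comp ?_)))
        refine tendsto_nhdsWithin_iff.2 ⟨?_, .of_forall fun n => ⟨(hpos n).le, mem_univ _⟩⟩
        exact hseq.prodMk_nhds tendsto_const_nhds
    have L2 : Tendsto (fun n : ℕ => ∫ t : ℝ, (f t * Real.exp (-(1 / ((n : ℝ) + 1)) * t)) *
        fejer a (y - t))
        atTop (𝓝 (∫ t : ℝ, f t * fejer a (y - t))) := by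
      refine tendsto_integral_of_dominated_convergence (fun t => C * fejer a (y - t)) ?_ ?_ ?_ ?_
      · intro n
        have := measurable_fejer a
        exact Measurable.aestronglyMeasurable (by fun_prop)
      · exact ((integrable_fejer ha).comp_sub_left y).const_mul C
      · intro n
        refine .of_forall fun t => ?_
        rw [norm_mul, norm_mul, Real.norm_eq_abs, Real.norm_eq_abs, Real.norm_eq_abs,
          abs_of_nonneg (fejer_nonneg ha _), Real.abs_exp]
        refine mul_le_mul_of_nonneg_right ?_ (fejer_nonneg ha _)
        by_cases ht : 0 ≤ t
        · have : Real.exp (-(1 / ((n : ℝ) + 1)) * t) ≤ 1 := by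
            rw [Real.exp_le_one_iff]
            have := mul_nonneg (hpos n).le ht
            linarith
          calc _ ≤ |f t| * 1 := mul_le_mul_of_nonneg_left this (abs_nonneg _)
            _ ≤ C := by linarith [hC t]
        · rw [hneg t (by linarith)]; simpa using hC0
      · refine .of_forall fun t => ?_
        refine Tendsto.mul_const _ ?_
        have : Tendsto (fun n : ℕ => Real.exp (-(1 / ((n : ℝ) + 1)) * t)) atTop
            (𝓝 (Real.exp (-0 * t))) :=
          (Real.continuous_exp.tendsto _).comp ((hseq.neg).mul_const t)
        simpa using this.const_mul (f t)
    have L2' := (Complex.continuous_ofReal.tendsto _).comp L2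
    refine tendsto_nhds_unique L1 (L2'.congr fun n => ?_)
    rw [fub _ (hpos n)]; rfl
  have RL := Real.tendsto_integral_exp_smul_cocompact (fun u : ℝ => (w u : ℂ) * g (0, u))
  have hy : Tendsto (fun y : ℝ => -y / (2 * Real.pi)) atTop (cocompact ℝ) := by
    refine Tendsto.mono_right ?_ atBot_le_cocompact
    exact tendsto_neg_atTop_atBot.atBot_div_const (by positivity)
  have RL' := RL.comp hy
  have : Tendsto (fun y : ℝ => ((∫ t : ℝ, f t * fejer a (y - t) : ℝ) : ℂ)) atTop (𝓝 0) := by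
    refine RL'.congr fun y => ?_
    rw [← key y]
    refine integral_congr_ae (.of_forall fun u => ?_)
    simp only [Circle.smul_def, smul_eq_mul, Real.fourierChar_apply]
    congr 2
    have : (Real.pi : ℂ) ≠ 0 := by exact_mod_cast Real.pi_ne_zero
    push_cast
    field_simp
  exact_mod_cast (Complex.continuous_re.tendsto _).comp this

open Filter Topology MeasureTheory Set in
theorem eventually_exists_lt_of_tendsto_fejer {f : ℝ → ℝ} {C : ℝ} (hf : Measurable f)
    (hC : ∀ t, |f t| ≤ C)
    (h : ∀ a > 0, Tendsto (fun y : ℝ => ∫ t : ℝ, f t * fejer a (y - t)) atTop (𝓝 0))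
    {δ η : ℝ} (hδ : 0 < δ) (hη : 0 < η) :
    ∀ᶠ y in atTop, ∃ t ∈ Icc (y - η) (y + η), f t < δ := by
  have hC0 : 0 ≤ C := (abs_nonneg _).trans (hC 0)
  set c : ℝ := 1 / 2 with hc
  have hcpos : 0 < c := by positivity
  obtain ⟨a, ha1, ha2⟩ : ∃ a : ℝ, 1 / η ≤ a ∧ (C * (4 * (1 + 1 / η ^ 2)) * Real.pi + 1) /
      (δ * c) ≤ a :=
    ⟨_, le_max_left _ _, le_max_right _ _⟩
  have ha : 0 < a := lt_of_lt_of_le (by positivity) ha1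
  set D : ℝ := C * (4 * (1 + 1 / η ^ 2)) / a with hD
  have hDpi : D * Real.pi < δ * c := by
    rw [div_le_iff₀ (by positivity)] at ha2
    rw [hD, div_mul_eq_mul_div, div_lt_iff₀ ha]
    linarith
  have hev := (h a ha).eventually (gt_mem_nhds (show 0 < 2 * (δ * c) - D * Real.pi by
    have : 0 < δ * c := by positivity
    linarith))
  filter_upwards [hev] with y hy
  by_contra hcon
  push Not at hcon
  have ha1' : 1 / a ≤ η := by
    rw [div_le_iff₀ ha]; rwa [div_le_iff₀ hη, mul_comm] at ha1
  have hlow : ∫ t : ℝ, ((Icc (y - 1 / a) (y + 1 / a)).indicator (fun _ => δ * (c * a)) t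
      - D * (1 + (y - t) ^ 2)⁻¹) ≤ ∫ t : ℝ, f t * fejer a (y - t) := by
    have i0 : Integrable fun t : ℝ => (1 + (y - t) ^ 2)⁻¹ :=
      integrable_inv_one_add_sq.comp_sub_left y
    refine integral_mono_ae ?_ ?_ ?_
    · exact (IntegrableOn.integrable_indicator continuous_const.integrableOn_Icc
          measurableSet_Icc).sub (i0.const_mul D)
    · have := measurable_fejer a
      refine (((integrable_fejer ha).comp_sub_left y).const_mul C).mono'
        (Measurable.aestronglyMeasurable (by fun_prop)) (.of_forall fun t => ?_)
      rw [norm_mul, Real.norm_eq_abs, Real.norm_eq_abs, abs_of_nonneg (fejer_nonneg ha _)]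
      exact mul_le_mul_of_nonneg_right (hC t) (fejer_nonneg ha _)
    · have : ∀ᵐ t : ℝ, t ≠ y := by simp [ae_iff]
      filter_upwards [this] with t ht
      have hyt : y - t ≠ 0 := sub_ne_zero.2 ht.symm
      have hDnn : 0 ≤ D * (1 + (y - t) ^ 2)⁻¹ := by positivity
      by_cases h1 : t ∈ Icc (y - 1 / a) (y + 1 / a)
      · rw [indicator_of_mem h1]
        have h2 : δ ≤ f t := hcon t ⟨by linarith [h1.1], by linarith [h1.2]⟩
        have h3 : c * a ≤ fejer a (y - t) := by
          unfold fejer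
          have h4 : |a * (y - t)| ≤ 1 := by
            rw [abs_mul, abs_of_pos ha, ← le_div_iff₀' ha]
            exact abs_le.2 ⟨by linarith [h1.2], by linarith [h1.1]⟩
          have h5 := Real.cos_bound h4
          have h6 : |a * (y - t)| ^ 4 ≤ (a * (y - t)) ^ 2 := by
            rw [show |a * (y - t)| ^ 4 = (|a * (y - t)| ^ 2) ^ 2 by ring, sq_abs]
            have : (a * (y - t)) ^ 2 ≤ 1 := by rw [← sq_abs]; nlinarith [abs_nonneg (a * (y - t))]
            nlinarith [sq_nonneg (a * (y - t))]
          have h7 := (abs_le.1 h5).2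
          rw [le_div_iff₀ (by positivity)]
          rw [hc]
          nlinarith [sq_nonneg (a * (y - t))]
        have := mul_le_mul h2 h3 (by positivity) (hδ.le.trans h2)
        exact (sub_le_self _ hDnn).trans this
      · rw [indicator_of_notMem h1]
        by_cases h2 : t ∈ Icc (y - η) (y + η)
        · have := mul_nonneg (hδ.le.trans (hcon t h2)) (fejer_nonneg ha (y - t))
          linarith
        · have h3 : η ^ 2 ≤ (y - t) ^ 2 := by
            rw [mem_Icc, not_and_or] at h2
            rcases h2 with h2 | h2 <;> nlinarith
          have h4 : fejer a (y - t) ≤ (4 * (1 + 1 / η ^ 2)) / a * (1 + (y - t) ^ 2)⁻¹ := by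
            unfold fejer
            have h5 := Real.neg_one_le_cos (a * (y - t))
            have : 0 < (y - t) ^ 2 := by positivity
            rw [← div_eq_mul_inv, div_div, div_le_div_iff₀ (by positivity) (by positivity)]
            have h6 : (1 + (y - t) ^ 2) ≤ (1 + 1 / η ^ 2) * (y - t) ^ 2 := by
              have : 1 ≤ 1 / η ^ 2 * (y - t) ^ 2 := by
                rw [div_mul_eq_mul_div, le_div_iff₀ (by positivity)]; linarith
              linarith
            calc 2 * (1 - Real.cos (a * (y - t))) * (a * (1 + (y - t) ^ 2))
                ≤ 4 * (a * ((1 + 1 / η ^ 2) * (y - t) ^ 2)) := by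
                  gcongr; linarith
              _ = _ := by ring
          have h5 := mul_le_mul (hC t) h4 (fejer_nonneg ha _) hC0
          have h6 : -(|f t| * fejer a (y - t)) ≤ f t * fejer a (y - t) := by
            have := mul_le_mul_of_nonneg_right (neg_abs_le (f t)) (fejer_nonneg ha (y - t))
            linarith
          have h7 : C * ((4 * (1 + 1 / η ^ 2)) / a * (1 + (y - t) ^ 2)⁻¹) =
              D * (1 + (y - t) ^ 2)⁻¹ := by
            rw [hD]; ring
          linarith
  rw [integral_sub (IntegrableOn.integrable_indicator continuous_const.integrableOn_Icc
      measurableSet_Icc)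
    ((integrable_inv_one_add_sq.comp_sub_left y).const_mul D),
    integral_indicator_const _ measurableSet_Icc, integral_const_mul,
    integral_sub_left_eq_self (fun t : ℝ => (1 + t ^ 2)⁻¹), integral_univ_inv_one_add_sq] at hlow
  simp only [measureReal_def, Real.volume_Icc, smul_eq_mul] at hlow
  rw [ENNReal.toReal_ofReal (by ring_nf; positivity)] at hlow
  have : (y + 1 / a - (y - 1 / a)) * (δ * (c * a)) = 2 * (δ * c) := by field_simp; ring
  rw [this] at hlow
  exact absurd hy (not_lt.2 hlow)

open Filter Topology MeasureTheory Set Complex in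
theorem tendsto_psi_exp : Tendsto (fun t : ℝ => Chebyshev.psi (Real.exp t) * Real.exp (-t)) atTop
    (𝓝 1) := by
  set B : ℝ → ℝ := fun t => Chebyshev.psi (Real.exp t) * Real.exp (-t) with hB
  set f : ℝ → ℝ := (Ici 0).indicator (fun t => B t - 1) with hfdef
  have hBmeas : Measurable B :=
    (Chebyshev.psi_mono.measurable.comp Real.measurable_exp).mul (by fun_prop)
  have hf : Measurable f := (hBmeas.sub_const 1).indicator measurableSet_Ici
  have hB0 : ∀ t, 0 ≤ B t := fun t => mul_nonneg (Chebyshev.psi_nonneg _) (Real.exp_nonneg _)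
  have hB1 : ∀ t, B t ≤ Real.log 4 + 4 := by
    intro t
    have := Chebyshev.psi_le_const_mul_self (Real.exp_nonneg t)
    have h2 := mul_le_mul_of_nonneg_right this (Real.exp_nonneg (-t))
    rw [mul_assoc, ← Real.exp_add, add_neg_cancel, Real.exp_zero, mul_one] at h2
    exact h2
  have hlog4 : 0 ≤ Real.log 4 := Real.log_nonneg (by norm_num)
  have hC : ∀ t, |f t| ≤ Real.log 4 + 5 := by
    intro t
    by_cases ht : t ∈ Ici (0 : ℝ)
    · rw [hfdef, indicator_of_mem ht, abs_le]
      constructor <;> linarith [hB0 t, hB1 t]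
    · rw [hfdef, indicator_of_notMem ht, abs_zero]; linarith
  have hneg : ∀ t < 0, f t = 0 := fun t ht => indicator_of_notMem (by simpa using ht) _
  set Aux := ArithmeticFunction.vonMangoldt.LFunctionResidueClassAux (1 : ZMod 1) with hAux
  set g : ℝ × ℝ → ℂ := fun z => (Aux (1 + z.1 + z.2 * I) - 1) / (1 + z.1 + z.2 * I) with hg
  have hgc : ContinuousOn g (Ici 0 ×ˢ univ) := by
    refine ContinuousOn.div (ContinuousOn.sub ?_ continuousOn_const) (by fun_prop) ?_
    · refine (ArithmeticFunction.vonMangoldt.continuousOn_LFunctionResidueClassAux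
          (1 : ZMod 1)).comp
        (by fun_prop) ?_
      rintro ⟨x, u⟩ ⟨hx, -⟩
      simpa using hx
    · rintro ⟨x, u⟩ ⟨hx, -⟩ h0
      have := congrArg Complex.re h0
      simp at this
      have hx' : 0 ≤ x := hx
      linarith
  have hfg : ∀ ε : ℝ, 0 < ε → ∀ u : ℝ,
      ∫ t : ℝ, (f t : ℂ) * cexp (-(ε + u * I) * t) = g (ε, u) := by
    intro ε hε u
    set s : ℂ := 1 + ε + u * I with hs
    have hsre : 1 < s.re := by simp [hs, hε]
    have hs0 : s ≠ 0 := by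
      intro h; rw [h] at hsre; simp at hsre; linarith
    have hs1 : s - 1 ≠ 0 := by
      intro h
      have := congrArg Complex.re h
      simp at this; linarith
    have hR : ∀ n : ℕ, ArithmeticFunction.vonMangoldt.residueClass (1 : ZMod 1) n
        = ArithmeticFunction.vonMangoldt n := by
      intro n
      rw [ArithmeticFunction.vonMangoldt.residueClass, indicator_of_mem]
      exact Subsingleton.elim _ _
    have hA : Aux s = LSeries (fun n => ((ArithmeticFunction.vonMangoldt n : ℝ) : ℂ)) s -
        1 / (s - 1) := by
      have := ArithmeticFunction.vonMangoldt.eqOn_LFunctionResidueClassAux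
        (a := (1 : ZMod 1)) isUnit_one (show s ∈ {s : ℂ | 1 < s.re} from hsre)
      simp only [hR] at this
      rw [hAux, this]
      simp
    have hsum : ∀ n : ℕ, ∑ k ∈ Finset.Icc 1 n, ArithmeticFunction.vonMangoldt k =
        Chebyshev.psi n := by
      intro n
      rw [Chebyshev.psi, Nat.floor_natCast]; rfl
    have hL := LSeries_eq_mul_integral_of_nonneg (fun n => ArithmeticFunction.vonMangoldt n)
      (r := 1) zero_le_one hsre ?_ (fun n => ArithmeticFunction.vonMangoldt_nonneg)
    · have hI1 : ∫ t in Ioi (1:ℝ), (∑ k ∈ Finset.Icc 1 ⌊t⌋₊,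
          ((ArithmeticFunction.vonMangoldt k : ℝ) : ℂ))
            * (t : ℂ) ^ (-(s + 1)) = ∫ t in Ioi (0:ℝ), (B t : ℂ) * cexp (-(ε + u * I) * t) := by
        rw [show (Ioi (1:ℝ)) = Real.exp '' Ioi 0 by rw [Real.image_exp_Ioi, Real.exp_zero],
          integral_image_eq_integral_abs_deriv_smul measurableSet_Ioi
          (fun x _ => (Real.hasDerivAt_exp x).hasDerivWithinAt) (Real.exp_injective.injOn)]
        refine setIntegral_congr_fun measurableSet_Ioi fun t ht => ?_
        rw [← ofReal_sum, hsum, ← Chebyshev.psi_eq_psi_coe_floor, Real.abs_exp,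
          cpow_def_of_ne_zero (by exact_mod_cast (Real.exp_pos t).ne'),
          ← ofReal_log (Real.exp_nonneg t),
          Real.log_exp, hB, real_smul]
        push_cast
        rw [show (-(ε + u * I) * t : ℂ) = t + t + t * (-(s + 1)) by rw [hs]; ring, Complex.exp_add,
          Complex.exp_add, Complex.exp_neg]
        have := Complex.exp_ne_zero (t : ℂ)
        field_simp
      have hre : (-(ε + u * I) : ℂ).re < 0 := by simp [hε]
      have hI2 : ∫ t in Ioi (0:ℝ), cexp (-(ε + u * I) * t) = 1 / (s - 1) := by
        rw [integral_exp_mul_complex_Ioi hre, hs]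
        simp only [ofReal_zero, mul_zero, Complex.exp_zero]
        rw [← neg_div_neg_eq]; simp; ring
      have hexp : IntegrableOn (fun t : ℝ => cexp (-(ε + u * I) * t)) (Ioi 0) :=
        integrableOn_exp_mul_complex_Ioi hre 0
      have hBint : IntegrableOn (fun t : ℝ => (B t : ℂ) * cexp (-(ε + u * I) * t)) (Ioi 0) := by
        refine hexp.bdd_mul (c := Real.log 4 + 4) (by fun_prop) (.of_forall fun t => ?_)
        rw [Complex.norm_real, Real.norm_eq_abs, abs_of_nonneg (hB0 t)]
        exact hB1 t
      have e : ∫ t : ℝ, (f t : ℂ) * cexp (-(ε + u * I) * t)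
          = ∫ t in Ioi (0:ℝ), ((B t : ℂ) * cexp (-(ε + u * I) * t) - cexp (-(ε + u * I) * t)) := by
        rw [← integral_Ici_eq_integral_Ioi, ← integral_indicator measurableSet_Ici]
        refine integral_congr_ae (.of_forall fun t => ?_)
        simp only
        by_cases ht : t ∈ Ici (0 : ℝ)
        · rw [indicator_of_mem ht, hfdef, indicator_of_mem ht]; push_cast; ring
        · rw [indicator_of_notMem ht, hfdef, indicator_of_notMem ht]; simp
      rw [e, integral_sub hBint hexp, hI2, hg]
      simp only
      rw [← hs, hA, hL, hI1]
      field_simp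
      ring
    · simp only [hsum]
      refine Asymptotics.IsBigO.of_bound (Real.log 4 + 4) (.of_forall fun n => ?_)
      rw [Real.norm_eq_abs, abs_of_nonneg (Chebyshev.psi_nonneg _), Real.rpow_one,
        Real.norm_of_nonneg (by positivity)]
      exact Chebyshev.psi_le_const_mul_self (by positivity)
  have hconv : ∀ a > 0, Tendsto (fun y : ℝ => ∫ t : ℝ, f t * fejer a (y - t)) atTop (𝓝 0) :=
    fun a ha => tendsto_integral_mul_fejer hf hC hneg hgc hfg ha
  have hconv' : ∀ a > 0, Tendsto (fun y : ℝ => ∫ t : ℝ, (-f t) * fejer a (y - t)) atTop (𝓝 0) := by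
    intro a ha
    simpa [integral_neg] using (hconv a ha).neg
  have hmono : ∀ x y, x ≤ y → B x * Real.exp (-(y - x)) ≤ B y := by
    intro x y hxy
    have h1 := mul_le_mul_of_nonneg_right (Chebyshev.psi_mono (Real.exp_le_exp.2 hxy))
      (Real.exp_nonneg (-y))
    have e : B x * Real.exp (-(y - x)) = Chebyshev.psi (Real.exp x) * Real.exp (-y) := by
      rw [hB]; simp only; rw [mul_assoc, ← Real.exp_add]; ring_nf
    rw [e]; exact h1
  rw [Metric.tendsto_atTop']
  intro δ0 hδ0
  set δ := min δ0 1 with hδ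
  have hδpos : 0 < δ := lt_min hδ0 one_pos
  have hδ1 : δ ≤ 1 := min_le_right _ _
  set η := δ / 16 with hη
  have hηpos : 0 < η := by positivity
  have hE : 1 - 2 * η ≤ Real.exp (-(2 * η)) := by linarith [Real.add_one_le_exp (-(2 * η))]
  have hev1 := eventually_exists_lt_of_tendsto_fejer hf hC hconv (δ := δ / 4) (by positivity) hηpos
  have hev2 := eventually_exists_lt_of_tendsto_fejer hf.neg (C := Real.log 4 + 5)
    (fun t => by simpa using hC t) hconv' (δ := δ / 4) (by positivity) hηpos
  obtain ⟨Y1, hY1⟩ := eventually_atTop.1 hev1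
  obtain ⟨Y2, hY2⟩ := eventually_atTop.1 hev2
  refine ⟨max (max Y1 (Y2 + η)) (2 * η), fun y hy => ?_⟩
  have hy1 : Y1 < y := lt_of_le_of_lt ((le_max_left _ _).trans (le_max_left _ _)) hy
  have hy2 : Y2 + η < y := lt_of_le_of_lt ((le_max_right _ _).trans (le_max_left _ _)) hy
  have hy3 : 2 * η < y := lt_of_le_of_lt (le_max_right _ _) hy
  obtain ⟨t1, ht1, hft1⟩ := hY1 (y + η) (by linarith)
  obtain ⟨t2, ht2, hft2⟩ := hY2 (y - η) (by linarith)
  rw [hfdef, indicator_of_mem (by rw [mem_Ici]; linarith [ht1.1])] at hft1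
  rw [Pi.neg_apply, hfdef, indicator_of_mem (by rw [mem_Ici]; linarith [ht2.1])] at hft2
  have m1 := hmono y t1 (by linarith [ht1.1])
  have m2 := hmono t2 y (by linarith [ht2.2])
  have q1 : Real.exp (-(2 * η)) ≤ Real.exp (-(t1 - y)) := Real.exp_le_exp.2 (by linarith [ht1.2])
  have q2 : Real.exp (-(2 * η)) ≤ Real.exp (-(y - t2)) := Real.exp_le_exp.2 (by linarith [ht2.1])
  have r1 : B y * (1 - 2 * η) ≤ B t1 := (mul_le_mul_of_nonneg_left (hE.trans q1) (hB0 y)).trans m1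
  have r2 : B t2 * (1 - 2 * η) ≤ B y := (mul_le_mul_of_nonneg_left (hE.trans q2) (hB0 t2)).trans m2
  have hη' : δ = 16 * η := by rw [hη]; ring
  rw [Real.dist_eq]
  refine lt_of_lt_of_le ?_ (min_le_left δ0 1)
  rw [← hδ, abs_lt, hη']
  constructor
  · nlinarith
  · by_contra hcon
    push Not at hcon
    nlinarith

open Filter Topology Real in
/-- The prime number theorem for the Chebyshev function `ψ`. -/
theorem tendsto_psi_div : Tendsto (fun x : ℝ => Chebyshev.psi x / x) atTop (𝓝 1) := by
  refine (tendsto_psi_exp.comp tendsto_log_atTop).congr' ?_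
  filter_upwards [eventually_gt_atTop 0] with x hx
  simp [Real.exp_neg, Real.exp_log hx, div_eq_mul_inv]

open Filter Topology Real in
/-- The prime number theorem for the Chebyshev function `θ`. -/
theorem tendsto_theta_div : Tendsto (fun x : ℝ => Chebyshev.theta x / x) atTop (𝓝 1) := by
  obtain ⟨C, hC⟩ := Chebyshev.psi_sub_theta_le_mul_sqrt
  have h1 : Tendsto (fun x : ℝ => C / Real.sqrt x) atTop (𝓝 0) :=
    tendsto_const_nhds.div_atTop tendsto_sqrt_atTop
  have h2 := tendsto_psi_div.sub h1
  rw [sub_zero] at h2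
  refine tendsto_of_tendsto_of_tendsto_of_le_of_le' h2 tendsto_psi_div ?_ ?_
  · filter_upwards [eventually_gt_atTop 0] with x hx
    have : C / Real.sqrt x = C * Real.sqrt x / x := by
      have := Real.sqrt_pos.2 hx
      field_simp
      rw [Real.sq_sqrt hx.le]
    rw [this, ← sub_div]
    exact div_le_div_of_nonneg_right (by linarith [hC x]) hx.le
  · filter_upwards [eventually_gt_atTop 0] with x hx
    exact div_le_div_of_nonneg_right (Chebyshev.theta_le_psi x) hx.le

theorem exists_mod_eq {y p B : ℕ} (h : y < B * p) : ∃ q < B, ∃ r,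
    y % p = r ∧ y = q * p + r ∧ r < p :=
  have hp : 0 < p := Nat.pos_of_ne_zero fun h0 => by simp [h0] at h
  ⟨y / p, Nat.div_lt_of_lt_mul (by rwa [mul_comm]), y % p, rfl, (Nat.div_add_mod' y p).symm,
      Nat.mod_lt _ hp⟩

theorem mod_lt_mod_of_mem_pos {p ν x a b c d : ℕ} (hx : x < p) (h1 : a * p + 2 ≤ b * ν)
    (h2 : d * ν + 2 < c * p)
    (h : (a, b, c, d) ∈ ({(1,12,1,10), (1,9,1,7), (1,6,1,5), (1,3,2,5), (5,9,4,7), (7,12,3,5),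
      (2,3,5,7), (3,4,4,5)} : Finset (ℕ × ℕ × ℕ × ℕ))) :
    (x + 7 * ν) % p < (7 * ν) % p ∨ (x + 3 * ν) % p < (5 * ν) % p ∨ (12 * ν + 2) % p < x := by
  have hν : ν < p := by
    fin_cases h <;> omega
  by_contra hcon
  push Not at hcon
  obtain ⟨h3, h4, h5⟩ := hcon
  obtain ⟨q1, hq1, r1, e1, f1, g1⟩ := exists_mod_eq (y := 7 * ν) (p := p) (B := 7) (by omega)
  obtain ⟨q2, hq2, r2, e2, f2, g2⟩ := exists_mod_eq (y := x + 7 * ν) (p := p) (B := 8) (by omega)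
  obtain ⟨q3, hq3, r3, e3, f3, g3⟩ := exists_mod_eq (y := 5 * ν) (p := p) (B := 5) (by omega)
  obtain ⟨q4, hq4, r4, e4, f4, g4⟩ := exists_mod_eq (y := x + 3 * ν) (p := p) (B := 4) (by omega)
  obtain ⟨q5, hq5, r5, e5, f5, g5⟩ := exists_mod_eq (y := 12 * ν + 2) (p := p) (B := 13) (by omega)
  rw [e1, e2] at h3
  rw [e3, e4] at h4
  rw [e5] at h5
  clear e1 e2 e3 e4 e5
  fin_cases h <;> interval_cases q1 <;> try omega
  all_goals interval_cases q3 <;> try omega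
  all_goals interval_cases q5 <;> try omega
  all_goals interval_cases q2 <;> try omega
  all_goals interval_cases q4 <;> omega

theorem mod_lt_mod_of_mem_neg {p ν x a b c d : ℕ} (hx : x < p) (h1 : a * p + 2 ≤ b * ν)
    (h2 : d * ν + 2 < c * p)
    (h : (a, b, c, d) ∈ ({(1,9,1,8), (1,6,1,5), (2,9,1,4), (1,3,2,5), (4,9,1,2),
      (2,3,3,4)} : Finset (ℕ × ℕ × ℕ × ℕ))) :
    (x + 5 * ν) % p < (5 * ν) % p ∨ (x + 3 * ν) % p < (4 * ν) % p ∨ (9 * ν + 2) % p < x := by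
  have hν : ν < p := by
    fin_cases h <;> omega
  by_contra hcon
  push Not at hcon
  obtain ⟨h3, h4, h5⟩ := hcon
  obtain ⟨q1, hq1, r1, e1, f1, g1⟩ := exists_mod_eq (y := 5 * ν) (p := p) (B := 5) (by omega)
  obtain ⟨q2, hq2, r2, e2, f2, g2⟩ := exists_mod_eq (y := x + 5 * ν) (p := p) (B := 6) (by omega)
  obtain ⟨q3, hq3, r3, e3, f3, g3⟩ := exists_mod_eq (y := 4 * ν) (p := p) (B := 4) (by omega)
  obtain ⟨q4, hq4, r4, e4, f4, g4⟩ := exists_mod_eq (y := x + 3 * ν) (p := p) (B := 4) (by omega)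
  obtain ⟨q5, hq5, r5, e5, f5, g5⟩ := exists_mod_eq (y := 9 * ν + 2) (p := p) (B := 10) (by omega)
  rw [e1, e2] at h3
  rw [e3, e4] at h4
  rw [e5] at h5
  clear e1 e2 e3 e4 e5
  fin_cases h <;> interval_cases q1 <;> try omega
  all_goals interval_cases q3 <;> try omega
  all_goals interval_cases q5 <;> try omega
  all_goals interval_cases q2 <;> try omega
  all_goals interval_cases q4 <;> omega

theorem Nat.Prime.dvd_choose_of_mod_lt {p n k : ℕ} (hp : p.Prime) (h : n % p < k % p) :
    p ∣ n.choose k := by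
  have := Fact.mk hp
  have := Choose.choose_modEq_choose_mod_mul_choose_div_nat (n := n) (k := k) (p := p)
  rw [Nat.choose_eq_zero_of_lt h, zero_mul] at this
  exact (Nat.modEq_zero_iff_dvd).1 this

/-- The absolute value of the residue of the approximating rational function at `-j - 1`. -/
def pfCoeff (a b c M j : ℕ) : ℕ := (j + a).choose a * (j + b).choose (b + c) * M.choose j

open Filter Topology in
theorem tendsto_theta_floor_div {g : ℕ → ℕ} {α : ℝ} (hα : 0 < α)
    (hg : Tendsto (fun n : ℕ => (g n : ℝ) / n) atTop (𝓝 α)) :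
    Tendsto (fun n : ℕ => Chebyshev.theta (g n) / n) atTop (𝓝 α) := by
  have h1 : Tendsto (fun n : ℕ => (g n : ℝ)) atTop atTop := by
    have : Tendsto (fun n : ℕ => (n : ℝ) * ((g n : ℝ) / n)) atTop atTop :=
      tendsto_natCast_atTop_atTop.atTop_mul_pos hα hg
    refine this.congr' ?_
    filter_upwards [eventually_gt_atTop 0] with n hn
    have : (n : ℝ) ≠ 0 := by positivity
    field_simp
  have h2 := (tendsto_theta_div.comp h1).mul hg
  rw [one_mul] at h2
  refine h2.congr' ?_
  filter_upwards [h1.eventually_gt_atTop 0] with n hn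
  simp only [Function.comp]
  field_simp

open Filter Topology in
theorem tendsto_div_div_nat {g : ℕ → ℕ} {A B : ℝ} {q : ℕ} (hq : 0 < q)
    (h1 : ∀ᶠ n : ℕ in atTop, A * n - B ≤ g n) (h2 : ∀ᶠ n : ℕ in atTop, (g n : ℝ) ≤ A * n + B) :
    Tendsto (fun n : ℕ => ((g n / q : ℕ) : ℝ) / n) atTop (𝓝 (A / q)) := by
  have hq' : (0 : ℝ) < q := by exact_mod_cast hq
  have t0 : Tendsto (fun n : ℕ => (1 : ℝ) / n) atTop (𝓝 0) := tendsto_one_div_atTop_nhds_zero_nat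
  have l1 : Tendsto (fun n : ℕ => A / q - (B / q + 1) * (1 / n)) atTop (𝓝 (A / q)) := by
    simpa using (t0.const_mul (B / q + 1)).const_sub (A / q)
  have l2 : Tendsto (fun n : ℕ => A / q + (B / q) * (1 / n)) atTop (𝓝 (A / q)) := by
    simpa using (t0.const_mul (B / q)).const_add (A / q)
  refine tendsto_of_tendsto_of_tendsto_of_le_of_le' l1 l2 ?_ ?_
  · filter_upwards [h1, eventually_gt_atTop 0] with n h hn
    have hn' : (0 : ℝ) < n := by exact_mod_cast hn
    have e : (g n : ℝ) / q < (g n / q : ℕ) + 1 := by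
      rw [div_lt_iff₀ hq']
      exact_mod_cast (by rw [mul_comm]; exact Nat.lt_mul_div_succ (g n) hq :
        g n < (g n / q + 1) * q)
    have e' : (A * n - B) / q ≤ (g n : ℝ) / q := by gcongr
    rw [le_div_iff₀ hn']
    have : (A / q - (B / q + 1) * (1 / n)) * n = (A * n - B) / q - 1 := by field_simp; ring
    linarith
  · filter_upwards [h2, eventually_gt_atTop 0] with n h hn
    have hn' : (0 : ℝ) < n := by exact_mod_cast hn
    have e : ((g n / q : ℕ) : ℝ) ≤ (g n : ℝ) / q := Nat.cast_div_le
    have e' : (g n : ℝ) / q ≤ (A * n + B) / q := by gcongr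
    rw [div_le_iff₀ hn']
    have : (A / q + (B / q) * (1 / n)) * n = (A * n + B) / q := by field_simp
    linarith

open Filter Topology Finset in
/-- A common denominator for the partial fraction coefficients divided by squares, with the primes
`p` for which `n / p` lies in prescribed intervals removed. -/
theorem exists_denominator (e₁ e₂ u N K : ℕ) (hN : 0 < N) (S : Finset (ℕ × ℕ × ℕ × ℕ))
    (hpos : ∀ t ∈ S, 0 < t.2.1 ∧ 0 < t.2.2.1 ∧ 0 < t.2.2.2 ∧
      t.1 * t.2.2.2 < t.2.2.1 * t.2.1)
    (hdisj : ∀ t ∈ S ×ˢ range K, ∀ t' ∈ S ×ˢ range K, t = t' ∨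
      t'.1.2.1 * (t.1.2.2.1 + t.1.2.2.2 * t.2) ≤ t.1.2.2.2 * (t'.1.1 + t'.1.2.1 * t'.2) ∨
      t.1.2.1 * (t'.1.2.2.1 + t'.1.2.2.2 * t'.2) ≤ t'.1.2.2.2 * (t.1.1 + t.1.2.1 * t.2))
    (ha : ∀ t ∈ S, 0 < t.1)
    (hS : ∀ p ν x a b c d : ℕ, x < p → a * p + 2 ≤ b * ν → d * ν + 2 < c * p → (a, b, c, d) ∈ S →
      (x + e₁ * ν) % p < (e₁ * ν) % p ∨ (x + e₂ * ν) % p < ((e₂ + u) * ν) % p ∨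
        (N * ν + 2) % p < x) :
    ∃ D : ℕ → ℝ, (∀ n, 0 < D n) ∧
      (∀ n j i : ℕ, 1 ≤ i → i ≤ N * n + 2 →
        ∃ m : ℤ, D n * pfCoeff (e₁ * n) (e₂ * n) (u * n) (N * n + 2) j / (i : ℝ) ^ 2 = m) ∧
      Tendsto (fun n : ℕ => Real.log (D n) / n) atTop (𝓝 (2 * N - ∑ t ∈ S ×ˢ range K,
        ((t.1.2.1 : ℝ) / (t.1.1 + t.1.2.1 * t.2 : ℕ) -
          (t.1.2.2.2 : ℝ) / (t.1.2.2.1 + t.1.2.2.2 * t.2 : ℕ)))) := by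
  set T := S ×ˢ range K with hT
  set up : (ℕ × ℕ × ℕ × ℕ) × ℕ → ℕ → ℕ := fun t n => (t.1.2.1 * n - 2) / (t.1.1 + t.1.2.1 * t.2)
  set lo : (ℕ × ℕ × ℕ × ℕ) × ℕ → ℕ → ℕ :=
    fun t n => (t.1.2.2.2 * n + 2) / (t.1.2.2.1 + t.1.2.2.2 * t.2)
  set I : ℕ → (ℕ × ℕ × ℕ × ℕ) × ℕ → Finset ℕ := fun n t => (Ioc (lo t n) (up t n)).filter Nat.Prime
  have hTS : ∀ t ∈ T, t.1 ∈ S := fun t ht => (mem_product.1 ht).1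
  have hA : ∀ t ∈ T, 0 < t.1.1 + t.1.2.1 * t.2 := fun t ht => by
    have := ha _ (hTS t ht); omega
  have hC : ∀ t ∈ T, 0 < t.1.2.2.1 + t.1.2.2.2 * t.2 := fun t ht => by
    have := (hpos _ (hTS t ht)).2.1; omega
  have key : ∀ n, ∀ t ∈ T, ∀ t' ∈ T,
      t'.1.2.1 * (t.1.2.2.1 + t.1.2.2.2 * t.2) ≤ t.1.2.2.2 * (t'.1.1 + t'.1.2.1 * t'.2) →
      up t' n ≤ lo t n := by
    intro n t ht t' ht' h
    rw [Nat.le_div_iff_mul_le (hC t ht)]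
    have h1 : up t' n * (t'.1.1 + t'.1.2.1 * t'.2) ≤ t'.1.2.1 * n - 2 := Nat.div_mul_le_self _ _
    refine le_trans ?_ (Nat.le_add_right _ 2)
    refine Nat.le_of_mul_le_mul_right ?_ (hA t' ht')
    calc up t' n * (t.1.2.2.1 + t.1.2.2.2 * t.2) * (t'.1.1 + t'.1.2.1 * t'.2)
        = (up t' n * (t'.1.1 + t'.1.2.1 * t'.2)) * (t.1.2.2.1 + t.1.2.2.2 * t.2) := by ring
      _ ≤ (t'.1.2.1 * n) * (t.1.2.2.1 + t.1.2.2.2 * t.2) :=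
          Nat.mul_le_mul_right _ (h1.trans (Nat.sub_le _ _))
      _ = (t'.1.2.1 * (t.1.2.2.1 + t.1.2.2.2 * t.2)) * n := by ring
      _ ≤ (t.1.2.2.2 * (t'.1.1 + t'.1.2.1 * t'.2)) * n := by gcongr
      _ = _ := by ring
  have hdis : ∀ n, Set.PairwiseDisjoint (T : Set _) (I n) := by
    intro n t ht t' ht' hne
    rw [Function.onFun, disjoint_left]
    intro p hp hp'
    simp only [I, mem_filter, mem_Ioc] at hp hp'
    rcases hdisj t ht t' ht' with h | h | h
    · exact hne h
    · have := key n t ht t' ht' h; omega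
    · have := key n t' ht' t ht h; omega
  set Δ : ℕ → ℕ := fun n => ∏ p ∈ T.biUnion (I n), p with hΔ
  have hprime : ∀ n, ∀ p ∈ T.biUnion (I n), p.Prime := by
    intro n p hp
    obtain ⟨t, ht, h⟩ := mem_biUnion.1 hp
    exact (mem_filter.1 h).2
  have hΔpos : ∀ n, 0 < Δ n := fun n => prod_pos fun p hp => (hprime n p hp).pos
  have hdvd : ∀ n j, Δ n ∣ pfCoeff (e₁ * n) (e₂ * n) (u * n) (N * n + 2) j := by
    intro n j
    refine prod_primes_dvd _ (fun p hp => (hprime n p hp).prime) fun p hp => ?_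
    have hpp := hprime n p hp
    obtain ⟨t, ht, h⟩ := mem_biUnion.1 hp
    simp only [I, mem_filter, mem_Ioc] at h
    obtain ⟨⟨hl, hu⟩, -⟩ := h
    obtain ⟨⟨a, b, c, d⟩, k⟩ := t
    simp only [lo, up] at hl hu
    have hA' := hA _ ht
    have hC' := hC _ ht
    simp only at hA' hC'
    rw [Nat.div_lt_iff_lt_mul hC'] at hl
    rw [Nat.le_div_iff_mul_le hA'] at hu
    have hmem := hTS _ ht
    obtain ⟨hb, -, hd, -⟩ := hpos _ hmem
    have ha' := ha _ hmem
    simp only at hb hd ha' hmem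
    have hp2 := hpp.pos
    have hu' : p * (a + b * k) + 2 ≤ b * n := by
      have : 0 < p * (a + b * k) := by positivity
      omega
    have hkn : k * p ≤ n := by
      refine Nat.le_of_mul_le_mul_left (?_ : b * (k * p) ≤ b * n) hb
      nlinarith [Nat.zero_le (p * a)]
    obtain ⟨ν, rfl⟩ := Nat.exists_eq_add_of_le hkn
    have e : ∀ r : ℕ, (r * (k * p + ν)) % p = (r * ν) % p := fun r => by
      rw [show r * (k * p + ν) = r * ν + (r * k) * p by ring, Nat.add_mul_mod_self_right]
    have e' : ∀ r : ℕ, (j + r * (k * p + ν)) % p = (j % p + r * ν) % p := fun r => by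
      rw [Nat.add_mod, e, ← Nat.add_mod, Nat.mod_add_mod]
    rcases hS p ν (j % p) a b c d (Nat.mod_lt _ hp2) (by nlinarith) (by nlinarith) hmem
        with h | h | h
    · refine Dvd.dvd.mul_right (Dvd.dvd.mul_right (hpp.dvd_choose_of_mod_lt ?_) _) _
      rwa [e', e]
    · refine Dvd.dvd.mul_right (Dvd.dvd.mul_left (hpp.dvd_choose_of_mod_lt ?_) _) _
      rwa [e', ← add_mul, e]
    · refine Dvd.dvd.mul_left (hpp.dvd_choose_of_mod_lt ?_) _
      rwa [Nat.add_mod, e, ← Nat.add_mod]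
  refine ⟨fun n => (Nat.lcmUpto (N * n + 2) : ℝ) ^ 2 / Δ n, fun n => ?_, ?_, ?_⟩
  · have := Nat.lcmUpto_pos (N * n + 2)
    have := hΔpos n
    positivity
  · intro n j i hi1 hi2
    obtain ⟨m, hm⟩ := hdvd n j
    have : i ∣ Nat.lcmUpto (N * n + 2) :=
      Finset.dvd_lcm (f := id) (s := Icc 1 (N * n + 2)) (mem_Icc.2 ⟨hi1, hi2⟩)
    obtain ⟨r, hr⟩ := this
    refine ⟨r ^ 2 * m, ?_⟩
    have h1 : (Δ n : ℝ) ≠ 0 := by exact_mod_cast (hΔpos n).ne'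
    have h2 : (i : ℝ) ≠ 0 := by positivity
    simp only [hm, hr]
    push_cast
    field_simp
  · have hlog : ∀ n, Real.log (Δ n) = ∑ t ∈ T, ∑ p ∈ I n t, Real.log p := by
      intro n
      rw [hΔ, Nat.cast_prod, Real.log_prod (fun p hp => by exact_mod_cast (hprime n p hp).ne_zero),
        sum_biUnion (hdis n)]
    have hlo : ∀ t ∈ T, Tendsto (fun n : ℕ => Chebyshev.theta (lo t n) / n) atTop
        (𝓝 ((t.1.2.2.2 : ℝ) / (t.1.2.2.1 + t.1.2.2.2 * t.2 : ℕ))) := by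
      intro t ht
      have hc := hC t ht
      have hd := (hpos _ (hTS t ht)).2.2.1
      refine tendsto_theta_floor_div (by positivity) (tendsto_div_div_nat (B := 2) hc ?_ ?_)
      · exact .of_forall fun n => by push_cast; linarith
      · exact .of_forall fun n => by push_cast; linarith
    have hup : ∀ t ∈ T, Tendsto (fun n : ℕ => Chebyshev.theta (up t n) / n) atTop
        (𝓝 ((t.1.2.1 : ℝ) / (t.1.1 + t.1.2.1 * t.2 : ℕ))) := by
      intro t ht
      have hc := hA t ht
      have hd := (hpos _ (hTS t ht)).1
      refine tendsto_theta_floor_div (by positivity) (tendsto_div_div_nat (B := 2) hc ?_ ?_)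
      · refine .of_forall fun n => ?_
        have : t.1.2.1 * n ≤ t.1.2.1 * n - 2 + 2 := by omega
        have : ((t.1.2.1 * n : ℕ) : ℝ) ≤ ((t.1.2.1 * n - 2 + 2 : ℕ) : ℝ) := by exact_mod_cast this
        push_cast at this
        linarith
      · refine .of_forall fun n => ?_
        have : t.1.2.1 * n - 2 ≤ t.1.2.1 * n + 2 := by omega
        exact_mod_cast this
    have hpsi : Tendsto (fun n : ℕ => Real.log (Nat.lcmUpto (N * n + 2)) / n) atTop
        (𝓝 N) := by
      have h1 : Tendsto (fun n : ℕ => ((N * n + 2 : ℕ) : ℝ)) atTop atTop := by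
        refine tendsto_natCast_atTop_atTop.comp ?_
        refine tendsto_atTop_mono (fun n => ?_) tendsto_id
        simp only [id]; nlinarith
      have h2 : Tendsto (fun n : ℕ => ((N * n + 2 : ℕ) : ℝ) / n) atTop (𝓝 N) := by
        have := tendsto_div_div_nat (g := fun n => N * n + 2) (A := N) (B := 2) (q := 1) one_pos
          (.of_forall fun n => by push_cast; linarith) (.of_forall fun n => by push_cast; linarith)
        simpa using this
      have h3 := (tendsto_psi_div.comp h1).mul h2
      rw [one_mul] at h3
      refine h3.congr' ?_
      filter_upwards [h1.eventually_gt_atTop 0] with n hn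
      simp only [Function.comp]
      rw [Chebyshev.psi_eq_log_lcmUpto]
      field_simp
    have hΔlim : Tendsto (fun n : ℕ => Real.log (Δ n) / n) atTop (𝓝 (∑ t ∈ T,
        ((t.1.2.1 : ℝ) / (t.1.1 + t.1.2.1 * t.2 : ℕ) -
          (t.1.2.2.2 : ℝ) / (t.1.2.2.1 + t.1.2.2.2 * t.2 : ℕ)))) := by
      have hs := tendsto_finsetSum T fun t ht => (hup t ht).sub (hlo t ht)
      refine hs.congr' ?_
      have hev : ∀ t ∈ T, ∀ᶠ n : ℕ in atTop, lo t n ≤ up t n := by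
        intro t ht
        have hlt : (t.1.2.2.2 : ℝ) / (t.1.2.2.1 + t.1.2.2.2 * t.2 : ℕ) <
            (t.1.2.1 : ℝ) / (t.1.1 + t.1.2.1 * t.2 : ℕ) := by
          have h1 := hA t ht
          have h2 := hC t ht
          rw [div_lt_div_iff₀ (by exact_mod_cast h2) (by exact_mod_cast h1)]
          have := (hpos _ (hTS t ht)).2.2.2
          have : t.1.2.2.2 * (t.1.1 + t.1.2.1 * t.2) < t.1.2.1 * (t.1.2.2.1 + t.1.2.2.2 * t.2) := by
            nlinarith
          exact_mod_cast this
        filter_upwards [(hlo t ht).eventually_lt (hup t ht) hlt, eventually_gt_atTop 0]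
            with n hn hn0
        rw [div_lt_div_iff_of_pos_right (by exact_mod_cast hn0)] at hn
        by_contra! hcon
        exact absurd hn (not_lt.2 (Chebyshev.theta_mono (by exact_mod_cast hcon.le)))
      filter_upwards [(T.eventually_all).2 hev] with n hn
      rw [hlog, sum_div]
      refine sum_congr rfl fun t ht => ?_
      rw [← sub_div, Chebyshev.theta, Chebyshev.theta, Nat.floor_natCast, Nat.floor_natCast,
        ← Finset.Ioc_union_Ioc_eq_Ioc (Nat.zero_le _) (hn t ht), filter_union, sum_union,
        add_sub_cancel_left]
      refine disjoint_filter_filter (disjoint_left.2 fun x hx hx' => ?_)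
      have := mem_Ioc.1 hx
      have := mem_Ioc.1 hx'
      omega
    have := (hpsi.const_mul 2).sub hΔlim
    refine this.congr fun n => ?_
    have h1 : (Δ n : ℝ) ≠ 0 := by exact_mod_cast (hΔpos n).ne'
    have h2 : (Nat.lcmUpto (N * n + 2) : ℝ) ≠ 0 := by
      exact_mod_cast Nat.lcmUpto_ne_zero _
    rw [Real.log_div (by positivity) h1, Real.log_pow]
    push_cast
    ring

open Filter Topology Finset in
theorem exists_denominator_pos :
    ∃ D : ℕ → ℝ, (∀ n, 0 < D n) ∧
      (∀ n j i : ℕ, 1 ≤ i → i ≤ 12 * n + 2 →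
        ∃ m : ℤ, D n * pfCoeff (7 * n) (3 * n) (2 * n) (12 * n + 2) j / (i : ℝ) ^ 2 = m) ∧
      ∀ᶠ n in atTop, D n ≤ Real.exp (18.08 * n) := by
  obtain ⟨D, h1, h2, h3⟩ := exists_denominator 7 3 2 12 2 (by norm_num)
    {(1,12,1,10), (1,9,1,7), (1,6,1,5), (1,3,2,5), (5,9,4,7), (7,12,3,5), (2,3,5,7), (3,4,4,5)}
    (by decide) (by decide +kernel) (by decide)
    (fun p ν x a b c d hx h1 h2 h => mod_lt_mod_of_mem_pos hx h1 h2 h)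
  refine ⟨D, h1, h2, ?_⟩
  have := h3.eventually_lt_const (u := 18.08) (by
    rw [Finset.sum_product]
    simp [Finset.sum_range_succ]
    norm_num)
  filter_upwards [this, eventually_gt_atTop 0] with n hn hn0
  rw [div_lt_iff₀ (by exact_mod_cast hn0)] at hn
  rw [← Real.log_le_iff_le_exp (h1 n)]
  exact hn.le

open Filter Topology Finset in
theorem exists_denominator_neg :
    ∃ D : ℕ → ℝ, (∀ n, 0 < D n) ∧
      (∀ n j i : ℕ, 1 ≤ i → i ≤ 9 * n + 2 →
        ∃ m : ℤ, D n * pfCoeff (5 * n) (3 * n) (1 * n) (9 * n + 2) j / (i : ℝ) ^ 2 = m) ∧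
      ∀ᶠ n in atTop, D n ≤ Real.exp (14.38 * n) := by
  obtain ⟨D, h1, h2, h3⟩ := exists_denominator 5 3 1 9 4 (by norm_num)
    {(1,9,1,8), (1,6,1,5), (2,9,1,4), (1,3,2,5), (4,9,1,2), (2,3,3,4)}
    (by decide) (by decide +kernel) (by decide)
    (fun p ν x a b c d hx h1 h2 h => mod_lt_mod_of_mem_neg hx h1 h2 h)
  refine ⟨D, h1, h2, ?_⟩
  have := h3.eventually_lt_const (u := 14.38) (by
    rw [Finset.sum_product]
    simp [Finset.sum_range_succ]
    norm_num)
  filter_upwards [this, eventually_gt_atTop 0] with n hn hn0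
  rw [div_lt_iff₀ (by exact_mod_cast hn0)] at hn
  rw [← Real.log_le_iff_le_exp (h1 n)]
  exact hn.le

open Polynomial in
theorem Polynomial.summable_eval_mul_pow (f : ℝ[X]) {x : ℝ} (hx : |x| < 1) :
    Summable fun s : ℕ => |f.eval (s : ℝ)| * |x| ^ (s + 1) := by
  induction f using Polynomial.induction_on' with
  | add p q hp hq =>
    refine Summable.of_nonneg_of_le (fun s => by positivity) (fun s => ?_) (hp.add hq)
    rw [← add_mul, eval_add]
    gcongr
    exact abs_add_le _ _
  | monomial n a =>
    have h := (summable_pow_mul_geometric_of_norm_lt_one (R := ℝ) n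
      (r := |x|) (by simpa using hx)).mul_left (|a| * |x|)
    refine h.congr fun s => ?_
    rw [eval_monomial, abs_mul, abs_pow, Nat.abs_cast, pow_succ]
    ring

open Polynomial in
/-- The functional `f ↦ ∑ (v s * f s + w s * f' s) x ^ (s + 1)` on polynomials. -/
noncomputable def jetSum (x : ℝ) (v w : ℕ → ℝ) (f : ℝ[X]) : ℝ :=
  ∑' s : ℕ, (v s * f.eval (s : ℝ) + w s * (derivative f).eval (s : ℝ)) * x ^ (s + 1)

section jetSum
open Polynomial
variable {x : ℝ} {v w : ℕ → ℝ} {C : ℝ}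

theorem summable_jetSum (hx : |x| < 1) (hv : ∀ s, |v s| ≤ C) (hw : ∀ s, |w s| ≤ C) (f : ℝ[X]) :
    Summable fun s : ℕ =>
      (v s * f.eval (s : ℝ) + w s * (derivative f).eval (s : ℝ)) * x ^ (s + 1) := by
  refine Summable.of_norm_bounded
    (((f.summable_eval_mul_pow hx).add ((derivative f).summable_eval_mul_pow hx)).mul_left C)
    fun s => ?_
  rw [Real.norm_eq_abs, abs_mul, abs_pow, ← add_mul, ← mul_assoc]
  gcongr
  refine (abs_add_le _ _).trans ?_
  rw [abs_mul, abs_mul, mul_add]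
  have := hv s
  have := hw s
  gcongr

theorem jetSum_add (hx : |x| < 1) (hv : ∀ s, |v s| ≤ C) (hw : ∀ s, |w s| ≤ C) (f g : ℝ[X]) :
    jetSum x v w (f + g) = jetSum x v w f + jetSum x v w g := by
  rw [jetSum, jetSum, jetSum, ← (summable_jetSum hx hv hw f).tsum_add (summable_jetSum hx hv hw g)]
  refine tsum_congr fun s => ?_
  rw [eval_add, derivative_add, eval_add]
  ring

theorem jetSum_C_mul (a : ℝ) (f : ℝ[X]) : jetSum x v w (.C a * f) = a * jetSum x v w f := by
  rw [jetSum, jetSum, ← tsum_mul_left]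
  refine tsum_congr fun s => ?_
  rw [derivative_C_mul, eval_mul, eval_mul, eval_C]
  ring

theorem jetSum_mul_shift (hx : |x| < 1) (hv : ∀ s, |v s| ≤ C) (hw : ∀ s, |w s| ≤ C)
    {A B : ℝ[X]} (hv0 : v 0 = 0) (hw0 : w 0 = 0)
    (h1 : ∀ s : ℕ, v (s + 1) * A.eval (s + 1 : ℝ) + w (s + 1) * (derivative A).eval (s + 1 : ℝ) =
      v s * B.eval (s : ℝ) + w s * (derivative B).eval (s : ℝ))
    (h2 : ∀ s : ℕ, w (s + 1) * A.eval (s + 1 : ℝ) = w s * B.eval (s : ℝ)) (h : ℝ[X]) :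
    jetSum x v w (A * h) = x * jetSum x v w (B * h.comp (X + 1)) := by
  rw [jetSum, (summable_jetSum hx hv hw _).tsum_eq_zero_add, jetSum, ← tsum_mul_left]
  simp only [hv0, hw0, zero_mul, add_zero, zero_add]
  refine tsum_congr fun s => ?_
  simp only [derivative_mul, eval_add, eval_mul, derivative_comp, eval_comp, eval_X, eval_one,
    Nat.cast_add, Nat.cast_one, derivative_add, derivative_X, derivative_one, add_zero]
  have e1 := h1 s
  have e2 := h2 s
  linear_combination x ^ (s + 1) * x * (eval (s + 1 : ℝ) h * e1 +
    eval (s + 1 : ℝ) (derivative h) * e2)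

theorem jetSum_eq_zero (hx : |x| < 1) (hv : ∀ s, |v s| ≤ C) (hw : ∀ s, |w s| ≤ C)
    {A B : ℝ[X]} (hv0 : v 0 = 0) (hw0 : w 0 = 0)
    (h1 : ∀ s : ℕ, v (s + 1) * A.eval (s + 1 : ℝ) + w (s + 1) * (derivative A).eval (s + 1 : ℝ) =
      v s * B.eval (s : ℝ) + w s * (derivative B).eval (s : ℝ))
    (h2 : ∀ s : ℕ, w (s + 1) * A.eval (s + 1 : ℝ) = w s * B.eval (s : ℝ))
    (hA : A.Monic) (hB : B.Monic) (hA3 : A.natDegree = 3) (hB3 : B.natDegree = 3)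
    (h0 : ∀ k < 3, jetSum x v w (X ^ k) = 0) (f : ℝ[X]) : jetSum x v w f = 0 := by
  have key : ∀ n (f : ℝ[X]), f.natDegree < n → jetSum x v w f = 0 := by
    intro n
    induction n with
    | zero => intro f hf; omega
    | succ n ih =>
      have mono : jetSum x v w (X ^ n) = 0 := by
        rcases lt_or_ge n 3 with hn | hn
        · exact h0 n hn
        · obtain ⟨m, rfl⟩ := Nat.exists_eq_add_of_le hn
          have hx1 : (1 - x) ≠ 0 := by
            have := (abs_lt.1 hx).2
            linarith
          have hXm : (X ^ m : ℝ[X]).comp (X + 1) = (X + 1) ^ m := by simp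
          have hX1 : ((X : ℝ[X]) + 1).Monic := by simpa using monic_X_add_C (1 : ℝ)
          have d1 : (A * X ^ m).natDegree = 3 + m := by
            rw [hA.natDegree_mul (monic_X_pow m), hA3, natDegree_X_pow]
          have d2 : (B * (X + 1) ^ m).natDegree = 3 + m := by
            rw [hB.natDegree_mul (hX1.pow m), hB3, hX1.natDegree_pow]
            have : ((X : ℝ[X]) + 1).natDegree = 1 := by simpa using natDegree_X_add_C (1 : ℝ)
            rw [this, mul_one]
          have r1 : ∀ p : ℝ[X], p.Monic → p.natDegree = 3 + m →
              jetSum x v w p = jetSum x v w (X ^ (3 + m)) := by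
            intro p hp hd
            have hlt : (p - X ^ (3 + m)).natDegree < 3 + m := by
              have hdeg : p.degree = (X ^ (3 + m) : ℝ[X]).degree := by
                rw [degree_X_pow, degree_eq_natDegree hp.ne_zero, hd]
              have := degree_sub_lt_left hdeg hp.ne_zero (by rw [hp, monic_X_pow])
              by_cases hz : p - X ^ (3 + m) = 0
              · rw [hz, natDegree_zero]; omega
              · exact (natDegree_lt_natDegree hz this).trans_eq hd
            have := jetSum_add hx hv hw (p - X ^ (3 + m)) (X ^ (3 + m))
            rw [sub_add_cancel, ih _ hlt, zero_add] at this
            exact this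
          have e := jetSum_mul_shift hx hv hw hv0 hw0 h1 h2 (X ^ m)
          rw [hXm, r1 _ (hA.mul (monic_X_pow m)) d1, r1 _ (hB.mul (hX1.pow m)) d2] at e
          have : (1 - x) * jetSum x v w (X ^ (3 + m)) = 0 := by linear_combination e
          exact (mul_eq_zero.1 this).resolve_left hx1
      intro f hf
      have hf' : f = f.erase n + .C (f.coeff n) * X ^ n := by
        conv_lhs => rw [← f.monomial_add_erase n]
        rw [add_comm, C_mul_X_pow_eq_monomial]
      rw [hf', jetSum_add hx hv hw, jetSum_C_mul, mono, mul_zero, add_zero]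
      by_cases hz : f.erase n = 0
      · rw [hz]; simp [jetSum]
      · refine ih _ ?_
        have h1 : (f.erase n).natDegree ≤ n :=
            (natDegree_le_natDegree (degree_erase_le f n)).trans (by omega)
        refine lt_of_le_of_ne h1 fun h => ?_
        have : (f.erase n).coeff n = 0 := by simp
        nth_rw 2 [← h] at this
        rw [coeff_natDegree, leadingCoeff_eq_zero] at this
        exact hz this
  exact key _ f (Nat.lt_succ_self _)

/-- A polynomial with value `1` at `s₀` and double zeros at `s₀ + 1, …, s₀ + K`. -/
noncomputable def cutoffPoly (s₀ K : ℕ) : ℝ[X] :=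
  ∏ k ∈ Finset.range K, (1 - .C (1 / (k + 1 : ℝ)) * (X - .C (s₀ : ℝ)))

theorem cutoffPoly_eval (s₀ K d : ℕ) : (cutoffPoly s₀ K).eval ((s₀ + d : ℕ) : ℝ) =
    ∏ k ∈ Finset.range K, (1 - (d : ℝ) / (k + 1)) := by
  rw [cutoffPoly, eval_prod]
  refine Finset.prod_congr rfl fun k _ => ?_
  simp
  ring

theorem cutoffPoly_eval_eq_zero {s₀ K d : ℕ} (h1 : 0 < d) (h2 : d ≤ K) :
    (cutoffPoly s₀ K).eval ((s₀ + d : ℕ) : ℝ) = 0 := by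
  rw [cutoffPoly_eval]
  refine Finset.prod_eq_zero (i := d - 1) (Finset.mem_range.2 (by omega)) ?_
  obtain ⟨e, rfl⟩ := Nat.exists_eq_add_of_le' h1
  push_cast
  have : (e : ℝ) + 1 ≠ 0 := by positivity
  field_simp
  simp

theorem cutoffPoly_abs_eval {s₀ K d : ℕ} (h : K < d) :
    |(cutoffPoly s₀ K).eval ((s₀ + d : ℕ) : ℝ)| = (d - 1).choose K := by
  obtain ⟨e, rfl⟩ := Nat.exists_eq_add_of_le' (Nat.pos_of_ne_zero (by omega : d ≠ 0))
  rw [cutoffPoly_eval, Finset.abs_prod, add_tsub_cancel_right]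
  induction K with
  | zero => simp
  | succ K ih =>
    rw [Finset.prod_range_succ, ih (by omega)]
    have h1 : ((e.choose (K + 1) : ℕ) : ℝ) * (K + 1) = e.choose K * (e - K) := by
      have := Nat.choose_succ_right_eq e K
      have h2 : ((e - K : ℕ) : ℝ) = e - K := by rw [Nat.cast_sub (by omega)]
      rw [← h2]
      exact_mod_cast this
    have h3 : (K : ℝ) + 1 ≤ e := by exact_mod_cast (by omega : K + 1 ≤ e)
    have h4 : |1 - ((e + 1 : ℕ) : ℝ) / (K + 1)| = (e - K) / (K + 1) := by
      rw [abs_sub_comm, abs_of_nonneg]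
      · push_cast; field_simp; ring
      · rw [sub_nonneg, le_div_iff₀ (by positivity)]; push_cast; linarith
    rw [h4, ← mul_div_assoc, ← h1]
    field_simp

theorem cutoffPoly_abs_derivative {s₀ K d : ℕ} (h : K < d) :
    |(derivative (cutoffPoly s₀ K)).eval ((s₀ + d : ℕ) : ℝ)| ≤ K * (d - 1).choose K := by
  rw [← cutoffPoly_abs_eval h (s₀ := s₀)]
  set y : ℝ := ((s₀ + d : ℕ) : ℝ) with hy
  have hfac : ∀ k ∈ Finset.range K,
      (1 - .C (1 / (k + 1 : ℝ)) * (X - .C (s₀ : ℝ)) : ℝ[X]).eval y = ((k + 1) - d) / (k + 1) := by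
    intro k _
    rw [hy]
    simp
    field_simp
  have hsum : (derivative (cutoffPoly s₀ K)).eval y = ∑ k ∈ Finset.range K,
      (cutoffPoly s₀ K).eval y * (-1 / ((k + 1) - d)) := by
    rw [cutoffPoly, derivative_prod_finset, eval_finsetSum]
    refine Finset.sum_congr rfl fun k hk => ?_
    rw [← Finset.mul_prod_erase _ _ hk, eval_mul, eval_mul, hfac k hk]
    have hk' : (k : ℝ) + 1 < d := by
      have := Finset.mem_range.1 hk
      exact_mod_cast (by omega : k + 1 < d)
    have : (k : ℝ) + 1 - d ≠ 0 := by linarith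
    have : (k : ℝ) + 1 ≠ 0 := by positivity
    simp
    field_simp
  rw [hsum, ← Finset.mul_sum, abs_mul, mul_comm (K : ℝ)]
  gcongr
  refine (Finset.abs_sum_le_sum_abs _ _).trans ?_
  refine (Finset.sum_le_card_nsmul _ _ 1 fun k hk => ?_).trans (by simp)
  have hk' : (k : ℝ) + 1 + 1 ≤ d := by
    have := Finset.mem_range.1 hk
    exact_mod_cast (by omega : k + 1 + 1 ≤ d)
  rw [abs_div, abs_neg, abs_one, abs_sub_comm, abs_of_pos (by linarith), div_le_one (by linarith)]
  linarith

open Filter Topology in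
theorem exists_jetSum_ne_zero (hx0 : x ≠ 0) (hx : |x| ≤ 1 / 5) (hv : ∀ s, |v s| ≤ C)
    (hw : ∀ s, |w s| ≤ C) {s₀ : ℕ} (hvs : ∀ s < s₀, v s = 0) (hws : ∀ s ≤ s₀, w s = 0)
    (hv0 : v s₀ ≠ 0) : ∃ f : ℝ[X], jetSum x v w f ≠ 0 := by
  by_contra! hcon
  have hC : 0 ≤ C := (abs_nonneg _).trans (hv 0)
  set F : ℕ → ℕ → ℝ := fun K d => (v (s₀ + d) * ((cutoffPoly s₀ K) ^ 2).eval ((s₀ + d : ℕ) : ℝ) +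
    w (s₀ + d) * (derivative ((cutoffPoly s₀ K) ^ 2)).eval ((s₀ + d : ℕ) : ℝ)) *
      x ^ (s₀ + d + 1) with hF
  have hx1 : |x| < 1 := by linarith
  have hsum : ∀ K, ∑' d, F K d = 0 := by
    intro K
    have h := hcon ((cutoffPoly s₀ K) ^ 2)
    rw [jetSum, ← (summable_jetSum hx1 hv hw _).sum_add_tsum_nat_add s₀, Finset.sum_eq_zero,
        zero_add] at h
    · rw [← h]
      refine tsum_congr fun d => ?_
      rw [add_comm d s₀]
    · intro s hs
      have := Finset.mem_range.1 hs
      rw [hvs s this, hws s this.le]; simp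
  set G : ℕ → ℝ := fun d => C * (1 + 2 * d) * 4 ^ d * (1 / 5) ^ d
  have hG : Summable G := by
    have h1 := (summable_pow_mul_geometric_of_norm_lt_one (R := ℝ) 1
      (r := 4 / 5) (by rw [Real.norm_eq_abs, abs_of_pos] <;> norm_num)).mul_left (2 * C)
    have h0 := (summable_pow_mul_geometric_of_norm_lt_one (R := ℝ) 0
      (r := 4 / 5) (by rw [Real.norm_eq_abs, abs_of_pos] <;> norm_num)).mul_left C
    refine (h0.add h1).congr fun d => ?_
    simp only [G, div_pow, one_pow]
    ring
  have hlim : Tendsto (fun K => ∑' d, F K d) atTop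
      (𝓝 (∑' d, if d = 0 then v s₀ * x ^ (s₀ + 1) else 0)) := by
    refine tendsto_tsum_of_dominated_convergence hG (fun d => ?_) (.of_forall fun K d => ?_)
    · rcases Nat.eq_zero_or_pos d with rfl | hd
      · refine tendsto_const_nhds.congr fun K => ?_
        simp only [hF, add_zero, hws s₀ le_rfl, zero_mul, eval_pow]
        have := cutoffPoly_eval s₀ K 0
        simp only [add_zero, Nat.cast_zero, zero_div, sub_zero, Finset.prod_const_one] at this
        rw [this]; simp
      · refine tendsto_const_nhds.congr' ?_
        filter_upwards [eventually_ge_atTop d] with K hK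
        simp only [hF, derivative_pow, eval_pow, eval_mul, cutoffPoly_eval_eq_zero hd hK]
        simp [hd.ne']
    · have hxp : |x| ^ (s₀ + d + 1) ≤ (1 / 5 : ℝ) ^ d := by
        calc |x| ^ (s₀ + d + 1) ≤ |x| ^ d :=
              pow_le_pow_of_le_one (abs_nonneg _) hx1.le (by omega)
          _ ≤ _ := by gcongr
      simp only [hF, G, Real.norm_eq_abs, abs_mul, abs_pow]
      have main : |v (s₀ + d) * eval ((s₀ + d : ℕ) : ℝ) (cutoffPoly s₀ K ^ 2) +
          w (s₀ + d) * eval ((s₀ + d : ℕ) : ℝ) (derivative (cutoffPoly s₀ K ^ 2))| ≤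
          C * (1 + 2 * d) * 4 ^ d := by
        rcases Nat.eq_zero_or_pos d with rfl | hd
        · have := cutoffPoly_eval s₀ K 0
          simp only [add_zero, Nat.cast_zero, zero_div, sub_zero, Finset.prod_const_one] at this
          simp only [add_zero, hws s₀ le_rfl, zero_mul, eval_pow]
          rw [this]
          simpa using hv s₀
        rcases lt_or_ge K d with hK | hK
        · have e1 := cutoffPoly_abs_eval (s₀ := s₀) hK
          have e2 := cutoffPoly_abs_derivative (s₀ := s₀) hK
          have hch : (((d - 1).choose K : ℕ) : ℝ) ≤ 2 ^ d := by
            have : (d - 1).choose K ≤ 2 ^ (d - 1) := Nat.choose_le_two_pow _ _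
            have h2 : 2 ^ (d - 1) ≤ 2 ^ d := Nat.pow_le_pow_right (by norm_num) (by omega)
            exact_mod_cast this.trans h2
          have hKd : (K : ℝ) ≤ d := by exact_mod_cast hK.le
          simp only [derivative_pow, eval_pow, eval_mul, Nat.cast_ofNat, eval_C]
          refine (abs_add_le _ _).trans ?_
          simp only [abs_mul, abs_pow, e1, Nat.add_one_sub_one, pow_one, abs_two]
          have e4 : (4 : ℝ) ^ d = 2 ^ d * 2 ^ d := by rw [← mul_pow]; norm_num
          calc _ ≤ C * (2 ^ d) ^ 2 + C * (2 * 2 ^ d * (d * 2 ^ d)) := by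
                have h1 := hv (s₀ + d)
                have h2 := hw (s₀ + d)
                gcongr
                refine e2.trans ?_
                gcongr
            _ = _ := by rw [e4]; ring
        · simp only [derivative_pow, eval_pow, eval_mul, cutoffPoly_eval_eq_zero hd hK]
          simp
          positivity
      gcongr
  simp only [hsum, tsum_ite_eq] at hlim
  have := tendsto_nhds_unique hlim tendsto_const_nhds
  exact mul_ne_zero hv0 (pow_ne_zero _ hx0) this

end jetSum

section ratFun
variable {F : Type*} [Field F]

/-- The numerator `∏ (s - i) ∏ (s + c - i)` of the approximating rational function. -/
def ratNum (a b c : ℕ) (s : F) : F :=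
  (∏ i ∈ Finset.range a, (s - i)) * ∏ i ∈ Finset.range (b + c), (s + c - i)

/-- The approximating rational function. -/
def ratFun (a b c M : ℕ) (s : F) : F :=
  (M.factorial : F) / (a.factorial * (b + c).factorial) * ratNum a b c s /
    ∏ i ∈ Finset.range (M + 1), (s + 1 + i)

/-- The residue of `ratFun` at `-j - 1`. -/
def ratRes (a b c M j : ℕ) : ℤ := (-1) ^ (a + b + c + j) * pfCoeff a b c M j

/-- The sum `∑ (e j) / (s + j + 1) ^ r` over `j ≤ M`. -/
def pfSum (e : ℕ → F) (M r : ℕ) (s : F) : F := ∑ j ∈ Finset.range (M + 1), e j / (s + j + 1) ^ r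

theorem prod_range_sub_natCast (n : ℕ) :
    ∏ i ∈ Finset.range n, ((i : F) - n) = (-1) ^ n * n.factorial := by
  have : ∏ i ∈ Finset.range n, ((i : F) - n) = ∏ i ∈ Finset.range n, (-1 * ((i + 1 : ℕ) : F)) := by
    rw [← Finset.prod_range_reflect]
    refine Finset.prod_congr rfl fun i hi => ?_
    have := Finset.mem_range.1 hi
    have e : n = (n - 1 - i) + (i + 1) := by omega
    nth_rw 2 [e]
    push_cast
    ring
  rw [this, Finset.prod_mul_distrib, Finset.prod_const, Finset.card_range, ← Nat.cast_prod,
    Finset.prod_range_add_one_eq_factorial]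

theorem prod_range_erase_sub_natCast {M i : ℕ} (hi : i ≤ M) :
    ∏ j ∈ (Finset.range (M + 1)).erase i, ((j : F) - i) =
      (-1) ^ i * i.factorial * (M - i).factorial := by
  obtain ⟨k, rfl⟩ := Nat.exists_eq_add_of_le hi
  have h1 : ∏ j ∈ (Finset.range (i + k + 1)).erase i, ((j : F) - i) =
      ∏ j ∈ Finset.range (i + 1 + k), if j = i then 1 else ((j : F) - i) := by
    rw [Finset.prod_ite, Finset.prod_const_one, one_mul, show i + 1 + k = i + k + 1 by ring,
      ← Finset.filter_ne']
  rw [h1, Finset.prod_range_add, Finset.prod_range_succ, if_pos rfl, mul_one, add_tsub_cancel_left]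
  congr 1
  · rw [← prod_range_sub_natCast]
    refine Finset.prod_congr rfl fun j hj => if_neg ?_
    exact (Finset.mem_range.1 hj).ne
  · rw [← Finset.prod_range_add_one_eq_factorial, Nat.cast_prod]
    refine Finset.prod_congr rfl fun j hj => ?_
    rw [if_neg (by omega)]
    push_cast
    ring

theorem ratNum_neg (a b c j : ℕ) : ratNum a b c (-(j + 1) : F) =
    (-1) ^ (a + b + c) * (a.factorial * (b + c).factorial) *
      ((j + a).choose a * (j + b).choose (b + c) : ℕ) := by
  have h1 : ∏ i ∈ Finset.range a, (-(j + 1) - i : F) =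
      (-1) ^ a * (a.factorial * (j + a).choose a : ℕ) := by
    rw [← Nat.ascFactorial_eq_factorial_mul_choose, Nat.ascFactorial_eq_prod_range, Nat.cast_prod,
      ← Finset.card_range a, ← Finset.prod_const, Finset.card_range, ← Finset.prod_mul_distrib]
    refine Finset.prod_congr rfl fun i _ => ?_
    push_cast
    ring
  have h2 : ∏ i ∈ Finset.range (b + c), (-(j + 1) + c - i : F) =
      (-1) ^ (b + c) * ((b + c).factorial * (j + b).choose (b + c) : ℕ) := by
    rcases lt_or_ge j c with h | h
    · rw [Nat.choose_eq_zero_of_lt (by omega)]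
      rw [Finset.prod_eq_zero (i := c - (j + 1)) (Finset.mem_range.2 (by omega))]
      · simp
      · rw [Nat.cast_sub (by omega)]; push_cast; ring
    · obtain ⟨k, rfl⟩ := Nat.exists_eq_add_of_le h
      rw [show c + k + b = k + (b + c) by ring, ← Nat.ascFactorial_eq_factorial_mul_choose,
        Nat.ascFactorial_eq_prod_range, Nat.cast_prod,
        ← Finset.card_range (b + c), ← Finset.prod_const, Finset.card_range,
        ← Finset.prod_mul_distrib]
      refine Finset.prod_congr rfl fun i _ => ?_
      push_cast
      ring
  rw [ratNum, h1, h2]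
  push_cast
  ring

open Polynomial in
theorem ratFun_mul_eval [CharZero F] {a b c M : ℕ} {g : F[X]} (hg : g.natDegree + a + b + c ≤ M)
    {s : F} (hs : ∀ j : ℕ, s + j + 1 ≠ 0) :
    ratFun a b c M s * g.eval s =
      pfSum (fun j => ratRes a b c M j * g.eval (-(j + 1) : F)) M 1 s := by
  set v : ℕ → F := fun j => -(j + 1) with hv
  have hinj : Set.InjOn v (Finset.range (M + 1)) := by
    intro i _ j _ h
    simp only [hv, neg_inj, add_left_inj, Nat.cast_inj] at h
    exact h
  set P : F[X] := (∏ i ∈ Finset.range a, (X - C (i : F))) *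
    (∏ i ∈ Finset.range (b + c), (X - C (i - c : F))) * g with hP
  have hPe : ∀ t, P.eval t = ratNum a b c t * g.eval t := by
    intro t
    rw [hP, eval_mul, eval_mul, eval_prod, eval_prod, ratNum]
    congr 2
    · exact Finset.prod_congr rfl fun i _ => by simp
    · exact Finset.prod_congr rfl fun i _ => by simp; ring
  have hdeg : P.degree < (Finset.range (M + 1)).card := by
    rw [Finset.card_range]
    refine degree_le_natDegree.trans_lt ?_
    have e1 : (∏ i ∈ Finset.range a, (X - C (i : F))).natDegree ≤ a := by
      refine (natDegree_prod_le _ _).trans ?_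
      simp only [natDegree_X_sub_C]
      simp
    have e2 : (∏ i ∈ Finset.range (b + c), (X - C (i - c : F))).natDegree ≤ b + c := by
      refine (natDegree_prod_le _ _).trans ?_
      simp [-map_sub]
    have e3 : P.natDegree ≤ _ := natDegree_mul_le
    have e4 := natDegree_mul_le (p := ∏ i ∈ Finset.range a, (X - C (i : F)))
      (q := ∏ i ∈ Finset.range (b + c), (X - C (i - c : F)))
    exact_mod_cast (by omega : P.natDegree < M + 1)
  have h1 := Lagrange.eq_interpolate hinj hdeg
  have hne : ∀ i ∈ Finset.range (M + 1), s ≠ v i := by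
    intro i _ h
    refine hs i ?_
    rw [h, hv]; ring
  have h2 := Lagrange.eval_interpolate_not_at_node (s := Finset.range (M + 1)) (v := v)
    (fun i => P.eval (v i)) hne
  rw [← h1, hPe, Lagrange.eval_nodal] at h2
  have hprod : ∏ i ∈ Finset.range (M + 1), (s - v i) = ∏ i ∈ Finset.range (M + 1), (s + 1 + i) :=
    Finset.prod_congr rfl fun i _ => by rw [hv]; ring
  have hprod0 : ∏ i ∈ Finset.range (M + 1), (s + 1 + i) ≠ 0 :=
    Finset.prod_ne_zero_iff.2 fun i _ => by
      have := hs i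
      rwa [add_right_comm]
  rw [hprod] at h2
  have ha : (a.factorial : F) ≠ 0 := by exact_mod_cast a.factorial_ne_zero
  have hb : ((b + c).factorial : F) ≠ 0 := by exact_mod_cast (b + c).factorial_ne_zero
  have h3 : ratFun a b c M s * g.eval s = (M.factorial : F) / (a.factorial * (b + c).factorial) *
      ∑ i ∈ Finset.range (M + 1),
        Lagrange.nodalWeight (Finset.range (M + 1)) v i * (s - v i)⁻¹ * eval (v i) P := by
    rw [ratFun, div_mul_eq_mul_div, mul_assoc, h2]
    field_simp
  rw [h3, pfSum, Finset.mul_sum]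
  refine Finset.sum_congr rfl fun j hj => ?_
  have hj' : j ≤ M := Nat.lt_succ_iff.1 (Finset.mem_range.1 hj)
  have hw : Lagrange.nodalWeight (Finset.range (M + 1)) v j =
      ((-1 : F) ^ j * j.factorial * (M - j).factorial)⁻¹ := by
    rw [Lagrange.nodalWeight, ← prod_range_erase_sub_natCast hj', Finset.prod_inv_distrib]
    congr 1
    exact Finset.prod_congr rfl fun i _ => by rw [hv]; ring
  have hsv : s - v j = s + j + 1 := by rw [hv]; ring
  rw [hw, hPe, hsv, hv, ratNum_neg, ratRes, pfCoeff]
  have hch : (M.factorial : F) = M.choose j * j.factorial * (M - j).factorial := by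
    exact_mod_cast (Nat.choose_mul_factorial_mul_factorial hj').symm
  rw [hch]
  have := hs j
  have h4 : (j.factorial : F) ≠ 0 := by exact_mod_cast j.factorial_ne_zero
  have h5 : ((M - j).factorial : F) ≠ 0 := by exact_mod_cast (M - j).factorial_ne_zero
  have h6 : ((-1 : F) ^ j) * (-1) ^ j = 1 := by rw [← mul_pow]; simp
  have h7 : ((-1 : F) ^ j) ≠ 0 := by simp
  push_cast
  rw [pow_add _ _ j]
  field_simp
  ring_nf
  simp [pow_mul']
end ratFun

section linForm

theorem hasDerivAt_pfSum {𝕜 : Type*} [NontriviallyNormedField 𝕜] (e : ℕ → 𝕜) (M : ℕ) {s : 𝕜}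
    (hs : ∀ j : ℕ, s + j + 1 ≠ 0) : HasDerivAt (pfSum e M 1) (-pfSum e M 2 s) s := by
  unfold pfSum
  rw [← Finset.sum_neg_distrib]
  refine HasDerivAt.fun_sum fun j _ => ?_
  have h := (((hasDerivAt_id s).add_const (j : 𝕜)).add_const 1).inv (hs j)
  have := h.const_mul (e j)
  simp only [pow_one, div_eq_mul_inv]
  refine this.congr_deriv ?_
  simp only [id]
  field_simp

theorem hasDerivAt_ratFun {𝕜 : Type*} [NontriviallyNormedField 𝕜] (a b c M : ℕ) {σ : ℕ}
    (hσ : σ < a) (h : ∀ j : ℕ, (σ : 𝕜) + 1 + j ≠ 0) : HasDerivAt (ratFun a b c M)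
      ((M.factorial : 𝕜) / (a.factorial * (b + c).factorial) *
        ((∏ i ∈ (Finset.range a).erase σ, ((σ : 𝕜) - i)) *
          ∏ i ∈ Finset.range (b + c), ((σ : 𝕜) + c - i)) /
        ∏ i ∈ Finset.range (M + 1), ((σ : 𝕜) + 1 + i)) σ := by
  set H : 𝕜 → 𝕜 := fun s => (M.factorial : 𝕜) / (a.factorial * (b + c).factorial) *
        ((∏ i ∈ (Finset.range a).erase σ, (s - i)) *
          ∏ i ∈ Finset.range (b + c), (s + c - i)) /
        ∏ i ∈ Finset.range (M + 1), (s + 1 + i) with hH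
  have hd : DifferentiableAt 𝕜 H σ := by
    refine DifferentiableAt.div ?_ ?_ (Finset.prod_ne_zero_iff.2 fun i _ => h i)
    · refine (DifferentiableAt.mul ?_ ?_).const_mul _ <;>
      exact DifferentiableAt.fun_finsetProd fun i _ => by fun_prop
    · exact DifferentiableAt.fun_finsetProd fun i _ => by fun_prop
  have e : ratFun a b c M = fun s => (s - σ) * H s := by
    funext s
    rw [ratFun, ratNum, ← Finset.mul_prod_erase _ _ (Finset.mem_range.2 hσ), hH]
    ring
  rw [e]
  refine (((hasDerivAt_id (σ : 𝕜)).sub_const (σ : 𝕜)).mul hd.hasDerivAt).congr_deriv ?_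
  simp [hH]

theorem ratFun_natCast_eq_zero {a b c M s : ℕ} (h : s < a) : ratFun a b c M (s : ℝ) = 0 := by
  rw [ratFun, ratNum, Finset.prod_eq_zero (Finset.mem_range.2 h) (sub_self _)]
  simp

theorem add_nat_add_one_ne_zero {s : ℝ} (hs : -1 < s) (j : ℕ) : s + j + 1 ≠ 0 := by
  have : (0 : ℝ) ≤ j := Nat.cast_nonneg j
  intro h
  linarith

theorem abs_pfSum_le {e : ℕ → ℝ} {M r s : ℕ} : |pfSum e M r (s : ℝ)| ≤
    ∑ j ∈ Finset.range (M + 1), |e j| := by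
  refine (Finset.abs_sum_le_sum_abs _ _).trans (Finset.sum_le_sum fun j _ => ?_)
  rw [abs_div]
  refine div_le_self (abs_nonneg _) ?_
  rw [abs_of_nonneg (by positivity)]
  refine one_le_pow₀ ?_
  have : (0 : ℝ) ≤ (s : ℝ) + j := by positivity
  linarith

/-- The series `∑ T(s) x ^ (s + 1)` attached to a partial fraction sum. -/
noncomputable def linForm (x : ℝ) (e : ℕ → ℝ) (M r : ℕ) : ℝ :=
  ∑' s : ℕ, pfSum e M r (s : ℝ) * x ^ (s + 1)

theorem summable_linForm {x : ℝ} (hx : |x| < 1) (e : ℕ → ℝ) (M r : ℕ) :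
    Summable fun s : ℕ => pfSum e M r (s : ℝ) * x ^ (s + 1) := by
  have h := ((summable_geometric_of_lt_one (abs_nonneg x) hx).mul_left |x|).mul_left
    (∑ j ∈ Finset.range (M + 1), |e j|)
  refine Summable.of_norm_bounded h fun s => ?_
  rw [Real.norm_eq_abs, abs_mul, abs_pow, pow_succ']
  gcongr
  exact abs_pfSum_le

theorem ratFun_mul_pow {a b c M k : ℕ} (hM : k + a + b + c ≤ M) {s : ℝ} (hs : -1 < s) :
    ratFun a b c M s * s ^ k =
      pfSum (fun j => ratRes a b c M j * (-(j + 1) : ℝ) ^ k) M 1 s := by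
  have := ratFun_mul_eval (F := ℝ) (a := a) (b := b) (c := c) (M := M) (g := Polynomial.X ^ k)
    (by simpa using hM) (s := s) (add_nat_add_one_ne_zero hs)
  simpa using this

open Filter Topology in
theorem hasDerivAt_ratFun_real {a b c M : ℕ} (hM : a + b + c ≤ M) {s : ℝ} (hs : -1 < s) :
    HasDerivAt (ratFun a b c M) (-pfSum (fun j => (ratRes a b c M j : ℝ)) M 2 s) s := by
  have h := hasDerivAt_pfSum (fun j => (ratRes a b c M j : ℝ)) M (add_nat_add_one_ne_zero hs)
  refine h.congr_of_eventuallyEq ?_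
  filter_upwards [lt_mem_nhds hs] with t ht
  simpa using ratFun_mul_pow (k := 0) (by simpa using hM) ht

open Filter Topology in
theorem pfSum_two_eq {a b c M k : ℕ} (hM : k + a + b + c ≤ M) {s : ℝ} (hs : -1 < s) {r' : ℝ}
    (hr : HasDerivAt (ratFun a b c M) r' s) :
    pfSum (fun j => ratRes a b c M j * (-(j + 1) : ℝ) ^ k) M 2 s =
      -(r' * s ^ k + ratFun a b c M s * (k * s ^ (k - 1))) := by
  have h := hasDerivAt_pfSum (fun j => ratRes a b c M j * (-(j + 1) : ℝ) ^ k) M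
    (add_nat_add_one_ne_zero hs)
  have h2 := hr.mul (hasDerivAt_pow k s)
  rw [← h.unique (h2.congr_of_eventuallyEq ?_), neg_neg]
  filter_upwards [lt_mem_nhds hs] with t ht
  exact (ratFun_mul_pow hM ht).symm

theorem ratFun_recurrence {a b c M : ℕ} {s : ℝ} (hs : -1 < s) :
    ratFun a b c M (s + 1) * ((s + 1 - a) * (s + 1 - b) * (s + 1 + M + 1)) =
      ratFun a b c M s * ((s + 1) ^ 2 * (s + 1 + c)) := by
  have p1 : (∏ i ∈ Finset.range a, (s + 1 - i)) * (s + 1 - a) =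
      (∏ i ∈ Finset.range a, (s - i)) * (s + 1) := by
    rw [← Finset.prod_range_succ (fun i : ℕ => s + 1 - (i : ℝ)), Finset.prod_range_succ']
    congr 1
    · exact Finset.prod_congr rfl fun i _ => by push_cast; ring
    · simp
  have p2 : (∏ i ∈ Finset.range (b + c), (s + 1 + c - i)) * (s + 1 - b) =
      (∏ i ∈ Finset.range (b + c), (s + c - i)) * (s + 1 + c) := by
    have := Finset.prod_range_succ (fun i : ℕ => s + 1 + c - (i : ℝ)) (b + c)
    rw [show s + 1 - b = s + 1 + c - ((b + c : ℕ) : ℝ) by push_cast; ring, ← this,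
      Finset.prod_range_succ']
    congr 1
    · exact Finset.prod_congr rfl fun i _ => by push_cast; ring
    · simp
  have p3 : (∏ i ∈ Finset.range (M + 1), (s + 1 + i)) * (s + 1 + M + 1) =
      (∏ i ∈ Finset.range (M + 1), (s + 1 + 1 + i)) * (s + 1) := by
    have := Finset.prod_range_succ (fun i : ℕ => s + 1 + (i : ℝ)) (M + 1)
    rw [show s + 1 + M + 1 = s + 1 + ((M + 1 : ℕ) : ℝ) by push_cast; ring, ← this,
      Finset.prod_range_succ']
    congr 1
    · exact Finset.prod_congr rfl fun i _ => by push_cast; ring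
    · simp
  have n1 : ∏ i ∈ Finset.range (M + 1), (s + 1 + i) ≠ 0 :=
    Finset.prod_ne_zero_iff.2 fun i _ => by
      have := add_nat_add_one_ne_zero hs i
      rwa [add_right_comm]
  have n2 : ∏ i ∈ Finset.range (M + 1), (s + 1 + 1 + i) ≠ 0 :=
    Finset.prod_ne_zero_iff.2 fun i _ => by
      have := add_nat_add_one_ne_zero (s := s + 1) (by linarith) i
      rwa [add_right_comm]
  rw [ratFun, ratFun, ratNum, ratNum]
  set A1 := ∏ i ∈ Finset.range a, (s + 1 - (i : ℝ))
  set A2 := ∏ i ∈ Finset.range (b + c), (s + 1 + c - (i : ℝ))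
  set A3 := ∏ i ∈ Finset.range (M + 1), (s + 1 + (i : ℝ))
  set B1 := ∏ i ∈ Finset.range a, (s - (i : ℝ))
  set B2 := ∏ i ∈ Finset.range (b + c), (s + c - (i : ℝ))
  set B3 := ∏ i ∈ Finset.range (M + 1), (s + 1 + 1 + (i : ℝ))
  set q : ℝ := (M.factorial : ℝ) / (a.factorial * (b + c).factorial)
  rw [div_mul_eq_mul_div (q * (A1 * A2)), div_mul_eq_mul_div (q * (B1 * B2)), div_eq_div_iff n2 n1]
  calc q * (A1 * A2) * ((s + 1 - a) * (s + 1 - b) * (s + 1 + M + 1)) * A3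
      = q * (A1 * (s + 1 - a)) * (A2 * (s + 1 - b)) * (A3 * (s + 1 + M + 1)) := by ring
    _ = q * (B1 * (s + 1)) * (B2 * (s + 1 + c)) * (B3 * (s + 1)) := by rw [p1, p2, p3]
    _ = _ := by ring

open Polynomial Filter Topology in
theorem exists_linForm_ne_zero {a b c M : ℕ} (hb : 0 < b) (hba : b < a) (hM : 2 + a + b + c ≤ M)
    {x : ℝ} (hx0 : x ≠ 0) (hx : |x| ≤ 1 / 5) {β γ : ℝ} (hβγ : β ≠ 0 ∨ γ ≠ 0) :
    ∃ k < 3, β * linForm x (fun j => ratRes a b c M j * (-(j + 1) : ℝ) ^ k) M 1 +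
      γ * linForm x (fun j => ratRes a b c M j * (-(j + 1) : ℝ) ^ k) M 2 ≠ 0 := by
  by_contra! hcon
  have hx1 : |x| < 1 := by linarith
  have hs1 : ∀ s : ℕ, (-1 : ℝ) < s := fun s => by
    have : (0 : ℝ) ≤ s := Nat.cast_nonneg s
    linarith
  set q : ℕ → ℝ := fun j => (ratRes a b c M j : ℝ) with hq
  set r : ℕ → ℝ := fun s => ratFun a b c M (s : ℝ) with hr
  set r' : ℕ → ℝ := fun s => -pfSum q M 2 (s : ℝ) with hr'
  have hder : ∀ s : ℕ, HasDerivAt (ratFun a b c M) (r' s) (s : ℝ) := fun s =>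
    hasDerivAt_ratFun_real (by omega) (hs1 s)
  have hrpf : ∀ s : ℕ, r s = pfSum q M 1 s := fun s => by
    simpa using ratFun_mul_pow (k := 0) (by omega) (hs1 s)
  set v : ℕ → ℝ := fun s => β * r s - γ * r' s with hv
  set w : ℕ → ℝ := fun s => -γ * r s with hw
  set C₀ := ∑ j ∈ Finset.range (M + 1), |q j|
  have hC0 : 0 ≤ C₀ := Finset.sum_nonneg fun _ _ => abs_nonneg _
  have hrb : ∀ s, |r s| ≤ C₀ := fun s => by rw [hrpf]; exact abs_pfSum_le
  have hrb' : ∀ s, |r' s| ≤ C₀ := fun s => by rw [hr', abs_neg]; exact abs_pfSum_le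
  have hvb : ∀ s, |v s| ≤ (|β| + |γ|) * C₀ := fun s => by
    refine (abs_sub _ _).trans ?_
    rw [abs_mul, abs_mul, add_mul]
    have := hrb s
    have := hrb' s
    gcongr
  have hwb : ∀ s, |w s| ≤ (|β| + |γ|) * C₀ := fun s => by
    rw [hw, abs_mul, abs_neg]
    have := hrb s
    have : |γ| ≤ |β| + |γ| := by linarith [abs_nonneg β]
    gcongr
  have hr0 : ∀ s < a, r s = 0 := fun s hs => ratFun_natCast_eq_zero hs
  have hne : ∀ s : ℕ, ∀ j : ℕ, (s : ℝ) + 1 + j ≠ 0 := fun s j => by positivity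
  have hrv : ∀ s < a, r' s = _ := fun s hs =>
    (hder s).unique (hasDerivAt_ratFun a b c M hs (hne s))
  have hr'0 : ∀ s < b, r' s = 0 := fun s hs => by
    rw [hrv s (by omega), Finset.prod_eq_zero (s := Finset.range (b + c)) (i := s + c)]
    · simp
    · exact Finset.mem_range.2 (by omega)
    · push_cast; ring
  have h0 : ∀ k < 3, jetSum x v w (X ^ k) = 0 := by
    intro k hk
    rw [← hcon k hk, linForm, linForm, ← tsum_mul_left, ← tsum_mul_left,
      ← ((summable_linForm hx1 _ _ _).mul_left β).tsum_add
        ((summable_linForm hx1 _ _ _).mul_left γ), jetSum]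
    refine tsum_congr fun s => ?_
    rw [← ratFun_mul_pow (by omega) (hs1 s), pfSum_two_eq (by omega) (hs1 s) (hder s)]
    simp only [hv, hw, hr, derivative_X_pow, eval_mul, eval_pow, eval_X, eval_natCast, map_natCast]
    ring
  set A : ℝ[X] := (X - C (a : ℝ)) * (X - C (b : ℝ)) * (X + C (M + 1 : ℝ)) with hA
  set B : ℝ[X] := (X + C 1) ^ 2 * (X + C (1 + c : ℝ)) with hB
  have hAm : ((X - C (a : ℝ)) * (X - C (b : ℝ))).Monic := (monic_X_sub_C _).mul (monic_X_sub_C _)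
  have hBm : ((X + C (1 : ℝ)) ^ 2).Monic := (monic_X_add_C _).pow 2
  have hA3 : A.natDegree = 3 := by
    rw [hA, hAm.natDegree_mul (monic_X_add_C _), (monic_X_sub_C _).natDegree_mul (monic_X_sub_C _),
      natDegree_X_sub_C, natDegree_X_sub_C, natDegree_X_add_C]
  have hB3 : B.natDegree = 3 := by
    rw [hB, hBm.natDegree_mul (monic_X_add_C _), (monic_X_add_C _).natDegree_pow,
      natDegree_X_add_C, natDegree_X_add_C]
  have hAe : ∀ t : ℝ, A.eval t = (t - a) * (t - b) * (t + M + 1) := fun t => by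
    rw [hA]; simp only [eval_mul, eval_sub, eval_add, eval_X, eval_C]; ring
  have hBe : ∀ t : ℝ, B.eval t = (t + 1) ^ 2 * (t + 1 + c) := fun t => by
    rw [hB]; simp only [eval_mul, eval_add, eval_pow, eval_X, eval_C]; ring
  have rec1 : ∀ t : ℝ, -1 < t →
      ratFun a b c M (t + 1) * A.eval (t + 1) = ratFun a b c M t * B.eval t := fun t ht => by
    rw [hAe, hBe]; exact ratFun_recurrence ht
  have rec2 : ∀ s : ℕ, r' (s + 1) * A.eval (s + 1 : ℝ) +
      r (s + 1) * (derivative A).eval (s + 1 : ℝ) =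
      r' s * B.eval (s : ℝ) + r s * (derivative B).eval (s : ℝ) := by
    intro s
    have d1 := hder (s + 1)
    rw [Nat.cast_add_one] at d1
    have d2 := (d1.mul (A.hasDerivAt _)).comp_add_const (s : ℝ) 1
    have d3 := (hder s).mul (B.hasDerivAt (s : ℝ))
    have := d2.unique (d3.congr_of_eventuallyEq ?_)
    · simpa [hr] using this
    · filter_upwards [lt_mem_nhds (hs1 s)] with t ht
      exact rec1 t ht
  have rec1' : ∀ s : ℕ, r (s + 1) * A.eval (s + 1 : ℝ) = r s * B.eval (s : ℝ) := fun s => by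
    simpa [hr] using rec1 s (hs1 s)
  have hall := jetSum_eq_zero hx1 hvb hwb (A := A) (B := B)
    (by simp [hv, hr0 0 (by omega), hr'0 0 hb]) (by simp [hw, hr0 0 (by omega)])
    (fun s => by simp only [hv, hw]; linear_combination β * rec1' s - γ * rec2 s)
    (fun s => by simp only [hw]; linear_combination (-γ) * rec1' s)
    (hAm.mul (monic_X_add_C _)) (hBm.mul (monic_X_add_C _)) hA3 hB3 h0
  have hfac : (M.factorial : ℝ) / (a.factorial * (b + c).factorial) ≠ 0 := by positivity
  have hden : ∀ s : ℕ, ∏ i ∈ Finset.range (M + 1), ((s : ℝ) + 1 + i) ≠ 0 := fun s =>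
    Finset.prod_ne_zero_iff.2 fun i _ => hne s i
  have hbc : ∀ s : ℕ, b ≤ s → ∏ i ∈ Finset.range (b + c), ((s : ℝ) + c - i) ≠ 0 := fun s hs =>
    Finset.prod_ne_zero_iff.2 fun i hi => by
      have := Finset.mem_range.1 hi
      have : (i : ℝ) < s + c := by exact_mod_cast (by omega : i < s + c)
      linarith
  by_cases hγ : γ = 0
  · have hβ : β ≠ 0 := hβγ.resolve_right (not_not.2 hγ)
    have hra : r a ≠ 0 := by
      refine div_ne_zero (mul_ne_zero hfac (mul_ne_zero ?_ (hbc a hba.le))) (hden a)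
      refine Finset.prod_ne_zero_iff.2 fun i hi => ?_
      have : (i : ℝ) < a := by exact_mod_cast Finset.mem_range.1 hi
      linarith
    obtain ⟨f, hf⟩ := exists_jetSum_ne_zero hx0 hx hvb hwb (s₀ := a)
      (fun s hs => by simp [hv, hγ, hr0 s hs]) (fun s hs => by simp [hw, hγ])
      (by simpa [hv, hγ] using ⟨hβ, hra⟩)
    exact hf (hall f)
  · have hrb : r' b ≠ 0 := by
      rw [hrv b hba]
      refine div_ne_zero (mul_ne_zero hfac (mul_ne_zero ?_ (hbc b le_rfl))) (hden b)
      refine Finset.prod_ne_zero_iff.2 fun i hi => ?_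
      have := (Finset.mem_erase.1 hi).1
      rw [sub_ne_zero]
      exact_mod_cast this.symm
    obtain ⟨f, hf⟩ := exists_jetSum_ne_zero hx0 hx hvb hwb (s₀ := b)
      (fun s hs => by simp [hv, hr0 s (by omega), hr'0 s hs])
      (fun s hs => by simp [hw, hr0 s (by omega)])
      (by simpa [hv, hr0 b hba] using ⟨hγ, hrb⟩)
    exact hf (hall f)

theorem summable_Li (r : ℕ) {x : ℝ} (hx : |x| < 1) :
    Summable fun n : ℕ => x ^ (n + 1) / (n + 1 : ℝ) ^ r := by
  have h := (summable_geometric_of_lt_one (abs_nonneg x) hx).mul_left |x|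
  refine Summable.of_norm_bounded h fun s => ?_
  rw [Real.norm_eq_abs, abs_div, abs_pow, ← pow_succ']
  refine div_le_self (by positivity) ?_
  rw [abs_of_nonneg (by positivity)]
  exact one_le_pow₀ (by linarith [(Nat.cast_nonneg s : (0 : ℝ) ≤ s)])

theorem linForm_eq {x : ℝ} (hx : |x| < 1) (hx0 : x ≠ 0) (e : ℕ → ℝ) (M r : ℕ) :
    linForm x e M r = ∑ j ∈ Finset.range (M + 1), e j * (x⁻¹ ^ j *
      (Li r x - ∑ i ∈ Finset.range j, x ^ (i + 1) / (i + 1 : ℝ) ^ r)) := by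
  have hterm : ∀ j : ℕ, HasSum (fun s : ℕ => x ^ (s + 1) / ((s : ℝ) + j + 1) ^ r)
      (x⁻¹ ^ j * (Li r x - ∑ i ∈ Finset.range j, x ^ (i + 1) / (i + 1 : ℝ) ^ r)) := by
    intro j
    have h := ((hasSum_nat_add_iff' j).2 (summable_Li r hx).hasSum).mul_left (x⁻¹ ^ j)
    refine h.congr_fun fun s => ?_
    rw [show s + j + 1 = j + (s + 1) by ring, pow_add x j, ← mul_div_assoc, ← mul_assoc, ← mul_pow,
      inv_mul_cancel₀ hx0, one_pow, one_mul]
    push_cast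
    rfl
  have := hasSum_sum fun j (_ : j ∈ Finset.range (M + 1)) => (hterm j).mul_left (e j)
  rw [linForm, ← this.tsum_eq]
  refine tsum_congr fun s => ?_
  rw [pfSum, Finset.sum_mul]
  exact Finset.sum_congr rfl fun j _ => by ring

/-- If `1, Li₁(1/z), Li₂(1/z)` satisfy an integer relation, the corresponding combination of the
linear forms becomes an integer after clearing denominators. -/
theorem exists_int_eq_linForm {z : ℤ} (hz : 1 < |(z : ℝ)|) {D : ℝ} {M : ℕ} (e : ℕ → ℤ)
    (hD : ∀ j i : ℕ, 1 ≤ i → i ≤ M → ∃ m : ℤ, D * e j / (i : ℝ) ^ 2 = m) (hM : 1 ≤ M)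
    {α β γ : ℤ} (h : α + β * Li 1 (1 / z) + γ * Li 2 (1 / z) = 0) :
    ∃ m : ℤ, D * (β * linForm (1 / z) (fun j => e j) M 1 +
      γ * linForm (1 / z) (fun j => e j) M 2) = m := by
  have hz0 : (z : ℝ) ≠ 0 := by rintro h; rw [h] at hz; norm_num at hz
  have hx0 : 1 / (z : ℝ) ≠ 0 := by positivity
  have hx : |1 / (z : ℝ)| < 1 := by
    rw [abs_div, abs_one, div_lt_one (by linarith)]; exact hz
  rw [linForm_eq hx hx0, linForm_eq hx hx0]
  have e0 : D * (β * ∑ j ∈ Finset.range (M + 1), e j * ((1 / (z : ℝ))⁻¹ ^ j *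
      (Li 1 (1 / z) - ∑ i ∈ Finset.range j, (1 / (z : ℝ)) ^ (i + 1) / (i + 1 : ℝ) ^ 1)) +
      γ * ∑ j ∈ Finset.range (M + 1), e j * ((1 / (z : ℝ))⁻¹ ^ j *
      (Li 2 (1 / z) - ∑ i ∈ Finset.range j, (1 / (z : ℝ)) ^ (i + 1) / (i + 1 : ℝ) ^ 2))) =
      ∑ j ∈ Finset.range (M + 1), (-(α * (D * e j * z ^ j)) -
        ∑ i ∈ Finset.range j, D * e j * z ^ j * (β * ((1 / (z : ℝ)) ^ (i + 1) / (i + 1 : ℝ) ^ 1) +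
          γ * ((1 / (z : ℝ)) ^ (i + 1) / (i + 1 : ℝ) ^ 2))) := by
    rw [Finset.mul_sum, Finset.mul_sum, ← Finset.sum_add_distrib, Finset.mul_sum]
    refine Finset.sum_congr rfl fun j _ => ?_
    rw [← Finset.mul_sum, Finset.sum_add_distrib, ← Finset.mul_sum, ← Finset.mul_sum, one_div,
        inv_inv]
    rw [one_div] at h
    linear_combination D * e j * z ^ j * h
  rw [e0]
  have hmem : ∀ y : ℝ, (∃ m : ℤ, y = m) ↔ y ∈ (Int.castRingHom ℝ).range := fun y => by
    simp [eq_comm]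
  rw [hmem]
  have h_int : ∀ m : ℤ, (m : ℝ) ∈ (Int.castRingHom ℝ).range := fun m => ⟨m, rfl⟩
  refine sum_mem fun j hj => sub_mem (neg_mem (mul_mem (h_int _) (mul_mem ?_ ?_)))
    (sum_mem fun i hi => ?_)
  · obtain ⟨m, hm⟩ := hD j 1 le_rfl hM
    rw [Nat.cast_one, one_pow, div_one] at hm
    rw [hm]; exact h_int m
  · exact pow_mem (h_int z) j
  · have hj' := Finset.mem_range.1 hj
    have hi' := Finset.mem_range.1 hi
    obtain ⟨m, hm⟩ := hD j (i + 1) (by omega) (by omega)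
    have hzp : (z : ℝ) ^ j = z ^ (j - (i + 1)) * z ^ (i + 1) := by
      rw [← pow_add]; congr 1; omega
    have hi0 : (i : ℝ) + 1 ≠ 0 := by positivity
    have : D * e j * z ^ j * (β * ((1 / (z : ℝ)) ^ (i + 1) / (i + 1 : ℝ) ^ 1) +
          γ * ((1 / (z : ℝ)) ^ (i + 1) / (i + 1 : ℝ) ^ 2)) =
        ((m * z ^ (j - (i + 1)) * (β * (i + 1) + γ) : ℤ) : ℝ) := by
      push_cast
      rw [← hm, hzp]
      push_cast
      have hzz : (z : ℝ) ^ (i + 1) * (1 / (z : ℝ)) ^ (i + 1) = 1 := by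
        rw [← mul_pow, mul_one_div_cancel hz0, one_pow]
      field_simp
      linear_combination D * e j * (β * (i + 1) + γ) * hzz
    rw [this]
    exact h_int _
end linForm

section partsIntegration
open Polynomial

theorem integral_iterate_derivative_mul {p : ℂ[X]} {N : ℕ} {F : ℕ → ℝ → ℂ}
    (hF : ∀ j, ∀ t ∈ Set.uIcc (0 : ℝ) 1, HasDerivAt (F j) (F (j + 1) t) t)
    (h1 : ∀ i < N, (derivative^[i] p).eval 1 = 0)
    (h0 : ∀ i j, i + j + 1 = N → (derivative^[i] p).eval 0 * F j 0 = 0) :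
    ∫ t in (0 : ℝ)..1, (derivative^[N] p).eval (t : ℂ) * F 0 t =
      (-1) ^ N * ∫ t in (0 : ℝ)..1, p.eval (t : ℂ) * F N t := by
  induction N generalizing F with
  | zero => simp
  | succ N ih =>
    have hc : ∀ j, ContinuousOn (F j) (Set.uIcc 0 1) := fun j t ht =>
      (hF j t ht).continuousAt.continuousWithinAt
    have hp : ∀ q : ℂ[X], Continuous fun t : ℝ => q.eval (t : ℂ) := fun q =>
      q.continuous.comp Complex.continuous_ofReal
    have hd : ∀ t ∈ Set.uIcc (0 : ℝ) 1, HasDerivAt (fun t : ℝ => (derivative^[N] p).eval (t : ℂ))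
        ((derivative^[N + 1] p).eval (t : ℂ)) t := fun t _ => by
      rw [Function.iterate_succ_apply']
      exact ((derivative^[N] p).hasDerivAt (t : ℂ)).comp_ofReal
    have := intervalIntegral.integral_deriv_mul_eq_sub hd (hF 0)
      ((hp _).intervalIntegrable _ _) ((hc 1).intervalIntegrable)
    rw [intervalIntegral.integral_add] at this
    · have e1 := h1 N (by omega)
      have e0 := h0 N 0 (by omega)
      rw [Complex.ofReal_one, e1, Complex.ofReal_zero, e0, zero_mul, sub_zero] at this
      rw [eq_neg_of_add_eq_zero_left this, ih (F := fun j => F (j + 1)) (fun j => hF (j + 1))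
        (fun i hi => h1 i (by omega)) (fun i j hij => h0 i (j + 1) (by omega)), pow_succ]
      ring
    · exact ((hp _).continuousOn.mul (hc 0)).intervalIntegrable
    · exact ((hp _).continuousOn.mul (hc 1)).intervalIntegrable

/-- The iterated derivatives of `t ^ c / (1 + η t)`. -/
noncomputable def ratDeriv (η : ℂ) : ℕ → ℕ → ℝ → ℂ
  | 0, j, t => (-η) ^ j * j.factorial / (1 + η * t) ^ (j + 1)
  | c + 1, j, t => t * ratDeriv η c j t + j * ratDeriv η c (j - 1) t

theorem hasDerivAt_ratDeriv {η : ℂ} (c j : ℕ) {t : ℝ} (h : 1 + η * t ≠ 0) :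
    HasDerivAt (ratDeriv η c j) (ratDeriv η c (j + 1) t) t := by
  induction c generalizing j with
  | zero =>
    have h1 : HasDerivAt (fun t : ℝ => 1 + η * (t : ℂ)) η t := by
      simpa using ((hasDerivAt_id (t : ℂ)).comp_ofReal.const_mul η).const_add 1
    have h2 := ((h1.pow (j + 1)).inv (pow_ne_zero _ h)).const_mul ((-η) ^ j * (j.factorial : ℂ))
    have e : ratDeriv η 0 j = fun t : ℝ => (-η) ^ j * (j.factorial : ℂ) *
        ((1 + η * (t : ℂ)) ^ (j + 1))⁻¹ := by
      funext t; rw [ratDeriv, div_eq_mul_inv]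
    rw [e]
    refine h2.congr_deriv ?_
    rw [ratDeriv, Nat.factorial_succ]
    push_cast
    simp only [Pi.pow_apply]
    field_simp
    ring
  | succ c ih =>
    have h1 : HasDerivAt (fun t : ℝ => (t : ℂ)) 1 t := (hasDerivAt_id (t : ℂ)).comp_ofReal
    have h2 := (h1.mul (ih j)).add ((ih (j - 1)).const_mul (j : ℂ))
    have e : ratDeriv η (c + 1) j = fun t : ℝ => (t : ℂ) * ratDeriv η c j t +
        j * ratDeriv η c (j - 1) t := by
      funext t; rw [ratDeriv]
    rw [e]
    refine h2.congr_deriv ?_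
    rw [ratDeriv, add_tsub_cancel_right]
    rcases j with _ | j
    · simp; ring
    · simp; ring

theorem ratDeriv_zero_right (η : ℂ) (c : ℕ) (t : ℝ) :
    ratDeriv η c 0 t = t ^ c / (1 + η * t) := by
  induction c with
  | zero => simp [ratDeriv]
  | succ c ih => rw [ratDeriv, ih]; push_cast; ring

theorem ratDeriv_at_zero {η : ℂ} {c j : ℕ} (h : j < c) : ratDeriv η c j 0 = 0 := by
  induction c generalizing j with
  | zero => omega
  | succ c ih =>
    rw [ratDeriv]
    rcases j with _ | j
    · simp
    · simp [ih (j := j) (by omega)]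

theorem ratDeriv_add {η : ℂ} (c b : ℕ) {t : ℝ} (h : 1 + η * t ≠ 0) :
    ratDeriv η c (c + b) t =
      (-1) ^ b * (c + b).factorial * η ^ b / (1 + η * t) ^ (c + b + 1) := by
  induction c generalizing b with
  | zero => rw [ratDeriv, neg_pow]; simp only [zero_add]; ring
  | succ c ih =>
    rw [ratDeriv, show c + 1 + b = c + (b + 1) by ring, ih,
        show c + (b + 1) - 1 = c + b by omega, ih,
      show c + (b + 1) = c + b + 1 by ring, Nat.factorial_succ]
    push_cast
    set u := 1 + η * (t : ℂ) with hu
    rw [pow_succ u (c + b + 1)]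
    field_simp
    linear_combination hu

theorem eval_iterate_derivative_of_dvd {r : ℂ} {N i : ℕ} {p : ℂ[X]} (h : (X - C r) ^ N ∣ p)
    (hi : i < N) : (derivative^[i] p).eval r = 0 := by
  have := pow_sub_dvd_iterate_derivative_of_pow_dvd i h
  obtain ⟨q, hq⟩ := this
  rw [hq, eval_mul, eval_pow, eval_sub, eval_X, eval_C, sub_self, zero_pow (by omega), zero_mul]

theorem integral_shift_derivative_div {Q : ℂ[X]} {b c : ℕ} (hQ : (X - C 1) ^ (b + c) ∣ Q) {η : ℂ}
    (hη : ∀ t ∈ Set.Icc (0 : ℝ) 1, 1 + η * t ≠ 0) :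
    ∫ t in (0 : ℝ)..1, (X ^ c * derivative^[b + c] (X ^ b * Q)).eval (t : ℂ) / (1 + η * t) =
      (-1) ^ c * (b + c).factorial * ∫ t in (0 : ℝ)..1,
        (t : ℂ) ^ b * Q.eval (t : ℂ) * η ^ b / (1 + η * t) ^ (b + c + 1) := by
  rw [← Set.uIcc_of_le zero_le_one] at hη
  have h := integral_iterate_derivative_mul (p := X ^ b * Q) (N := b + c) (F := ratDeriv η c)
    (fun j t ht => hasDerivAt_ratDeriv c j (hη t ht))
    (fun i hi => eval_iterate_derivative_of_dvd (hQ.mul_left _) hi)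
    (fun i j hij => by
      by_cases hi : i < b
      · rw [eval_iterate_derivative_of_dvd (N := b) _ hi, zero_mul]
        simp
      · rw [ratDeriv_at_zero (by omega), mul_zero])
  have e1 : ∀ t : ℝ, (X ^ c * derivative^[b + c] (X ^ b * Q)).eval (t : ℂ) / (1 + η * t) =
      (derivative^[b + c] (X ^ b * Q)).eval (t : ℂ) * ratDeriv η c 0 t := fun t => by
    rw [ratDeriv_zero_right, eval_mul, eval_pow, eval_X]
    ring
  simp_rw [e1]
  rw [h, ← intervalIntegral.integral_const_mul, ← intervalIntegral.integral_const_mul]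
  refine intervalIntegral.integral_congr fun t ht => ?_
  have := ratDeriv_add c b (hη t ht)
  rw [add_comm c b] at this
  simp only [this, eval_mul, eval_pow, eval_X]
  have hs : (-1 : ℂ) ^ (b + c) * (-1) ^ b = (-1) ^ c := by
    rw [pow_add, mul_right_comm, ← mul_pow]; simp
  rw [← hs]
  ring

theorem integral_derivative_div {h : ℂ[X]} {a : ℕ} (hh : (X - C 1) ^ a ∣ h) {ξ : ℂ}
    (hξ : ∀ t ∈ Set.Icc (0 : ℝ) 1, t + ξ ≠ 0) :
    ∫ t in (0 : ℝ)..1, (derivative^[a] (X ^ a * h)).eval (t : ℂ) / (t + ξ) =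
      a.factorial * ∫ t in (0 : ℝ)..1, (t : ℂ) ^ a * h.eval (t : ℂ) / (t + ξ) ^ (a + 1) := by
  have hξ0 : ξ ≠ 0 := by simpa using hξ 0 (by simp)
  have := integral_shift_derivative_div (b := a) (c := 0) (Q := h) hh (η := ξ⁻¹) fun t ht => by
    have := hξ t ht
    contrapose! this
    rw [← mul_right_inj' (inv_ne_zero hξ0), mul_zero, ← this]
    field_simp
    ring
  have e1 : ∀ t : ℝ, (derivative^[a] (X ^ a * h)).eval (t : ℂ) / (t + ξ) = ξ⁻¹ *
      ((X ^ 0 * derivative^[a + 0] (X ^ a * h)).eval (t : ℂ) / (1 + ξ⁻¹ * t)) := fun t => by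
    rw [pow_zero, one_mul, add_zero]
    have : (t : ℂ) + ξ = ξ * (1 + ξ⁻¹ * t) := by field_simp; ring
    rw [this]
    field_simp
  simp_rw [e1]
  rw [intervalIntegral.integral_const_mul, this, pow_zero, one_mul, add_zero, mul_left_comm,
    ← intervalIntegral.integral_const_mul]
  congr 1
  refine intervalIntegral.integral_congr fun t ht => ?_
  have : (t : ℂ) + ξ = ξ * (1 + ξ⁻¹ * t) := by field_simp; ring
  simp only [this]
  rw [mul_pow, inv_pow, pow_succ ξ]
  field_simp
end partsIntegration

section kernel
open Complex Set MeasureTheory Filter Topology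

theorem exists_mul_le_norm_add {ξ : ℂ} (hξ : ξ ∈ slitPlane) :
    ∃ δ > 0, ∀ x y : ℝ, 0 ≤ x → 0 ≤ y → δ * (x + y) ≤ ‖(x : ℂ) + ξ * y‖ := by
  have h0 : ξ ≠ 0 := slitPlane_ne_zero hξ
  set r := ‖ξ‖ with hr
  have hr0 : 0 < r := norm_pos_iff.2 h0
  have hre : |ξ.re| ≤ r := abs_re_le_norm ξ
  have hc : 0 < r + ξ.re := by
    rcases hξ with h | h
    · linarith
    · have : |ξ.re| < r := abs_re_lt_norm.2 h
      linarith [neg_abs_le ξ.re]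
  have hk : 0 < (r + ξ.re) / (2 * r) := by positivity
  refine ⟨Real.sqrt ((r + ξ.re) / (2 * r)) * min 1 r, by positivity, fun x y hx hy => ?_⟩
  have hm : min 1 r * (x + y) ≤ x + r * y := by
    have h1 := mul_le_mul_of_nonneg_right (min_le_left 1 r) hx
    have h2 := mul_le_mul_of_nonneg_right (min_le_right 1 r) hy
    linarith
  rw [mul_assoc]
  refine (mul_le_mul_of_nonneg_left hm (Real.sqrt_nonneg _)).trans ?_
  refine le_of_sq_le_sq ?_ (norm_nonneg _)
  rw [mul_pow, Real.sq_sqrt hk.le, ← normSq_eq_norm_sq, normSq_apply]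
  have hsq : r ^ 2 = ξ.re * ξ.re + ξ.im * ξ.im := by rw [hr, ← normSq_eq_norm_sq, normSq_apply]
  simp only [add_re, ofReal_re, mul_re, ofReal_im, mul_zero, sub_zero, add_im, mul_im, zero_add]
  have e : (x + ξ.re * y) * (x + ξ.re * y) + ξ.im * y * (ξ.im * y) -
      (r + ξ.re) / (2 * r) * (x + r * y) ^ 2 = (r - ξ.re) / (2 * r) * (x - r * y) ^ 2 := by
    field_simp
    linear_combination (-2 * r * y ^ 2) * hsq
  have : 0 ≤ (r - ξ.re) / (2 * r) * (x - r * y) ^ 2 := by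
    have := le_abs_self ξ.re
    have : 0 ≤ r - ξ.re := by linarith
    positivity
  linarith

theorem one_add_mul_mem_slitPlane {ξ : ℂ} (hξ : ξ ∈ slitPlane) {y : ℝ} (hy : 0 ≤ y) :
    1 + ξ * y ∈ slitPlane := by
  rcases hy.eq_or_lt with rfl | hy
  · simp
  · rw [mem_slitPlane_iff] at hξ ⊢
    simp only [add_re, one_re, mul_re, ofReal_re, ofReal_im, mul_zero, sub_zero, add_im, one_im,
      mul_im, zero_add]
    rcases hξ with h | h
    · left; positivity
    · right; exact mul_ne_zero h hy.ne'

theorem real_mul_mem_slitPlane {ξ : ℂ} (hξ : ξ ∈ slitPlane) {t : ℝ} (ht : 0 < t) :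
    t * ξ ∈ slitPlane := by
  rw [mem_slitPlane_iff] at hξ ⊢
  rw [re_ofReal_mul, im_ofReal_mul]
  exact hξ.imp (mul_pos ht) (mul_ne_zero ht.ne')

theorem integrableOn_div_one_add_sq {t : ℝ} (ht : 0 < t) :
    IntegrableOn (fun y : ℝ => t / (1 + t * y) ^ 2) (Ioi 0) ∧
      ∫ y in Ioi (0 : ℝ), t / (1 + t * y) ^ 2 = 1 := by
  have hd : ∀ y ∈ Ici (0 : ℝ),
      HasDerivAt (fun y : ℝ => -(1 + t * y)⁻¹) (t / (1 + t * y) ^ 2) y := by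
    intro y hy
    have h0 : 1 + t * y ≠ 0 := by have : 0 ≤ y := hy; positivity
    refine ((((hasDerivAt_id y).const_mul t).const_add 1).inv h0).neg.congr_deriv ?_
    simp [neg_div]
  have hl : Tendsto (fun y : ℝ => -(1 + t * y)⁻¹) atTop (𝓝 0) := by
    rw [← neg_zero]
    exact (tendsto_inv_atTop_zero.comp
      (tendsto_atTop_add_const_left _ _ (tendsto_id.const_mul_atTop ht))).neg
  have hi := integrableOn_Ioi_deriv_of_nonneg (hd 0 self_mem_Ici).continuousAt.continuousWithinAt
    (fun y hy => hd y (Ioi_subset_Ici_self hy)) (fun y hy => by positivity) hl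
  refine ⟨hi, ?_⟩
  rw [integral_Ioi_of_hasDerivAt_of_tendsto (hd 0 self_mem_Ici).continuousAt.continuousWithinAt
    (fun y hy => hd y (Ioi_subset_Ici_self hy)) hi hl]
  simp

theorem integrableOn_one_div_one_add_sq :
    IntegrableOn (fun y : ℝ => 1 / (1 + y) ^ 2) (Ioi 0) := by
  simpa using (integrableOn_div_one_add_sq one_pos).1

theorem tendsto_log_one_add_mul_sub {ξ : ℂ} (hξ : ξ ∈ slitPlane) :
    Tendsto (fun y : ℝ => log (1 + ξ * y) - Real.log y) atTop (𝓝 (log ξ)) := by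
  have h1 : Tendsto (fun y : ℝ => ((y⁻¹ : ℝ) : ℂ) + ξ) atTop (𝓝 (((0 : ℝ) : ℂ) + ξ)) :=
    ((continuous_ofReal.tendsto 0).comp tendsto_inv_atTop_zero).add_const ξ
  rw [ofReal_zero, zero_add] at h1
  have h2 := (continuousAt_clog hξ).tendsto.comp h1
  refine h2.congr' ?_
  filter_upwards [eventually_gt_atTop 0] with y hy
  have hm := one_add_mul_mem_slitPlane hξ hy.le
  have e : ((y⁻¹ : ℝ) : ℂ) + ξ = ((y⁻¹ : ℝ) : ℂ) * (1 + ξ * y) := by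
    have : (y : ℂ) ≠ 0 := ofReal_ne_zero.2 hy.ne'
    push_cast
    field_simp
  rw [Function.comp_apply, e, log_ofReal_mul (inv_pos.2 hy) (slitPlane_ne_zero hm), Real.log_inv]
  push_cast
  ring

theorem integral_kernel {ω μ : ℂ} (hω : ω ∈ slitPlane) (hμ : μ ∈ slitPlane) {t : ℝ} (ht : 0 < t)
    (hne : ω - t * μ ≠ 0) : ∫ y in Ioi (0 : ℝ), ω / ((1 + ω * y) * (1 + t * μ * y)) =
      ω / (ω - t * μ) * (log ω - log μ - Real.log t) := by
  have htμ := real_mul_mem_slitPlane hμ ht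
  have hd1 : ∀ {ξ : ℂ}, ξ ∈ slitPlane → ∀ y ∈ Ici (0 : ℝ),
      HasDerivAt (fun y : ℝ => log (1 + ξ * y)) (ξ / (1 + ξ * y)) y := fun {ξ} hξ y hy => by
    have h1 : HasDerivAt (fun t : ℝ => 1 + ξ * (t : ℂ)) ξ y := by
      simpa using ((hasDerivAt_id (y : ℂ)).comp_ofReal.const_mul ξ).const_add 1
    exact h1.clog_real (one_add_mul_mem_slitPlane hξ hy)
  have hd : ∀ y ∈ Ici (0 : ℝ), HasDerivAt (fun y : ℝ => ω / (ω - t * μ) *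
      (log (1 + ω * y) - log (1 + t * μ * y))) (ω / ((1 + ω * y) * (1 + t * μ * y))) y := by
    intro y hy
    refine (((hd1 hω y hy).sub (hd1 htμ y hy)).const_mul _).congr_deriv ?_
    have n1 := slitPlane_ne_zero (one_add_mul_mem_slitPlane hω hy)
    have n2 := slitPlane_ne_zero (one_add_mul_mem_slitPlane htμ hy)
    field_simp
    ring
  have hl : Tendsto (fun y : ℝ => ω / (ω - t * μ) * (log (1 + ω * y) - log (1 + t * μ * y)))
      atTop (𝓝 (ω / (ω - t * μ) * (log ω - log μ - Real.log t))) := by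
    refine Tendsto.const_mul _ ?_
    have := (tendsto_log_one_add_mul_sub hω).sub (tendsto_log_one_add_mul_sub htμ)
    rw [log_ofReal_mul ht (slitPlane_ne_zero hμ)] at this
    convert this using 2 <;> ring
  obtain ⟨δ₁, hδ₁, h1⟩ := exists_mul_le_norm_add hω
  obtain ⟨δ₂, hδ₂, h2⟩ := exists_mul_le_norm_add htμ
  have hi : IntegrableOn (fun y : ℝ => ω / ((1 + ω * y) * (1 + t * μ * y))) (Ioi 0) := by
    refine (integrableOn_one_div_one_add_sq.const_mul (‖ω‖ / (δ₁ * δ₂))).mono' ?_ ?_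
    · exact ContinuousOn.aestronglyMeasurable (fun y hy => by
        have n1 := slitPlane_ne_zero (one_add_mul_mem_slitPlane hω (le_of_lt hy))
        have n2 := slitPlane_ne_zero (one_add_mul_mem_slitPlane htμ (le_of_lt hy))
        refine ContinuousAt.continuousWithinAt ?_
        exact continuousAt_const.div (by fun_prop) (mul_ne_zero n1 n2)) measurableSet_Ioi
    · refine (ae_restrict_iff' measurableSet_Ioi).2 (ae_of_all _ fun y hy => ?_)
      have hy : 0 < y := hy
      have h1 := h1 1 y zero_le_one hy.le
      have h2 := h2 1 y zero_le_one hy.le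
      rw [ofReal_one] at h1 h2
      rw [norm_div, norm_mul, div_mul_div_comm, mul_one]
      refine div_le_div_of_nonneg_left (norm_nonneg _) (by positivity) ?_
      calc δ₁ * δ₂ * (1 + y) ^ 2 = δ₁ * (1 + y) * (δ₂ * (1 + y)) := by ring
        _ ≤ _ := by gcongr
  rw [integral_Ioi_of_hasDerivAt_of_tendsto (hd 0 self_mem_Ici).continuousAt.continuousWithinAt
    (fun y hy => hd y (Ioi_subset_Ici_self hy)) hi hl]
  simp
end kernel

section linFormIntegral
open MeasureTheory Set

theorem integral_pow_mul_log (n : ℕ) :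
    ∫ t in (0 : ℝ)..1, t ^ n * Real.log t = -(1 / ((n : ℝ) + 1) ^ 2) := by
  have hc : Continuous fun t : ℝ => (t ^ n * (t * Real.log t)) / (n + 1) -
      t ^ (n + 1) / (n + 1 : ℝ) ^ 2 := by
    have := Real.continuous_mul_log
    fun_prop
  rw [intervalIntegral.integral_eq_sub_of_hasDerivAt_of_le zero_le_one hc.continuousOn
    (f' := fun t => t ^ n * Real.log t)]
  · simp
  · intro t ht
    have h1 := ((hasDerivAt_pow (n + 1) t).mul (Real.hasDerivAt_log ht.1.ne')).div_const (n + 1 : ℝ)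
    have h2 := (hasDerivAt_pow (n + 1) t).div_const ((n + 1 : ℝ) ^ 2)
    have h3 := h1.sub h2
    have e : (fun t : ℝ => (t ^ n * (t * Real.log t)) / (n + 1) - t ^ (n + 1) / (n + 1 : ℝ) ^ 2) =
        fun t => t ^ (n + 1) * Real.log t / (n + 1) - t ^ (n + 1) / (n + 1 : ℝ) ^ 2 := by
      funext t; ring
    rw [e]
    refine h3.congr_deriv ?_
    have := ht.1.ne'
    simp only [add_tsub_cancel_right]
    push_cast
    field_simp
    ring
  · exact intervalIntegral.intervalIntegrable_log'.continuousOn_mul (continuous_pow n).continuousOn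

theorem IntervalIntegrable.complex_ofReal {f : ℝ → ℝ} {a b : ℝ}
    (h : IntervalIntegrable f volume a b) :
    IntervalIntegrable (fun t => (f t : ℂ)) volume a b :=
  ⟨h.1.ofReal, h.2.ofReal⟩

theorem intervalIntegrable_mul_log {P : ℝ → ℂ} (hP : Continuous P) (c : ℂ) :
    IntervalIntegrable (fun t : ℝ => P t * (c - Real.log t)) volume 0 1 := by
  refine IntervalIntegrable.continuousOn_mul ?_ hP.continuousOn
  exact intervalIntegrable_const.sub
    (IntervalIntegrable.complex_ofReal intervalIntegral.intervalIntegrable_log')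

theorem integral_pow_mul_polynomial (e : ℕ → ℝ) (M s : ℕ) (c : ℂ) :
    ∫ t in (0 : ℝ)..1, (t : ℂ) ^ s * (∑ j ∈ Finset.range (M + 1), (e j : ℂ) * (t : ℂ) ^ j) *
      (c - Real.log t) = pfSum e M 2 (s : ℝ) + c * pfSum e M 1 (s : ℝ) := by
  have e1 : ∀ t : ℝ, (t : ℂ) ^ s * (∑ j ∈ Finset.range (M + 1), (e j : ℂ) * (t : ℂ) ^ j) *
      (c - Real.log t) = ∑ j ∈ Finset.range (M + 1), (e j : ℂ) * ((t : ℂ) ^ (s + j) *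
      (c - Real.log t)) := fun t => by
    rw [Finset.mul_sum, Finset.sum_mul]
    exact Finset.sum_congr rfl fun j _ => by rw [pow_add]; ring
  have e2 : ∀ N : ℕ, ∫ t in (0 : ℝ)..1, (t : ℂ) ^ N * (c - Real.log t) =
      c / (N + 1) + 1 / (N + 1) ^ 2 := fun N => by
    have h1 : ∀ t : ℝ, (t : ℂ) ^ N * (c - Real.log t) =
        c * ((t ^ N : ℝ) : ℂ) - ((t ^ N * Real.log t : ℝ) : ℂ) := fun t => by push_cast; ring
    simp_rw [h1]
    rw [intervalIntegral.integral_sub, intervalIntegral.integral_const_mul,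
      intervalIntegral.integral_ofReal, intervalIntegral.integral_ofReal, integral_pow,
      integral_pow_mul_log]
    · push_cast
      simp
      ring
    · exact Continuous.intervalIntegrable (by fun_prop) _ _
    · exact IntervalIntegrable.complex_ofReal
        (intervalIntegral.intervalIntegrable_log'.continuousOn_mul (continuous_pow N).continuousOn)
  simp_rw [e1]
  rw [intervalIntegral.integral_finsetSum]
  · simp_rw [intervalIntegral.integral_const_mul, e2]
    unfold pfSum
    push_cast
    rw [Finset.mul_sum, ← Finset.sum_add_distrib]
    exact Finset.sum_congr rfl fun j _ => by ring
  · intro j _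
    exact (intervalIntegrable_mul_log (P := fun t : ℝ => (t : ℂ) ^ (s + j))
        (by fun_prop) c).const_mul _

theorem linForm_add_eq_integral {x : ℝ} (hx : |x| < 1) (e : ℕ → ℝ) (M : ℕ) (c : ℂ) :
    (linForm x e M 2 + c * linForm x e M 1 : ℂ) = x * ∫ t in (0 : ℝ)..1,
      (∑ j ∈ Finset.range (M + 1), (e j : ℂ) * (t : ℂ) ^ j) * (c - Real.log t) / (1 - x * t) := by
  set P : ℝ → ℂ := fun t => ∑ j ∈ Finset.range (M + 1), (e j : ℂ) * (t : ℂ) ^ j with hP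
  have hPc : Continuous P := by fun_prop
  have hi := intervalIntegrable_mul_log hPc c
  have key := intervalIntegral.hasSum_integral_of_dominated_convergence (μ := volume) (a := 0)
    (b := 1) (F := fun s t => (x : ℂ) ^ (s + 1) * ((t : ℂ) ^ s * P t * (c - Real.log t)))
    (f := fun t => x * (P t * (c - Real.log t) / (1 - x * t)))
    (fun s t => |x| ^ s * (|x| * ‖P t * (c - Real.log t)‖)) ?_ ?_ ?_ ?_ ?_
  · have h1 := (summable_linForm hx e M 1).hasSum
    have h2 := (summable_linForm hx e M 2).hasSum
    have h3 := ((Complex.hasSum_ofReal.2 h2).add ((Complex.hasSum_ofReal.2 h1).mul_left c)).tsum_eq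
    rw [linForm, linForm, ← h3, ← intervalIntegral.integral_const_mul, ← key.tsum_eq]
    refine tsum_congr fun s => ?_
    rw [intervalIntegral.integral_const_mul, integral_pow_mul_polynomial]
    push_cast
    ring
  · intro s
    have hg : Continuous fun t : ℝ => (x : ℂ) ^ (s + 1) * (t : ℂ) ^ s := by fun_prop
    have h := (hi.continuousOn_mul hg.continuousOn).1.aestronglyMeasurable
    rw [uIoc_of_le zero_le_one]
    exact h.congr (ae_of_all _ fun t => by simp only; ring)
  · refine fun s => ae_of_all _ fun t ht => ?_
    rw [uIoc_of_le zero_le_one] at ht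
    rw [mul_assoc ((t : ℂ) ^ s), norm_mul, norm_mul, norm_pow, norm_pow, pow_succ,
        Complex.norm_real,
      Complex.norm_real, Real.norm_eq_abs, Real.norm_eq_abs, abs_of_pos ht.1, mul_assoc]
    have : t ^ s ≤ 1 := pow_le_one₀ ht.1.le ht.2
    gcongr
    exact mul_le_of_le_one_left (norm_nonneg _) this
  · exact ae_of_all _ fun t _ => (summable_geometric_of_lt_one (abs_nonneg x) hx).mul_right _
  · simp_rw [tsum_mul_right]
    exact (hi.norm.const_mul _).const_mul _
  · refine ae_of_all _ fun t ht => ?_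
    rw [uIoc_of_le zero_le_one] at ht
    have : ‖(x * t : ℂ)‖ < 1 := by
      rw [norm_mul, Complex.norm_real, Complex.norm_real, Real.norm_eq_abs, Real.norm_eq_abs,
        abs_of_pos ht.1]
      nlinarith [abs_nonneg x, ht.1, ht.2]
    have := (hasSum_geometric_of_norm_lt_one this).mul_left (x * (P t * (c - Real.log t)))
    rw [← div_eq_mul_inv, ← mul_div_assoc] at *
    exact this.congr_fun fun s => by rw [mul_pow]; ring
end linFormIntegral

section doubleIntegral
open Complex Set MeasureTheory Polynomial

theorem integral_integral_swap_of_norm_le {F : ℝ → ℝ → ℂ} {G : ℝ → ℝ → ℝ} {C : ℝ}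
    (hF : ContinuousOn (Function.uncurry F) (Ioc 0 1 ×ˢ Ioi 0))
    (hG : ∀ t ∈ Ioc (0 : ℝ) 1, IntegrableOn (G t) (Ioi 0) ∧ ∫ y in Ioi 0, G t y = 1)
    (hFG : ∀ t ∈ Ioc (0 : ℝ) 1, ∀ y ∈ Ioi (0 : ℝ), ‖F t y‖ ≤ C * G t y) :
    ∫ t in (0 : ℝ)..1, ∫ y in Ioi 0, F t y = ∫ y in Ioi 0, ∫ t in (0 : ℝ)..1, F t y := by
  simp_rw [intervalIntegral.integral_of_le zero_le_one]
  refine integral_integral_swap ?_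
  have hm : AEStronglyMeasurable (Function.uncurry F)
      ((volume.restrict (Ioc (0 : ℝ) 1)).prod (volume.restrict (Ioi (0 : ℝ)))) := by
    rw [Measure.prod_restrict]
    exact hF.aestronglyMeasurable (measurableSet_Ioc.prod measurableSet_Ioi)
  rw [integrable_prod_iff hm]
  have hb : ∀ t ∈ Ioc (0 : ℝ) 1, ∀ᵐ y ∂(volume.restrict (Ioi (0 : ℝ))), ‖F t y‖ ≤ C * G t y :=
    fun t ht => (ae_restrict_iff' measurableSet_Ioi).2 (ae_of_all _ (hFG t ht))
  have hi : ∀ t ∈ Ioc (0 : ℝ) 1, IntegrableOn (F t) (Ioi 0) := fun t ht => by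
    refine Integrable.mono' ((hG t ht).1.const_mul C) ?_ (hb t ht)
    refine ContinuousOn.aestronglyMeasurable ?_ measurableSet_Ioi
    exact hF.comp (f := fun y : ℝ => (t, y)) (by fun_prop) fun y hy => ⟨ht, hy⟩
  refine ⟨(ae_restrict_iff' measurableSet_Ioc).2 (ae_of_all _ hi), ?_⟩
  have hc : Integrable (fun _ : ℝ => C) (volume.restrict (Ioc (0 : ℝ) 1)) :=
    integrableOn_const (by simp)
  refine hc.mono' hm.norm.integral_prod_right' ?_
  refine (ae_restrict_iff' measurableSet_Ioc).2 (ae_of_all _ fun t ht => ?_)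
  rw [Real.norm_of_nonneg (integral_nonneg fun _ => norm_nonneg _)]
  calc _ ≤ ∫ y in Ioi 0, C * G t y :=
        integral_mono_ae (hi t ht).norm ((hG t ht).1.const_mul C) (hb t ht)
    _ = C := by rw [integral_const_mul, (hG t ht).2, mul_one]

theorem exists_norm_eval_le (P : ℂ[X]) :
    ∃ C : ℝ, 0 ≤ C ∧ ∀ t ∈ Icc (0 : ℝ) 1, ‖P.eval (t : ℂ)‖ ≤ C := by
  have hc : Continuous fun t : ℝ => P.eval (t : ℂ) := P.continuous.comp continuous_ofReal
  obtain ⟨C, hC⟩ := isCompact_Icc.exists_bound_of_continuousOn (hc.continuousOn (s := Icc 0 1))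
  exact ⟨C, (norm_nonneg _).trans (hC 0 (by simp)), hC⟩

theorem integrableOn_one_div_one_add_sq' : ∀ t ∈ Ioc (0 : ℝ) 1,
    IntegrableOn (fun y : ℝ => 1 / (1 + y) ^ 2) (Ioi 0) ∧ ∫ y in Ioi 0, 1 / (1 + y) ^ 2 = (1 : ℝ) :=
  fun _ _ => by simpa using integrableOn_div_one_add_sq zero_lt_one

/-- The double integral attached to the polynomial `h`, over the rays spanned by `ω` and `μ`. -/
noncomputable def doubleIntegral (ω μ : ℂ) (a b c : ℕ) (h : ℂ[X]) : ℂ :=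
  ∫ v in Ioi (0 : ℝ), ω * (μ * v) ^ b / (1 + μ * v) ^ (b + c + 1) *
    ∫ t in (0 : ℝ)..1, (t : ℂ) ^ a * h.eval (t : ℂ) / (t + ω * v) ^ (a + 1)

theorem integral_polynomial_mul_log_eq {ω μ : ℂ} (hω : ω ∈ slitPlane) (hμ : μ ∈ slitPlane) {x : ℝ}
    (hx : |x| < 1) (hμx : μ = x * ω) {a b c : ℕ} (hb : 1 ≤ b) (hc : 1 ≤ c) {h : ℂ[X]}
    (hh : (X - C 1) ^ (a + (b + c)) ∣ h) :
    ∫ t in (0 : ℝ)..1, (X ^ c * derivative^[b + c] (X ^ b * derivative^[a] (X ^ a * h))).eval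
      (t : ℂ) * (log ω - log μ - Real.log t) / (1 - x * t) =
      (-1) ^ c * (b + c).factorial * a.factorial * doubleIntegral ω μ a b c h := by
  obtain ⟨δ, hδ, hωδ⟩ := exists_mul_le_norm_add hω
  obtain ⟨ε, hε, hμε⟩ := exists_mul_le_norm_add hμ
  have hω1 : ∀ y : ℝ, 0 ≤ y → δ * (1 + y) ≤ ‖1 + ω * y‖ := fun y hy => by
    simpa using hωδ 1 y zero_le_one hy
  have hμ1 : ∀ y : ℝ, 0 ≤ y → ε * (1 + y) ≤ ‖1 + μ * y‖ := fun y hy => by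
    simpa using hμε 1 y zero_le_one hy
  have hω0 : ∀ y : ℝ, 0 ≤ y → 1 + ω * y ≠ 0 := fun y hy =>
    slitPlane_ne_zero (one_add_mul_mem_slitPlane hω hy)
  have hμ0 : ∀ y : ℝ, 0 ≤ y → 1 + μ * y ≠ 0 := fun y hy =>
    slitPlane_ne_zero (one_add_mul_mem_slitPlane hμ hy)
  have hωt : ∀ t y : ℝ, 0 < t → 0 < y → (t : ℂ) + ω * y ≠ 0 := fun t y ht hy =>
    norm_pos_iff.1 ((by positivity : 0 < δ * (t + y)).trans_le (hωδ t y ht.le hy.le))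
  set Q : ℂ[X] := derivative^[a] (X ^ a * h) with hQdef
  set P₁ : ℂ[X] := derivative^[b + c] (X ^ b * Q) with hP₁
  have hQ : (X - C 1) ^ (b + c) ∣ Q := by
    have := pow_sub_dvd_iterate_derivative_of_pow_dvd a (hh.mul_left (X ^ a))
    rwa [Nat.add_sub_cancel_left] at this
  obtain ⟨CQ, hCQ0, hCQ⟩ := exists_norm_eval_le Q
  obtain ⟨CP, hCP0, hCP⟩ := exists_norm_eval_le P₁
  have step1 : ∫ t in (0 : ℝ)..1, (X ^ c * P₁).eval (t : ℂ) * (log ω - log μ - Real.log t) /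
      (1 - x * t) = ∫ t in (0 : ℝ)..1, ∫ y in Ioi (0 : ℝ), (X ^ c * P₁).eval (t : ℂ) *
        (ω / ((1 + ω * y) * (1 + t * μ * y))) := by
    rw [intervalIntegral.integral_of_le zero_le_one, intervalIntegral.integral_of_le zero_le_one]
    refine setIntegral_congr_fun measurableSet_Ioc fun t ht => ?_
    have hxt : 1 - (x : ℂ) * t ≠ 0 := by
      have : x * t < 1 := by nlinarith [abs_lt.1 hx, ht.1, ht.2]
      rw [← ofReal_mul, ← ofReal_one, ← ofReal_sub, ofReal_ne_zero]
      linarith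
    have e : ω - t * μ = ω * (1 - x * t) := by rw [hμx]; ring
    have hω00 := slitPlane_ne_zero hω
    rw [integral_const_mul, integral_kernel hω hμ ht.1 (by rw [e]; exact mul_ne_zero hω00 hxt), e]
    field_simp
  have step2 : ∫ t in (0 : ℝ)..1, ∫ y in Ioi (0 : ℝ), (X ^ c * P₁).eval (t : ℂ) *
        (ω / ((1 + ω * y) * (1 + t * μ * y))) = ∫ y in Ioi (0 : ℝ), ∫ t in (0 : ℝ)..1,
        (X ^ c * P₁).eval (t : ℂ) * (ω / ((1 + ω * y) * (1 + t * μ * y))) := by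
    refine integral_integral_swap_of_norm_le (G := fun _ y => 1 / (1 + y) ^ 2)
      (C := CP * ‖ω‖ / (δ * ε)) ?_ integrableOn_one_div_one_add_sq' ?_
    · refine ContinuousOn.mul ((X ^ c * P₁).continuous.comp
        (continuous_ofReal.comp continuous_fst)).continuousOn ?_
      refine ContinuousOn.div (by fun_prop) (by fun_prop) ?_
      rintro ⟨t, y⟩ ⟨ht, hy⟩
      refine mul_ne_zero (hω0 y (le_of_lt hy)) ?_
      have := hμ0 (t * y) (mul_nonneg ht.1.le (le_of_lt hy))
      push_cast at this
      convert this using 1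
      ring
    · intro t ht y hy
      have ht0 := ht.1
      have hy0 : 0 < y := hy
      have h1 := hω1 y hy0.le
      have h2 : ε * (t * (1 + y)) ≤ ‖1 + t * μ * y‖ := by
        have := hμ1 (t * y) (by positivity)
        push_cast at this
        rw [show (1 : ℂ) + t * μ * y = 1 + μ * (t * y) by ring]
        refine le_trans (mul_le_mul_of_nonneg_left ?_ hε.le) this
        nlinarith [ht.2]
      have h3 : ‖(X ^ c * P₁).eval (t : ℂ)‖ ≤ t * CP := by
        rw [eval_mul, eval_pow, eval_X, norm_mul, norm_pow, norm_real, Real.norm_of_nonneg ht0.le]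
        refine mul_le_mul ?_ (hCP t ⟨ht0.le, ht.2⟩) (norm_nonneg _) ht0.le
        exact pow_le_of_le_one ht0.le ht.2 (by omega)
      rw [norm_mul, norm_div, norm_mul]
      calc _ ≤ t * CP * (‖ω‖ / ((δ * (1 + y)) * (ε * (t * (1 + y))))) := by gcongr
        _ = _ := by field_simp
  have step3 : ∀ y ∈ Ioi (0 : ℝ), ∫ t in (0 : ℝ)..1,
        (X ^ c * P₁).eval (t : ℂ) * (ω / ((1 + ω * y) * (1 + t * μ * y))) =
        (-1) ^ c * (b + c).factorial * ∫ t in (0 : ℝ)..1, Q.eval (t : ℂ) *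
            (t ^ b * ω * (μ * y) ^ b /
          ((1 + ω * y) * (1 + t * μ * y) ^ (b + c + 1))) := by
    intro y hy
    have hy0 : 0 < y := hy
    have := integral_shift_derivative_div hQ (η := μ * y) (c := c) (fun t ht => by
      have := hμ0 (y * t) (mul_nonneg hy0.le ht.1)
      push_cast at this
      rwa [← mul_assoc] at this)
    have e1 : ∀ t : ℝ, (X ^ c * P₁).eval (t : ℂ) * (ω / ((1 + ω * y) * (1 + t * μ * y))) =
        (ω / (1 + ω * y)) * ((X ^ c * P₁).eval (t : ℂ) / (1 + μ * y * t)) := fun t => by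
      rw [show (1 : ℂ) + t * μ * y = 1 + μ * y * t by ring, div_mul_eq_div_div]
      ring
    have e2 : ∀ t : ℝ, Q.eval (t : ℂ) * (t ^ b * ω * (μ * y) ^ b /
          ((1 + ω * y) * (1 + t * μ * y) ^ (b + c + 1))) = (ω / (1 + ω * y)) *
          (t ^ b * Q.eval (t : ℂ) * (μ * y) ^ b / (1 + μ * y * t) ^ (b + c + 1)) := fun t => by
      rw [show (1 : ℂ) + t * μ * y = 1 + μ * y * t by ring, div_mul_eq_div_div]
      ring
    simp_rw [e1, e2]
    rw [intervalIntegral.integral_const_mul, intervalIntegral.integral_const_mul, this]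
    ring
  have step4 : ∫ t in (0 : ℝ)..1, ∫ y in Ioi (0 : ℝ), Q.eval (t : ℂ) * (t ^ b * ω * (μ * y) ^ b /
          ((1 + ω * y) * (1 + t * μ * y) ^ (b + c + 1))) = ∫ y in Ioi (0 : ℝ), ∫ t in (0 : ℝ)..1,
          Q.eval (t : ℂ) * (t ^ b * ω * (μ * y) ^ b /
          ((1 + ω * y) * (1 + t * μ * y) ^ (b + c + 1))) := by
    refine integral_integral_swap_of_norm_le (G := fun t y => t / (1 + t * y) ^ 2)
      (C := CQ * ‖ω‖ * ‖μ‖ ^ b / (δ * ε ^ (b + c + 1)))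
      ?_ (fun t ht => integrableOn_div_one_add_sq ht.1) ?_
    · refine ContinuousOn.mul (Q.continuous.comp
        (continuous_ofReal.comp continuous_fst)).continuousOn ?_
      refine ContinuousOn.div (by fun_prop) (by fun_prop) ?_
      rintro ⟨t, y⟩ ⟨ht, hy⟩
      refine mul_ne_zero (hω0 y (le_of_lt hy)) (pow_ne_zero _ ?_)
      have := hμ0 (t * y) (mul_nonneg ht.1.le (le_of_lt hy))
      push_cast at this
      convert this using 1
      ring
    · intro t ht y hy
      have ht0 := ht.1
      have hy0 : 0 < y := hy
      have h1 := hω1 y hy0.le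
      have h2 : ε * (1 + t * y) ≤ ‖1 + t * μ * y‖ := by
        have := hμ1 (t * y) (by positivity)
        push_cast at this
        rwa [show (1 : ℂ) + t * μ * y = 1 + μ * (t * y) by ring]
      have h3 := hCQ t ⟨ht0.le, ht.2⟩
      have h4 : (t * y) ^ b / ((1 + y) * (1 + t * y) ^ (b + c + 1)) ≤ t / (1 + t * y) ^ 2 := by
        rw [div_le_div_iff₀ (by positivity) (by positivity)]
        have h5 : (t * y) ^ (b - 1) ≤ (1 + t * y) ^ (b + c - 1) :=
          (pow_le_pow_left₀ (by positivity) (by linarith) _).trans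
            (pow_le_pow_right₀ (by nlinarith [mul_pos ht0 hy0]) (by omega))
        have e1 : (t * y) ^ b = (t * y) ^ (b - 1) * (t * y) := by
          rw [← pow_succ, Nat.sub_add_cancel hb]
        have e2 : (1 + t * y) ^ (b + c + 1) = (1 + t * y) ^ (b + c - 1) * (1 + t * y) ^ 2 := by
          rw [← pow_add]; congr 1; omega
        rw [e1, e2]
        calc _ ≤ (1 + t * y) ^ (b + c - 1) * (t * (1 + y)) * (1 + t * y) ^ 2 := by
              gcongr; linarith
          _ = _ := by ring
      simp only [norm_mul, norm_div, norm_pow, norm_real, Real.norm_of_nonneg ht0.le,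
        Real.norm_of_nonneg hy0.le]
      calc _ ≤ CQ * (t ^ b * ‖ω‖ * (‖μ‖ * y) ^ b / ((δ * (1 + y)) *
            (ε * (1 + t * y)) ^ (b + c + 1))) := by gcongr
        _ = CQ * ‖ω‖ * ‖μ‖ ^ b / (δ * ε ^ (b + c + 1)) *
            ((t * y) ^ b / ((1 + y) * (1 + t * y) ^ (b + c + 1))) := by
          simp only [mul_pow]; field_simp
        _ ≤ _ := by gcongr
  have step5 : ∀ t ∈ Ioc (0 : ℝ) 1, ∫ y in Ioi (0 : ℝ), Q.eval (t : ℂ) * (t ^ b * ω * (μ * y) ^ b /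
          ((1 + ω * y) * (1 + t * μ * y) ^ (b + c + 1))) = ∫ v in Ioi (0 : ℝ), Q.eval (t : ℂ) *
          (ω * (μ * v) ^ b / ((t + ω * v) * (1 + μ * v) ^ (b + c + 1))) := by
    intro t ht
    have ht0 : (t : ℂ) ≠ 0 := ofReal_ne_zero.2 ht.1.ne'
    have := integral_comp_mul_left_Ioi' (fun v : ℝ => Q.eval (t : ℂ) *
          (ω * (μ * v) ^ b / ((t + ω * v) * (1 + μ * v) ^ (b + c + 1)))) 0 ht.1
    rw [mul_zero] at this
    rw [← this, ← integral_smul]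
    refine integral_congr_ae (ae_of_all _ fun y => ?_)
    simp only [real_smul]
    push_cast
    rw [show (t : ℂ) + ω * (t * y) = t * (1 + ω * y) by ring,
      show μ * ((t : ℂ) * y) = t * μ * y by ring, show (t : ℂ) * μ * y = t * (μ * y) by ring,
      mul_pow]
    by_cases hz : 1 + ω * y = 0
    · simp [hz]
    · field_simp
      simp only [mul_pow]
      ring
  have step6 : ∫ t in (0 : ℝ)..1, ∫ v in Ioi (0 : ℝ), Q.eval (t : ℂ) *
          (ω * (μ * v) ^ b / ((t + ω * v) * (1 + μ * v) ^ (b + c + 1))) =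
          ∫ v in Ioi (0 : ℝ), ∫ t in (0 : ℝ)..1, Q.eval (t : ℂ) *
          (ω * (μ * v) ^ b / ((t + ω * v) * (1 + μ * v) ^ (b + c + 1))) := by
    refine integral_integral_swap_of_norm_le (G := fun _ y => 1 / (1 + y) ^ 2)
      (C := CQ * ‖ω‖ * ‖μ‖ ^ b / (δ * ε ^ (b + c + 1))) ?_ integrableOn_one_div_one_add_sq' ?_
    · refine ContinuousOn.mul (Q.continuous.comp
        (continuous_ofReal.comp continuous_fst)).continuousOn ?_
      refine ContinuousOn.div (by fun_prop) (by fun_prop) ?_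
      rintro ⟨t, y⟩ ⟨ht, hy⟩
      exact mul_ne_zero (hωt t y ht.1 hy) (pow_ne_zero _ (hμ0 y (le_of_lt hy)))
    · intro t ht y hy
      have ht0 := ht.1
      have hy0 : 0 < y := hy
      have h1 : δ * y ≤ ‖(t : ℂ) + ω * y‖ :=
        le_trans (mul_le_mul_of_nonneg_left (by linarith) hδ.le) (hωδ t y ht0.le hy0.le)
      have h2 := hμ1 y hy0.le
      have h3 := hCQ t ⟨ht0.le, ht.2⟩
      have h4 : y ^ b / (y * (1 + y) ^ (b + c + 1)) ≤ 1 / (1 + y) ^ 2 := by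
        rw [div_le_div_iff₀ (by positivity) (by positivity)]
        have h5 : y ^ (b - 1) ≤ (1 + y) ^ (b + c - 1) :=
          (pow_le_pow_left₀ (by positivity) (by linarith) _).trans
            (pow_le_pow_right₀ (by linarith) (by omega))
        have e1 : y ^ b = y ^ (b - 1) * y := by rw [← pow_succ, Nat.sub_add_cancel hb]
        have e2 : (1 + y) ^ (b + c + 1) = (1 + y) ^ (b + c - 1) * (1 + y) ^ 2 := by
          rw [← pow_add]; congr 1; omega
        rw [e1, e2]
        calc _ ≤ (1 + y) ^ (b + c - 1) * y * (1 + y) ^ 2 := by gcongr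
          _ = _ := by ring
      simp only [norm_mul, norm_div, norm_pow, norm_real, Real.norm_of_nonneg hy0.le]
      calc _ ≤ CQ * (‖ω‖ * (‖μ‖ * y) ^ b / ((δ * y) * (ε * (1 + y)) ^ (b + c + 1))) := by gcongr
        _ = CQ * ‖ω‖ * ‖μ‖ ^ b / (δ * ε ^ (b + c + 1)) *
            (y ^ b / (y * (1 + y) ^ (b + c + 1))) := by
          simp only [mul_pow]; field_simp
        _ ≤ _ := by gcongr
  have step7 : ∀ v ∈ Ioi (0 : ℝ), ∫ t in (0 : ℝ)..1, Q.eval (t : ℂ) *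
          (ω * (μ * v) ^ b / ((t + ω * v) * (1 + μ * v) ^ (b + c + 1))) =
          a.factorial * (ω * (μ * v) ^ b / (1 + μ * v) ^ (b + c + 1) *
    ∫ t in (0 : ℝ)..1, (t : ℂ) ^ a * h.eval (t : ℂ) / (t + ω * v) ^ (a + 1)) := by
    intro v hv
    have hv0 : 0 < v := hv
    have := integral_derivative_div ((pow_dvd_pow _ (by omega : a ≤ a + (b + c))).trans hh)
      (ξ := ω * v) (fun t ht => by
        refine norm_pos_iff.1 (lt_of_lt_of_le ?_ (hωδ t v ht.1 hv0.le))
        have := ht.1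
        positivity)
    have e1 : ∀ t : ℝ, Q.eval (t : ℂ) * (ω * (μ * v) ^ b /
        ((t + ω * v) * (1 + μ * v) ^ (b + c + 1))) = ω * (μ * v) ^ b / (1 + μ * v) ^ (b + c + 1) *
        (Q.eval (t : ℂ) / (t + ω * v)) := fun t => by
      rw [mul_comm ((t : ℂ) + ω * v), div_mul_eq_div_div]
      ring
    simp_rw [e1]
    rw [intervalIntegral.integral_const_mul, this]
    ring
  rw [step1, step2, setIntegral_congr_fun measurableSet_Ioi step3, integral_const_mul, ← step4,
    intervalIntegral.integral_of_le zero_le_one, setIntegral_congr_fun measurableSet_Ioc step5,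
    ← intervalIntegral.integral_of_le zero_le_one, step6,
    setIntegral_congr_fun measurableSet_Ioi step7, integral_const_mul, doubleIntegral, ← mul_assoc]
end doubleIntegral

section doubleIntegralBound
open Complex Set MeasureTheory Polynomial

theorem norm_doubleIntegral_le {ω μ : ℂ} (hω : ω ∈ slitPlane) (hμ : μ ∈ slitPlane) {a b c N : ℕ}
    (hb : 1 ≤ b) (hc : 1 ≤ c) {ρ : ℝ} (hρ0 : 0 ≤ ρ)
    (hρ : ∀ t ∈ Ioc (0 : ℝ) 1, ∀ v ∈ Ioi (0 : ℝ),
      t ^ a * (1 - t) ^ N * ‖μ * v‖ ^ b / (‖1 + μ * v‖ ^ (b + c) * ‖t + ω * v‖ ^ a) ≤ ρ) :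
    ∃ K : ℝ, 0 ≤ K ∧ ∀ (m : ℕ) (g : ℂ[X]) (B : ℝ), (∀ t ∈ Icc (0 : ℝ) 1, ‖g.eval (t : ℂ)‖ ≤ B) →
      ‖doubleIntegral ω μ (a * (m + 1)) (b * (m + 1)) (c * (m + 1))
        ((1 - X) ^ (N * (m + 1)) * g)‖ ≤ K * B * ρ ^ m := by
  obtain ⟨δ, hδ, hωδ⟩ := exists_mul_le_norm_add hω
  obtain ⟨ε, hε, hμε⟩ := exists_mul_le_norm_add hμ
  have hμ1 : ∀ y : ℝ, 0 ≤ y → ε * (1 + y) ≤ ‖1 + μ * y‖ := fun y hy => by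
    simpa using hμε 1 y zero_le_one hy
  set K : ℝ := ‖ω‖ * ‖μ‖ ^ b / (δ ^ (a + 1) * ε ^ (b + c + 1)) with hK
  refine ⟨K, by positivity, fun m g B hB => ?_⟩
  have hB0 : 0 ≤ B := (norm_nonneg _).trans (hB 0 (by simp))
  have hpt : ∀ v ∈ Ioi (0 : ℝ), ‖ω * (μ * v) ^ (b * (m + 1)) /
      (1 + μ * v) ^ (b * (m + 1) + c * (m + 1) + 1) * ∫ t in (0 : ℝ)..1, (t : ℂ) ^ (a * (m + 1)) *
      ((1 - X) ^ (N * (m + 1)) * g).eval (t : ℂ) / (t + ω * v) ^ (a * (m + 1) + 1)‖ ≤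
      K * B * ρ ^ m * (1 / (1 + v) ^ 2) := by
    intro v hv
    have hv0 : 0 < v := hv
    have h2 := hμ1 v hv0.le
    rw [← intervalIntegral.integral_const_mul]
    refine (intervalIntegral.norm_integral_le_of_norm_le_const
      (C := K * B * ρ ^ m * (1 / (1 + v) ^ 2)) fun t ht => ?_).trans (by simp)
    rw [uIoc_of_le zero_le_one] at ht
    have ht0 := ht.1
    have h1 := hωδ t v ht0.le hv0.le
    have h3 := hB t ⟨ht0.le, ht.2⟩
    have h4 : ‖(1 : ℂ) - t‖ = 1 - t := by
      rw [← ofReal_one, ← ofReal_sub, norm_real, Real.norm_of_nonneg (by linarith [ht.2])]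
    have hωp : 0 < ‖(t : ℂ) + ω * v‖ := lt_of_lt_of_le (by positivity) h1
    have hμp : 0 < ‖1 + μ * v‖ := lt_of_lt_of_le (by positivity) h2
    have h5 : t ^ a * v ^ b / ((1 + v) ^ (b + c + 1) * (t + v) ^ (a + 1)) ≤ 1 / (1 + v) ^ 2 := by
      rw [div_le_div_iff₀ (by positivity) (by positivity)]
      have h6 : v ^ (b - 1) ≤ (1 + v) ^ (b + c - 1) :=
        (pow_le_pow_left₀ (by positivity) (by linarith) _).trans
          (pow_le_pow_right₀ (by linarith) (by omega))
      have h7 : t ^ a * v ≤ (t + v) ^ (a + 1) := by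
        rw [pow_succ]
        gcongr <;> linarith
      have e1 : v ^ b = v ^ (b - 1) * v := by rw [← pow_succ, Nat.sub_add_cancel hb]
      have e2 : (1 + v) ^ (b + c + 1) = (1 + v) ^ (b + c - 1) * (1 + v) ^ 2 := by
        rw [← pow_add]; congr 1; omega
      rw [e1, e2]
      calc _ = v ^ (b - 1) * (t ^ a * v) * (1 + v) ^ 2 := by ring
        _ ≤ (1 + v) ^ (b + c - 1) * (t + v) ^ (a + 1) * (1 + v) ^ 2 := by gcongr
        _ = _ := by ring
    have h8 : t ^ a * (1 - t) ^ N * ‖μ * v‖ ^ b / (‖1 + μ * v‖ ^ (b + c) * ‖t + ω * v‖ ^ a) *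
        (‖ω‖ / (‖1 + μ * v‖ * ‖t + ω * v‖)) ≤ K * (1 / (1 + v) ^ 2) := by
      have h9 : (1 - t) ^ N ≤ 1 := pow_le_one₀ (by linarith [ht.2]) (by linarith)
      calc _ = t ^ a * (1 - t) ^ N * (‖μ‖ * v) ^ b * ‖ω‖ /
            (‖1 + μ * v‖ ^ (b + c + 1) * ‖t + ω * v‖ ^ (a + 1)) := by
            rw [norm_mul, norm_real, Real.norm_of_nonneg hv0.le]
            rw [div_mul_div_comm]
            congr 1
            ring
        _ ≤ t ^ a * 1 * (‖μ‖ * v) ^ b * ‖ω‖ /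
            ((ε * (1 + v)) ^ (b + c + 1) * (δ * (t + v)) ^ (a + 1)) := by gcongr
        _ = K * (t ^ a * v ^ b / ((1 + v) ^ (b + c + 1) * (t + v) ^ (a + 1))) := by
            rw [hK]; simp only [mul_pow]; field_simp
        _ ≤ _ := by gcongr
    have h10 := hρ t ht v hv
    simp only [eval_mul, eval_pow, eval_sub, eval_one, eval_X, norm_mul, norm_div, norm_pow, h4]
    simp only [norm_mul] at h8 h10
    rw [norm_real t, Real.norm_of_nonneg ht0.le]
    set V := ‖μ‖ * ‖(v : ℂ)‖
    set p := ‖1 + μ * v‖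
    set q := ‖(t : ℂ) + ω * v‖
    have ht1 : 0 ≤ 1 - t := by linarith [ht.2]
    have hV : 0 ≤ V := by positivity
    clear_value V p q
    calc _ = (t ^ a * (1 - t) ^ N * V ^ b / (p ^ (b + c) * q ^ a)) ^ m *
          (t ^ a * (1 - t) ^ N * V ^ b / (p ^ (b + c) * q ^ a) * (‖ω‖ / (p * q))) *
          ‖g.eval (t : ℂ)‖ := by
          simp only [div_pow, mul_pow, ← pow_mul]
          field_simp
          ring
      _ ≤ ρ ^ m * (K * (1 / (1 + v) ^ 2)) * B := by gcongr
      _ = _ := by ring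
  have h_int := integrableOn_one_div_one_add_sq' 1 (by simp)
  refine (norm_integral_le_of_norm_le (h_int.1.const_mul (K * B * ρ ^ m))
    ((ae_restrict_iff' measurableSet_Ioi).2 (ae_of_all _ hpt))).trans ?_
  rw [integral_const_mul, h_int.2, mul_one]

/-- The generating polynomial of `(-1)^j * M.choose j * (-(j+1))^k`. -/
noncomputable def shiftPoly (M k : ℕ) : ℂ[X] :=
  ∑ j ∈ Finset.range (M + 1), C ((-1 : ℂ) ^ j * M.choose j * (-((j : ℂ) + 1)) ^ k) * X ^ j

theorem shiftPoly_zero (M : ℕ) : shiftPoly M 0 = (1 - X) ^ M := by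
  rw [sub_eq_neg_add, add_pow, shiftPoly]
  refine Finset.sum_congr rfl fun j _ => ?_
  rw [neg_pow (X : ℂ[X]) j]
  simp only [pow_zero, mul_one, C_mul, C_pow, C_neg, C_1, C_eq_natCast, one_pow]
  ring

theorem shiftPoly_succ (M k : ℕ) : shiftPoly M (k + 1) = -derivative (X * shiftPoly M k) := by
  simp only [shiftPoly]
  rw [Finset.mul_sum, derivative_sum, ← Finset.sum_neg_distrib]
  refine Finset.sum_congr rfl fun j _ => ?_
  rw [show X * (C ((-1 : ℂ) ^ j * M.choose j * (-((j : ℂ) + 1)) ^ k) * X ^ j) =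
    C ((-1 : ℂ) ^ j * M.choose j * (-((j : ℂ) + 1)) ^ k) * X ^ (j + 1) by ring,
    derivative_C_mul_X_pow, pow_succ, Nat.add_sub_cancel, ← neg_mul, ← C_neg]
  push_cast
  congr 2
  ring

theorem exists_shiftPoly_eq (N : ℕ) {k : ℕ} (hk : k < 3) : ∃ g : ℂ[X],
    shiftPoly (N + 2) k = (1 - X) ^ N * g ∧
      ∀ t ∈ Icc (0 : ℝ) 1, ‖g.eval (t : ℂ)‖ ≤ 5 * ((N : ℝ) + 2) ^ 2 := by
  have hC : (C 2 : ℂ[X]) = 2 := map_ofNat C 2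
  have h1 : shiftPoly (N + 2) 1 = (1 - X) ^ N * (((N : ℂ[X]) + 2) * X * (1 - X) - (1 - X) ^ 2) := by
    rw [shiftPoly_succ, shiftPoly_zero, derivative_mul, derivative_X, derivative_pow]
    simp
    rw [hC]
    ring
  have key : ∀ (r : ℝ → ℝ) (g : ℂ[X]), (∀ t : ℝ, g.eval (t : ℂ) = r t) →
      (∀ t ∈ Icc (0 : ℝ) 1, |r t| ≤ 5 * ((N : ℝ) + 2) ^ 2) →
      ∀ t ∈ Icc (0 : ℝ) 1, ‖g.eval (t : ℂ)‖ ≤ 5 * ((N : ℝ) + 2) ^ 2 := fun r g h h' t ht => by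
    rw [h, norm_real]
    exact h' t ht
  have hN : (0 : ℝ) ≤ N := N.cast_nonneg
  interval_cases k
  · refine ⟨(1 - X) ^ 2, by rw [shiftPoly_zero, pow_add], key (fun t => (1 - t) ^ 2) _ (by simp) ?_⟩
    rintro t ⟨h0, h1⟩
    rw [abs_le]
    constructor <;> nlinarith
  · refine ⟨_, h1, key (fun t => (N + 2) * t * (1 - t) - (1 - t) ^ 2) _ (by simp) ?_⟩
    rintro t ⟨h0, h1⟩
    have h3 : 0 ≤ t * (1 - t) := by nlinarith
    have h4 : t * (1 - t) ≤ 1 := by nlinarith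
    rw [abs_le]
    constructor <;> nlinarith [mul_nonneg hN h3, mul_nonneg hN (sub_nonneg.2 h4)]
  · refine ⟨(1 - X) ^ 2 - (3 * ((N : ℂ[X]) + 2)) * X * (1 - X) +
      (((N : ℂ[X]) + 2) * ((N : ℂ[X]) + 1)) * X ^ 2, ?_,
      key (fun t => (1 - t) ^ 2 - 3 * (N + 2) * t * (1 - t) + (N + 2) * (N + 1) * t ^ 2) _
      (by simp) ?_⟩
    · rw [shiftPoly_succ, h1]
      rcases N with _ | N
      · simp [derivative_pow, hC]
        ring
      · simp [derivative_pow, hC]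
        ring
    · rintro t ⟨h0, h1⟩
      have h3 : 0 ≤ t * (1 - t) := by nlinarith
      have h4 : t * (1 - t) ≤ 1 := by nlinarith
      have h5 : t ^ 2 ≤ 1 := by nlinarith
      rw [abs_le]
      constructor <;> nlinarith [mul_nonneg hN h3, mul_nonneg hN (sub_nonneg.2 h4),
        mul_nonneg hN (sub_nonneg.2 h5), mul_nonneg (mul_nonneg hN hN) (sub_nonneg.2 h5),
        sq_nonneg t,
        mul_nonneg hN (sq_nonneg t), mul_nonneg (mul_nonneg hN hN) (sq_nonneg t)]

theorem eval_X_pow_mul_iterate_derivative (a b c j : ℕ) (r t : ℂ) :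
    (X ^ c * derivative^[b + c] (X ^ b * derivative^[a] (X ^ a * (C r * X ^ j)))).eval t =
      r * (a.factorial * (b + c).factorial * (j + a).choose a * (j + b).choose (b + c)) *
        t ^ j := by
  rw [show X ^ a * (C r * X ^ j) = C r * X ^ (j + a) by ring, iterate_derivative_C_mul,
    iterate_derivative_X_pow_eq_natCast_mul, Nat.add_sub_cancel,
    show X ^ b * (C r * (((j + a).descFactorial a : ℂ[X]) * X ^ j)) =
      C (r * (j + a).descFactorial a) * X ^ (j + b) by rw [C_mul, C_eq_natCast]; ring,
    iterate_derivative_C_mul, iterate_derivative_X_pow_eq_natCast_mul,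
    Nat.descFactorial_eq_factorial_mul_choose, Nat.descFactorial_eq_factorial_mul_choose]
  simp only [eval_mul, eval_pow, eval_X, eval_C, eval_natCast]
  rcases le_or_gt c j with h | h
  · rw [show j + b - (b + c) = j - c by omega, ← Nat.add_sub_cancel' h, pow_add,
      Nat.add_sub_cancel_left]
    push_cast
    ring
  · rw [Nat.choose_eq_zero_of_lt (by omega : j + b < b + c)]
    simp

theorem eval_X_pow_mul_iterate_derivative_shiftPoly (a b c M k : ℕ) (t : ℂ) :
    (X ^ c * derivative^[b + c] (X ^ b * derivative^[a] (X ^ a * shiftPoly M k))).eval t =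
      (-1) ^ (a + b + c) * (a.factorial * (b + c).factorial) * ∑ j ∈ Finset.range (M + 1),
        ((ratRes a b c M j * (-(j + 1) : ℝ) ^ k : ℝ) : ℂ) * t ^ j := by
  simp only [shiftPoly, Finset.mul_sum, iterate_derivative_sum, eval_finsetSum]
  refine Finset.sum_congr rfl fun j _ => ?_
  rw [eval_X_pow_mul_iterate_derivative]
  simp only [ratRes, pfCoeff]
  push_cast
  rw [pow_add _ (a + b + c) j]
  have : (-1 : ℂ) ^ (a + b + c) * (-1) ^ (a + b + c) = 1 := by rw [← mul_pow]; simp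
  linear_combination (-(-1 : ℂ) ^ j * M.choose j * (-(j + 1)) ^ k * (a.factorial *
    (b + c).factorial * (j + a).choose a * (j + b).choose (b + c)) * t ^ j) * this

theorem exists_norm_linForm_add_eq {ω μ : ℂ} (hω : ω ∈ slitPlane) (hμ : μ ∈ slitPlane) {x : ℝ}
    (hx : |x| < 1) (hμx : μ = x * ω) {a b c k : ℕ} (hb : 1 ≤ b) (hc : 1 ≤ c) (hk : k < 3) :
    ∃ g : ℂ[X], (∀ t ∈ Icc (0 : ℝ) 1,
        ‖g.eval (t : ℂ)‖ ≤ 5 * (((a + (b + c) : ℕ) : ℝ) + 2) ^ 2) ∧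
      ‖(linForm x (fun j => ratRes a b c (a + (b + c) + 2) j * (-(j + 1) : ℝ) ^ k)
          (a + (b + c) + 2) 2 : ℂ) + (log ω - log μ) *
        linForm x (fun j => ratRes a b c (a + (b + c) + 2) j * (-(j + 1) : ℝ) ^ k)
          (a + (b + c) + 2) 1‖ =
      |x| * ‖doubleIntegral ω μ a b c ((1 - X) ^ (a + (b + c)) * g)‖ := by
  obtain ⟨g, hg, hgb⟩ := exists_shiftPoly_eq (a + (b + c)) hk
  refine ⟨g, hgb, ?_⟩
  have hd : (X - C 1) ^ (a + (b + c)) ∣ shiftPoly (a + (b + c) + 2) k := by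
    rw [hg, show (1 : ℂ[X]) - X = -1 * (X - C 1) by simp, mul_pow]
    exact ⟨(-1) ^ (a + (b + c)) * g, by ring⟩
  have key := integral_polynomial_mul_log_eq hω hμ hx hμx hb hc hd
  rw [linForm_add_eq_integral hx, norm_mul, norm_real, Real.norm_eq_abs, ← hg]
  congr 1
  set σ : ℂ := (-1) ^ (a + b + c) * (a.factorial * (b + c).factorial) with hσ
  have e : ∀ t : ℝ, (X ^ c * derivative^[b + c] (X ^ b * derivative^[a]
      (X ^ a * shiftPoly (a + (b + c) + 2) k))).eval (t : ℂ) * (log ω - log μ - Real.log t) /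
      (1 - x * t) = σ * ((∑ j ∈ Finset.range (a + (b + c) + 2 + 1),
        ((ratRes a b c (a + (b + c) + 2) j * (-(j + 1) : ℝ) ^ k : ℝ) : ℂ) * t ^ j) *
        (log ω - log μ - Real.log t) / (1 - x * t)) := fun t => by
    rw [eval_X_pow_mul_iterate_derivative_shiftPoly]
    ring
  simp_rw [e] at key
  rw [intervalIntegral.integral_const_mul] at key
  have hf : (0 : ℝ) < a.factorial * (b + c).factorial := by positivity
  have := congrArg norm key
  simp only [hσ, norm_mul, norm_pow, norm_neg, norm_one, one_pow, one_mul, norm_natCast] at this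
  rw [mul_comm ((b + c).factorial : ℝ)] at this
  exact mul_left_cancel₀ hf.ne' this
end doubleIntegralBound

section inequalities
open Set

theorem pow_le_pow_mul_exp (n : ℕ) {x : ℝ} (hx : 0 ≤ x) :
    x ^ n ≤ (n : ℝ) ^ n * Real.exp (x - n) := by
  rcases n.eq_zero_or_pos with rfl | hn
  · simpa using hx
  have hn' : (0 : ℝ) < n := Nat.cast_pos.2 hn
  have h : x / n ≤ Real.exp (x / n - 1) := by linarith [Real.add_one_le_exp (x / n - 1)]
  have h2 := pow_le_pow_left₀ (by positivity) h n
  rw [← Real.exp_nat_mul, mul_sub, mul_div_cancel₀ _ hn'.ne', mul_one, div_pow,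
    div_le_iff₀ (by positivity)] at h2
  linarith

theorem pow_mul_pow_mul_pow_le (a b c : ℕ) {x y z : ℝ} (hx : 0 ≤ x) (hy : 0 ≤ y) (hz : 0 ≤ z)
    (h : 0 < x + y + z) :
    x ^ a * y ^ b * z ^ c * (a + b + c : ℝ) ^ (a + b + c) ≤
      (a : ℝ) ^ a * (b : ℝ) ^ b * (c : ℝ) ^ c * (x + y + z) ^ (a + b + c) := by
  set N : ℝ := a + b + c with hN
  set s : ℝ := N / (x + y + z) with hs
  have hN0 : 0 ≤ N := by positivity
  have hs0 : 0 ≤ s := by positivity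
  have hsx : s * (x + y + z) = N := div_mul_cancel₀ _ h.ne'
  have h1 := pow_le_pow_mul_exp a (mul_nonneg hs0 hx)
  have h2 := pow_le_pow_mul_exp b (mul_nonneg hs0 hy)
  have h3 := pow_le_pow_mul_exp c (mul_nonneg hs0 hz)
  have h4 : Real.exp (s * x - a) * Real.exp (s * y - b) * Real.exp (s * z - c) = 1 := by
    rw [← Real.exp_add, ← Real.exp_add, Real.exp_eq_one_iff]
    linarith
  calc _ = (s * x) ^ a * (s * y) ^ b * (s * z) ^ c * (x + y + z) ^ (a + b + c) := by
        rw [← hsx]; simp only [mul_pow, pow_add]; ring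
    _ ≤ ((a : ℝ) ^ a * Real.exp (s * x - a)) * ((b : ℝ) ^ b * Real.exp (s * y - b)) *
        ((c : ℝ) ^ c * Real.exp (s * z - c)) * (x + y + z) ^ (a + b + c) := by gcongr
    _ = (a : ℝ) ^ a * (b : ℝ) ^ b * (c : ℝ) ^ c * (x + y + z) ^ (a + b + c) *
        (Real.exp (s * x - a) * Real.exp (s * y - b) * Real.exp (s * z - c)) := by ring
    _ = _ := by rw [h4, mul_one]

theorem one_sub_pow_mul_pow_le (a b : ℕ) {t : ℝ} (h0 : 0 ≤ t) (h1 : t ≤ 1) :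
    (1 - t) ^ a * t ^ b ≤ (a : ℝ) ^ a * (b : ℝ) ^ b / (a + b : ℝ) ^ (a + b) := by
  have := pow_mul_pow_mul_pow_le a b 0 (sub_nonneg.2 h1) h0 le_rfl (by simp)
  simp only [pow_zero, mul_one, CharP.cast_eq_zero, add_zero, sub_add_cancel, one_pow] at this
  rcases (a + b).eq_zero_or_pos with h | h
  · obtain ⟨rfl, rfl⟩ : a = 0 ∧ b = 0 := by omega
    simp
  · have h' : (0 : ℝ) < a + b := by exact_mod_cast h
    rwa [le_div_iff₀ (by positivity)]

theorem le_pow_mul_pow_of_endpoints {q n : ℕ} {m y₀ y₁ c d y : ℝ} (hm : 0 < m) (h0 : 0 < y₀)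
    (hc0 : 0 < c - d * y₀) (hc1 : 0 < c - d * y₁) (hm0 : m ≤ y₀ ^ q * (c - d * y₀) ^ n)
    (hm1 : m ≤ y₁ ^ q * (c - d * y₁) ^ n) (hy : y ∈ Icc y₀ y₁) :
    m ≤ y ^ q * (c - d * y) ^ n := by
  have h1 : 0 < y₁ := h0.trans_le (hy.1.trans hy.2)
  rw [← segment_eq_Icc (hy.1.trans hy.2)] at hy
  obtain ⟨a, b, ha, hb, hab, rfl⟩ := hy
  have e1 := Real.geom_mean_le_arith_mean2_weighted ha hb h0.le h1.le hab
  have e2 := Real.geom_mean_le_arith_mean2_weighted ha hb hc0.le hc1.le hab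
  have e3 : a * (c - d * y₀) + b * (c - d * y₁) = c - d * (a * y₀ + b * y₁) := by
    linear_combination c * hab
  rw [e3] at e2
  simp only [smul_eq_mul]
  calc m = m ^ a * m ^ b := by rw [← Real.rpow_add hm, hab, Real.rpow_one]
    _ ≤ (y₀ ^ q * (c - d * y₀) ^ n) ^ a * (y₁ ^ q * (c - d * y₁) ^ n) ^ b := by gcongr
    _ = (y₀ ^ a * y₁ ^ b) ^ q * ((c - d * y₀) ^ a * (c - d * y₁) ^ b) ^ n := by
        rw [Real.mul_rpow (by positivity) (by positivity),
          Real.mul_rpow (by positivity) (by positivity), mul_pow, mul_pow,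
          Real.rpow_pow_comm h0.le, Real.rpow_pow_comm h1.le, Real.rpow_pow_comm hc0.le,
          Real.rpow_pow_comm hc1.le]
        ring
    _ ≤ _ := by gcongr

theorem pow_mul_pow_le_of_numeral_bound {p q n₁ n₂ n₃ : ℕ} {r m t y : ℝ} (hp : p = 6 + q)
    (hn : n₁ + n₂ + n₃ = 80) (hn' : n₂ + 2 * n₃ = 16 * p) (hp' : p ≤ 10) (hr : 0 ≤ r) (hm0 : 0 ≤ m)
    (ht : t ∈ Icc (0 : ℝ) 1) (hy : 0 < y) (hm : m ≤ y ^ q * (1 - 1.7 * y + y ^ 2) ^ 4)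
    (hnum : ((18 : ℝ) ^ 18 * (p : ℝ) ^ p / (18 + p : ℝ) ^ (18 + p)) ^ 16 *
      ((n₁ : ℝ) ^ n₁ * (n₂ : ℝ) ^ n₂ * (n₃ : ℝ) ^ n₃) ≤
      (r * m) ^ 16 * (80 ^ 80 * 8.5 ^ n₂ * 25 ^ n₃)) :
    (1 - t) ^ 18 * t ^ 10 * y ^ 6 ≤
      r * (1 - 1.7 * y + y ^ 2) ^ 4 * (t ^ 2 + 8.5 * t * y + 25 * y ^ 2) ^ 5 := by
  obtain ⟨ht0, ht1⟩ := ht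
  have hA : 0 < 1 - 1.7 * y + y ^ 2 := by nlinarith [sq_nonneg (y - 0.85)]
  set A := 1 - 1.7 * y + y ^ 2
  have hB : 0 < t ^ 2 + 8.5 * t * y + 25 * y ^ 2 := by positivity
  have h1 := one_sub_pow_mul_pow_le 18 p ht0 ht1
  have h2 := pow_mul_pow_mul_pow_le n₁ n₂ n₃ (sq_nonneg t)
    (by positivity : 0 ≤ 8.5 * t * y) (by positivity : 0 ≤ 25 * y ^ 2) hB
  set B := t ^ 2 + 8.5 * t * y + 25 * y ^ 2
  rw [show (n₁ + n₂ + n₃ : ℝ) = 80 by exact_mod_cast hn, hn] at h2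
  have ht1' : 0 ≤ 1 - t := sub_nonneg.2 ht1
  refine le_of_pow_le_pow_left₀ (n := 16) (by norm_num) (by positivity) ?_
  simp only [Nat.cast_ofNat] at h1
  set T : ℝ := (18 : ℝ) ^ 18 * (p : ℝ) ^ p / (18 + p : ℝ) ^ (18 + p)
  set W : ℝ := (n₁ : ℝ) ^ n₁ * (n₂ : ℝ) ^ n₂ * (n₃ : ℝ) ^ n₃ with hW
  set D : ℝ := 80 ^ 80 * 8.5 ^ n₂ * 25 ^ n₃
  have hW0 : 0 < W := by
    have : ∀ n : ℕ, 0 < (n : ℝ) ^ n := fun n => by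
      rcases n.eq_zero_or_pos with rfl | h
      · simp
      · positivity
    exact mul_pos (mul_pos (this _) (this _)) (this _)
  have e1 : (t ^ 2) ^ n₁ * (8.5 * t * y) ^ n₂ * (25 * y ^ 2) ^ n₃ * 80 ^ 80 =
      D * (t ^ (160 - 16 * p) * y ^ (16 * p)) := by
    rw [show 160 - 16 * p = 2 * n₁ + n₂ by omega, ← hn']
    simp only [D, mul_pow, ← pow_mul, pow_add]
    ring
  rw [e1] at h2
  have hD0 : 0 ≤ D := by positivity
  have hq0 : 0 < y ^ q * A ^ 4 := by positivity
  refine le_of_mul_le_mul_right ?_ hW0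
  have e2 : ((1 - t) ^ 18 * t ^ 10 * y ^ 6) ^ 16 =
      ((1 - t) ^ 18 * t ^ p) ^ 16 * t ^ (160 - 16 * p) * y ^ 96 := by
    have : t ^ 160 = t ^ (16 * p) * t ^ (160 - 16 * p) := by rw [← pow_add]; congr 1; omega
    rw [mul_pow, mul_pow, ← pow_mul t, this, mul_pow _ (t ^ p), ← pow_mul t p, mul_comm p]
    ring
  have e3 : y ^ (16 * p) = y ^ 96 * (y ^ q) ^ 16 := by
    rw [hp, ← pow_mul, ← pow_add]; congr 1; omega
  clear_value T W D A B
  calc ((1 - t) ^ 18 * t ^ 10 * y ^ 6) ^ 16 * W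
      = ((1 - t) ^ 18 * t ^ p) ^ 16 * t ^ (160 - 16 * p) * y ^ 96 * W := by rw [e2]
    _ ≤ T ^ 16 * t ^ (160 - 16 * p) * y ^ 96 * W := by
        gcongr
    _ = t ^ (160 - 16 * p) * y ^ 96 * (T ^ 16 * W) := by ring
    _ ≤ t ^ (160 - 16 * p) * y ^ 96 * ((r * m) ^ 16 * D) := by gcongr
    _ ≤ t ^ (160 - 16 * p) * y ^ 96 * ((r * (y ^ q * A ^ 4)) ^ 16 * D) := by
        gcongr
    _ = (r * A ^ 4) ^ 16 * (D * (t ^ (160 - 16 * p) * y ^ (16 * p))) := by rw [e3]; ring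
    _ ≤ (r * A ^ 4) ^ 16 * (W * B ^ 80) := by gcongr
    _ = (r * A ^ 4 * B ^ 5) ^ 16 * W := by rw [mul_pow _ (B ^ 5), ← pow_mul B]; ring

theorem pow_mul_pow_le_neg {t y : ℝ} (ht : t ∈ Icc (0 : ℝ) 1) (hy : 0 < y) :
    (1 - t) ^ 18 * t ^ 10 * y ^ 6 ≤
      0.000000000000322 * (1 - 1.7 * y + y ^ 2) ^ 4 * (t ^ 2 + 8.5 * t * y + 25 * y ^ 2) ^ 5 := by
  have key : ∀ c d : ℝ, 0 < c - d * y → c - d * y ≤ 1 - 1.7 * y + y ^ 2 → ∀ (q : ℕ) (m : ℝ),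
      m ≤ y ^ q * (c - d * y) ^ 4 → m ≤ y ^ q * (1 - 1.7 * y + y ^ 2) ^ 4 :=
    fun c d h0 h1 q m h => h.trans (by gcongr)
  have of_deg7 := pow_mul_pow_le_of_numeral_bound (p := 7) (q := 1) (n₁ := 8) (n₂ := 32) (n₃ := 40)
      (r := 0.000000000000322)
    (m := 0.0472) (by norm_num) (by norm_num) (by norm_num) (by norm_num) (by norm_num)
    (by norm_num) ht hy
  have of_deg8 := pow_mul_pow_le_of_numeral_bound (p := 8) (q := 2) (n₁ := 4) (n₂ := 24) (n₃ := 52)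
      (r := 0.000000000000322)
    (m := 0.00778) (by norm_num) (by norm_num) (by norm_num) (by norm_num) (by norm_num)
    (by norm_num) ht hy
  have of_deg9 := pow_mul_pow_le_of_numeral_bound (p := 9) (q := 3) (n₁ := 1) (n₂ := 14) (n₃ := 65)
      (r := 0.000000000000322)
    (m := 0.00255) (by norm_num) (by norm_num) (by norm_num) (by norm_num) (by norm_num)
    (by norm_num) ht hy
  rcases le_total y 0.1 with h1 | h1
  · refine pow_mul_pow_le_of_numeral_bound (p := 6) (q := 0) (n₁ := 14) (n₂ := 36) (n₃ := 30)
      (m := 0.84 ^ 4) (by norm_num) (by norm_num) (by norm_num) (by norm_num) (by norm_num)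
      (by norm_num) ht hy ?_ (by norm_num)
    rw [pow_zero, one_mul]
    gcongr
    nlinarith
  have tang : ∀ c d y₀ y₁ : ℝ, d ^ 2 - 3.4 * d + 4 * c = 1.11 → 0 < y₀ → 0 ≤ d → y₀ ≤ y →
      y ≤ y₁ → 0 < c - d * y₁ → ∀ (q : ℕ) (m : ℝ), 0 < m → m ≤ y₀ ^ q * (c - d * y₀) ^ 4 →
      m ≤ y₁ ^ q * (c - d * y₁) ^ 4 → m ≤ y ^ q * (1 - 1.7 * y + y ^ 2) ^ 4 := by
    intro c d y₀ y₁ hcd hy₀ hd hy0 hy1 hc1 q m hm hm0 hm1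
    have h0 : c - d * y₁ ≤ c - d * y := by nlinarith
    have h0' : c - d * y₁ ≤ c - d * y₀ := by nlinarith
    refine key c d (hc1.trans_le h0) ?_ q m
      (le_pow_mul_pow_of_endpoints hm hy₀ (hc1.trans_le h0') hc1 hm0 hm1 ⟨hy0, hy1⟩)
    nlinarith [sq_nonneg (2 * y - 1.7 + d)]
  rcases le_total y 0.2 with h2 | h2
  · exact of_deg7 (tang 0.9775 1.4 0.1 0.2 (by norm_num) (by norm_num) (by norm_num) h1 h2
      (by norm_num) _ _ (by norm_num) (by norm_num) (by norm_num)) (by norm_num)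
  rcases le_total y 0.4 with h3 | h3
  · exact of_deg8 (tang 0.91 1.1 0.2 0.4 (by norm_num) (by norm_num) (by norm_num) h2 h3
      (by norm_num) _ _ (by norm_num) (by norm_num) (by norm_num)) (by norm_num)
  refine of_deg9 ?_ (by norm_num)
  rcases le_total y 0.6 with h4 | h4
  · exact tang 0.75 0.7 0.4 0.6 (by norm_num) (by norm_num) (by norm_num) h3 h4
      (by norm_num) _ _ (by norm_num) (by norm_num) (by norm_num)
  rcases le_total y 0.77 with h5 | h5
  · exact tang 0.51 0.3 0.6 0.77 (by norm_num) (by norm_num) (by norm_num) h4 h5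
      (by norm_num) _ _ (by norm_num) (by norm_num) (by norm_num)
  · calc (0.00255 : ℝ) ≤ 0.77 ^ 3 * 0.2775 ^ 4 := by norm_num
      _ ≤ _ := by
        gcongr
        nlinarith [sq_nonneg (y - 0.85)]
end inequalities

section bounds
open Set Polynomial

/-- The series `linForm` for the residues of `ratFun` multiplied by `s ^ k`. -/
noncomputable def pfForm (x : ℝ) (a b c k r : ℕ) : ℝ :=
  linForm x (fun j => ratRes a b c (a + (b + c) + 2) j * (-(j + 1) : ℝ) ^ k) (a + (b + c) + 2) r

theorem exists_norm_pfForm_add_le {ω μ : ℂ} (hω : ω ∈ Complex.slitPlane)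
    (hμ : μ ∈ Complex.slitPlane) {x : ℝ} (hx : |x| < 1) (hμx : μ = x * ω) {a b c : ℕ}
    (hb : 1 ≤ b) (hc : 1 ≤ c) {ρ : ℝ} (hρ0 : 0 ≤ ρ)
    (hρ : ∀ t ∈ Ioc (0 : ℝ) 1, ∀ v ∈ Ioi (0 : ℝ), t ^ a * (1 - t) ^ (a + (b + c)) * ‖μ * v‖ ^ b /
      (‖1 + μ * v‖ ^ (b + c) * ‖t + ω * v‖ ^ a) ≤ ρ) :
    ∃ K, 0 ≤ K ∧ ∀ m k : ℕ, k < 3 →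
      ‖(pfForm x (a * (m + 1)) (b * (m + 1)) (c * (m + 1)) k 2 : ℂ) +
        (Complex.log ω - Complex.log μ) *
          pfForm x (a * (m + 1)) (b * (m + 1)) (c * (m + 1)) k 1‖ ≤
        K * ((m + 1 : ℝ) ^ 2 * ρ ^ m) := by
  obtain ⟨K, hK, h⟩ := norm_doubleIntegral_le hω hμ hb hc hρ0 hρ
  refine ⟨|x| * (K * (5 * ((a + (b + c) : ℕ) + 2) ^ 2)), by positivity, fun m k hk => ?_⟩
  obtain ⟨g, hg, hg'⟩ := exists_norm_linForm_add_eq hω hμ hx hμx (a := a * (m + 1))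
    (Nat.mul_pos hb m.succ_pos) (Nat.mul_pos hc m.succ_pos) hk
  refine hg'.trans_le ?_
  rw [show a * (m + 1) + (b * (m + 1) + c * (m + 1)) = (a + (b + c)) * (m + 1) by ring] at hg ⊢
  calc _ ≤ |x| * (K * (5 * (((a + (b + c)) * (m + 1) : ℕ) + 2) ^ 2) * ρ ^ m) := by
        gcongr
        exact h m g _ hg
    _ ≤ |x| * (K * (5 * (((a + (b + c) : ℕ) + 2) * (m + 1)) ^ 2) * ρ ^ m) := by
        gcongr
        push_cast
        nlinarith [(Nat.cast_nonneg m : (0 : ℝ) ≤ m)]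
    _ = _ := by ring

theorem abs_le_of_norm_add_le {u v R : ℝ} {l : ℂ} (h : ‖(u : ℂ) + l * v‖ ≤ R) :
    |u| ≤ R + ‖l‖ * |v| := by
  have h1 := norm_sub_le ((u : ℂ) + l * v) (l * v)
  rw [add_sub_cancel_right, norm_mul, Complex.norm_real, Complex.norm_real, Real.norm_eq_abs,
    Real.norm_eq_abs] at h1
  linarith

theorem abs_le_of_norm_add_le_of_im_ne_zero {u v R : ℝ} {l : ℂ} (h : ‖(u : ℂ) + l * v‖ ≤ R)
    (hl : l.im ≠ 0) : |v| ≤ R / |l.im| := by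
  rw [le_div_iff₀ (abs_pos.2 hl), mul_comm, ← abs_mul]
  refine le_trans ?_ h
  simpa using Complex.abs_im_le_norm ((u : ℂ) + l * v)

theorem exists_pfForm_bound_of_neg {z : ℤ} (hz : z ≤ -5) :
    ∃ ρ K : ℝ, 0 ≤ ρ ∧ ρ * Real.exp 14.38 < 1 ∧ ∀ m k r : ℕ, k < 3 → (r = 1 ∨ r = 2) →
      |pfForm (1 / (z : ℝ)) (5 * (m + 1)) (3 * (m + 1)) (1 * (m + 1)) k r| ≤
        K * ((m + 1 : ℝ) ^ 2 * ρ ^ m) := by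
  have hz' : (z : ℝ) ≤ -5 := by exact_mod_cast hz
  set s : ℝ := √0.2775 with hs
  have hs0 : 0 < s := Real.sqrt_pos.2 (by norm_num)
  have hs2 : s ^ 2 = 0.2775 := Real.sq_sqrt (by norm_num)
  set μ : ℂ := ⟨-0.85, s⟩ with hμ
  set ω : ℂ := z * μ with hω
  have hωim : ω.im = z * s := by simp [hω, hμ]
  have hωre : ω.re = z * -0.85 := by simp [hω, hμ]
  have hωneg : ω.im < 0 := by rw [hωim]; nlinarith
  have hμ' : μ ∈ Complex.slitPlane := Or.inr hs0.ne'
  have hω' : ω ∈ Complex.slitPlane := Or.inr hωneg.ne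
  have hl : (Complex.log ω - Complex.log μ).im ≠ 0 := by
    rw [Complex.sub_im, Complex.log_im, Complex.log_im]
    have h1 := Complex.arg_neg_iff.2 hωneg
    have h2 : 0 ≤ Complex.arg μ := Complex.arg_nonneg_iff.2 hs0.le
    linarith
  have hx : |1 / (z : ℝ)| < 1 := by
    rw [abs_div, abs_one, div_lt_one (by rw [abs_pos]; linarith), abs_of_neg (by linarith)]
    linarith
  have hμx : μ = (1 / z : ℝ) * ω := by
    have : (z : ℂ) ≠ 0 := by
      rw [Int.cast_ne_zero]; omega
    push_cast
    rw [hω, one_div, inv_mul_cancel_left₀ this]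
  have hρ : ∀ t ∈ Ioc (0 : ℝ) 1, ∀ v ∈ Ioi (0 : ℝ),
      t ^ 5 * (1 - t) ^ (5 + (3 + 1)) * ‖μ * v‖ ^ 3 / (‖1 + μ * v‖ ^ (3 + 1) * ‖t + ω * v‖ ^ 5) ≤
        √0.000000000000322 := by
    intro t ht v hv
    have hv : 0 < v := hv
    refine Real.le_sqrt_of_sq_le ?_
    have e1 : ‖μ * v‖ ^ 2 = v ^ 2 := by
      rw [Complex.sq_norm, Complex.normSq_apply]
      simp [hμ]
      linear_combination v ^ 2 * hs2
    have e2 : ‖1 + μ * v‖ ^ 2 = 1 - 1.7 * v + v ^ 2 := by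
      rw [Complex.sq_norm, Complex.normSq_apply]
      simp [hμ]
      linear_combination v ^ 2 * hs2
    have e3 : ‖t + ω * v‖ ^ 2 = t ^ 2 - 1.7 * z * t * v + z ^ 2 * v ^ 2 := by
      rw [Complex.sq_norm, Complex.normSq_apply]
      simp [hωim, hωre]
      linear_combination z ^ 2 * v ^ 2 * hs2
    rw [div_pow, mul_pow, mul_pow, mul_pow, pow_right_comm _ 3, pow_right_comm ‖1 + μ * v‖,
      pow_right_comm ‖t + ω * v‖, e1, e2, e3]
    have h1 : 0 < 1 - 1.7 * v + v ^ 2 := by nlinarith [sq_nonneg (v - 0.85)]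
    have h2 : t ^ 2 + 8.5 * t * v + 25 * v ^ 2 ≤ t ^ 2 - 1.7 * z * t * v + z ^ 2 * v ^ 2 := by
      have h3 : 0 ≤ t * v := mul_nonneg ht.1.le hv.le
      have h4 : (25 : ℝ) ≤ z ^ 2 := by nlinarith
      nlinarith [sq_nonneg v]
    have h3 : 0 < t ^ 2 + 8.5 * t * v + 25 * v ^ 2 := by
      have := ht.1
      positivity
    rw [div_le_iff₀ (by have := h3.trans_le h2; positivity)]
    calc _ = (1 - t) ^ 18 * t ^ 10 * v ^ 6 := by ring
      _ ≤ _ := pow_mul_pow_le_neg ⟨ht.1.le, ht.2⟩ hv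
      _ ≤ 0.000000000000322 * (1 - 1.7 * v + v ^ 2) ^ 4 *
          (t ^ 2 - 1.7 * z * t * v + z ^ 2 * v ^ 2) ^ 5 := by gcongr
      _ = _ := by ring
  obtain ⟨K, hK, h⟩ := exists_norm_pfForm_add_le hω' hμ' hx hμx (by norm_num) (by norm_num)
    (Real.sqrt_nonneg _) hρ
  set l := Complex.log ω - Complex.log μ
  refine ⟨√0.000000000000322, K + K / |l.im| + ‖l‖ * (K / |l.im|), Real.sqrt_nonneg _, ?_, ?_⟩
  · rw [← Real.sqrt_sq (Real.exp_pos 14.38).le, ← Real.sqrt_mul (by norm_num),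
      Real.sqrt_lt' (by norm_num), one_pow]
    refine lt_of_pow_lt_pow_left₀ 25 (by norm_num) ?_
    rw [one_pow, mul_pow, ← pow_mul, ← Real.exp_nat_mul]
    have : Real.exp ((2 * 25 : ℕ) * 14.38) = Real.exp 1 ^ 719 := by
      rw [← Real.exp_nat_mul]; norm_num
    rw [this]
    calc _ ≤ (0.000000000000322 : ℝ) ^ 25 * 2.7182818286 ^ 719 := by
          gcongr
          exact Real.exp_one_lt_d9.le
      _ = (0.000000000000322 * 2.7182818286 ^ 28) ^ 25 * 2.7182818286 ^ 19 := by
          rw [mul_pow, ← pow_mul, mul_assoc, ← pow_add]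
      _ < 1 := by norm_num
  · intro m k r hk hr
    have h1 := h m k hk
    have h2 := abs_le_of_norm_add_le_of_im_ne_zero h1 hl
    have h3 := abs_le_of_norm_add_le h1
    have h4 : 0 ≤ (m + 1 : ℝ) ^ 2 * √0.000000000000322 ^ m := by positivity
    rw [mul_div_right_comm] at h2
    have h5 : 0 ≤ K / |l.im| := by positivity
    rcases hr with rfl | rfl
    · refine h2.trans (mul_le_mul_of_nonneg_right ?_ h4)
      have : 0 ≤ ‖l‖ * (K / |l.im|) := by positivity
      linarith
    · have h6 := mul_le_mul_of_nonneg_left h2 (norm_nonneg l)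
      nlinarith [mul_nonneg h5 h4]
end bounds

section positive
open Set

theorem prod_range_natCast_sub_eq (N k : ℕ) :
    ∏ i ∈ Finset.range k, ((N : ℝ) - i) = k.factorial * N.choose k := by
  rw [← descPochhammer_eval_eq_prod_range, descPochhammer_eval_eq_descFactorial,
    Nat.descFactorial_eq_factorial_mul_choose, Nat.cast_mul]

theorem ratFun_natCast_eq (a b c M s : ℕ) :
    ratFun a b c M (s : ℝ) = s.choose a * (s + c).choose (b + c) *
      (M.factorial / ∏ i ∈ Finset.range (M + 1), ((s : ℝ) + 1 + i)) := by
  have h2 := prod_range_natCast_sub_eq (s + c) (b + c)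
  push_cast at h2
  rw [ratFun, ratNum, prod_range_natCast_sub_eq, h2]
  have h3 : (a.factorial : ℝ) ≠ 0 := by positivity
  have h4 : ((b + c).factorial : ℝ) ≠ 0 := by positivity
  field_simp

theorem factorial_div_prod_le {s M : ℕ} {B : ℝ}
    (hB : ∀ t ∈ Ioc (0 : ℝ) 1, t ^ s * (1 - t) ^ M ≤ B) :
    M.factorial / ∏ i ∈ Finset.range (M + 1), ((s : ℝ) + 1 + i) ≤ B := by
  have h := Complex.betaIntegral_eval_nat_add_one_right (u := (s + 1 : ℝ))
    (by rw [Complex.ofReal_re]; positivity) M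
  rw [Complex.betaIntegral] at h
  have h2 := intervalIntegral.norm_integral_le_of_norm_le_const (a := (0 : ℝ)) (b := 1)
    (f := fun t : ℝ => (t : ℂ) ^ (((s + 1 : ℝ) : ℂ) - 1) * (1 - t : ℂ) ^ ((M : ℂ) + 1 - 1))
    (C := B) (fun t ht => by
      rw [uIoc_of_le zero_le_one] at ht
      have h1 : 0 ≤ 1 - t := sub_nonneg.2 ht.2
      push_cast
      rw [add_sub_cancel_right, add_sub_cancel_right, Complex.cpow_natCast, Complex.cpow_natCast,
        norm_mul, norm_pow, norm_pow, Complex.norm_real, Real.norm_of_nonneg ht.1.le,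
        ← Complex.ofReal_one, ← Complex.ofReal_sub, Complex.norm_real, Real.norm_of_nonneg h1]
      exact hB t ht)
  rw [h] at h2
  have e : ((M.factorial : ℂ) / ∏ j ∈ Finset.range (M + 1), (((s + 1 : ℝ) : ℂ) + j)) =
    ((M.factorial / ∏ i ∈ Finset.range (M + 1), ((s : ℝ) + 1 + i) : ℝ) : ℂ) := by
    push_cast; rfl
  rw [e, Complex.norm_real, sub_zero, abs_one, mul_one] at h2
  exact (le_abs_self _).trans h2

theorem choose_mul_pow_le_one_add_pow (s j : ℕ) {u : ℝ} (hu : 0 ≤ u) :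
    s.choose j * u ^ j ≤ (1 + u) ^ s := by
  rcases lt_or_ge s j with h | h
  · rw [Nat.choose_eq_zero_of_lt h]
    simp only [Nat.cast_zero, zero_mul]
    positivity
  rw [add_comm, add_pow]
  refine le_trans (le_of_eq ?_) (Finset.single_le_sum (f := fun m => u ^ m * 1 ^ (s - m) *
    (s.choose m : ℝ)) (fun i _ => by positivity) (Finset.mem_range.2 (Nat.lt_succ_of_le h)))
  simp [mul_comm]

theorem pow_mul_pow_div_le_pos {t : ℝ} (ht : t ∈ Ioc (0 : ℝ) 1) :
    4 * (1 - t) ^ 12 * (t / (3.4 - t)) ^ 7 ≤ 0.0000000139 := by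
  obtain ⟨h0, h1⟩ := ht
  have h1' : 0 ≤ 1 - t := sub_nonneg.2 h1
  rcases le_total t 0.69 with h | h
  · have h2 := one_sub_pow_mul_pow_le 12 7 h0.le h1
    have h3 : 0 ≤ t ^ 7 := by positivity
    calc 4 * (1 - t) ^ 12 * (t / (3.4 - t)) ^ 7 ≤ 4 * (1 - t) ^ 12 * (t / 2.71) ^ 7 := by
          have : 0 ≤ t / (3.4 - t) := div_nonneg h0.le (by linarith)
          gcongr
          linarith
      _ = 4 / 2.71 ^ 7 * ((1 - t) ^ 12 * t ^ 7) := by rw [div_pow]; ring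
      _ ≤ 4 / 2.71 ^ 7 * _ := mul_le_mul_of_nonneg_left h2 (by positivity)
      _ ≤ _ := by norm_num
  · calc 4 * (1 - t) ^ 12 * (t / (3.4 - t)) ^ 7 ≤ 4 * (1 - 0.69) ^ 12 * (1 / (3.4 - 1)) ^ 7 := by
          have : 0 ≤ t / (3.4 - t) := div_nonneg h0.le (by linarith)
          gcongr
      _ ≤ _ := by norm_num

theorem ratFun_natCast_nonneg (a b c M s : ℕ) : 0 ≤ ratFun a b c M (s : ℝ) := by
  rw [ratFun_natCast_eq]
  exact mul_nonneg (by positivity) (div_nonneg (by positivity)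
    (Finset.prod_nonneg fun i _ => by positivity))

theorem ratFun_natCast_le_pos (n s : ℕ) :
    ratFun (7 * n) (3 * n) (2 * n) (12 * n + 2) (s : ℝ) ≤ 6.8 ^ s * 0.0000000139 ^ n := by
  rcases lt_or_ge s (7 * n) with h | h
  · rw [ratFun_natCast_eq_zero h]
    positivity
  rw [ratFun_natCast_eq]
  have hP : 0 < (s.choose (7 * n) : ℝ) := by exact_mod_cast Nat.choose_pos h
  have hP' : 0 < ((s + 2 * n).choose (3 * n + 2 * n) : ℝ) := by
    exact_mod_cast Nat.choose_pos (by omega)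
  rw [mul_comm, ← le_div_iff₀ (by positivity)]
  refine factorial_div_prod_le fun t ht => ?_
  rw [le_div_iff₀ (by positivity)]
  obtain ⟨h0, h1⟩ := ht
  have h1' : 0 ≤ 1 - t := sub_nonneg.2 h1
  have h34 : 0 < 3.4 - t := by linarith
  have hu : 0 < 3.4 / t - 1 := by
    rw [sub_pos, lt_div_iff₀ h0]; linarith
  have e1 : (s.choose (7 * n) : ℝ) ≤ (1 + (3.4 / t - 1)) ^ s / (3.4 / t - 1) ^ (7 * n) := by
    rw [le_div_iff₀ (by positivity)]
    exact choose_mul_pow_le_one_add_pow s (7 * n) hu.le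
  have e2 : ((s + 2 * n).choose (3 * n + 2 * n) : ℝ) ≤ 2 ^ (s + 2 * n) := by
    exact_mod_cast Nat.choose_le_two_pow _ _
  have e3 : (1 - t) ^ (12 * n + 2) ≤ (1 - t) ^ (12 * n) :=
    pow_le_pow_of_le_one h1' (by linarith) (by omega)
  calc t ^ s * (1 - t) ^ (12 * n + 2) * (s.choose (7 * n) *
        (s + 2 * n).choose (3 * n + 2 * n))
      ≤ t ^ s * (1 - t) ^ (12 * n) * ((1 + (3.4 / t - 1)) ^ s / (3.4 / t - 1) ^ (7 * n) *
        2 ^ (s + 2 * n)) := by gcongr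
    _ = (t * (1 + (3.4 / t - 1)) * 2) ^ s *
        (4 * (1 - t) ^ 12 * (1 / (3.4 / t - 1)) ^ 7) ^ n := by
        rw [show (4 : ℝ) = 2 ^ 2 by norm_num]
        simp only [mul_pow, div_pow, one_pow, pow_add, ← pow_mul]
        ring
    _ = 6.8 ^ s * (4 * (1 - t) ^ 12 * (t / (3.4 - t)) ^ 7) ^ n := by
        congr 3
        · rw [add_sub_cancel, mul_div_cancel₀ _ h0.ne']; norm_num
        · rw [div_sub_one h0.ne', one_div_div]
    _ ≤ _ := by
        gcongr
        exact pow_mul_pow_div_le_pos ⟨h0, h1⟩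

theorem exists_abs_pfForm_le_pos {z : ℤ} (hz : 7 ≤ z) :
    ∃ K : ℝ, 0 ≤ K ∧ ∀ m k : ℕ, k < 3 →
      |pfForm (1 / (z : ℝ)) (7 * (m + 1)) (3 * (m + 1)) (2 * (m + 1)) k 1| ≤
        K * 0.0000000139 ^ m := by
  have hz' : (7 : ℝ) ≤ z := by exact_mod_cast hz
  have hsum : Summable fun s : ℕ => ((s : ℝ) ^ 2 + 1) * (6.8 / 7) ^ s := by
    simp only [add_mul, one_mul]
    exact (summable_pow_mul_geometric_of_norm_lt_one 2 (by norm_num)).add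
      (summable_geometric_of_norm_lt_one (by norm_num))
  refine ⟨∑' s : ℕ, ((s : ℝ) ^ 2 + 1) * (6.8 / 7) ^ s, tsum_nonneg fun s => by positivity,
    fun m k hk => ?_⟩
  rw [pfForm, linForm, ← tsum_mul_right, ← Real.norm_eq_abs]
  refine tsum_of_norm_bounded (hsum.mul_right _).hasSum fun s => ?_
  rw [← ratFun_mul_pow (by omega) (by linarith [(Nat.cast_nonneg s : (0 : ℝ) ≤ s)]),
    show 7 * (m + 1) + (3 * (m + 1) + 2 * (m + 1)) + 2 = 12 * (m + 1) + 2 by ring,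
    Real.norm_of_nonneg (mul_nonneg (mul_nonneg (ratFun_natCast_nonneg ..) (by positivity))
      (by positivity))]
  have hs : (s : ℝ) ^ k ≤ s ^ 2 + 1 := by
    rcases s.eq_zero_or_pos with rfl | h
    · interval_cases k <;> simp
    · have : (1 : ℝ) ≤ s := by exact_mod_cast h
      linarith [pow_le_pow_right₀ this (by omega : k ≤ 2)]
  calc _ ≤ 6.8 ^ s * 0.0000000139 ^ (m + 1) * ((s : ℝ) ^ 2 + 1) * (1 / 7) ^ (s + 1) := by
        gcongr
        exact ratFun_natCast_le_pos (m + 1) s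
    _ = ((s : ℝ) ^ 2 + 1) * (6.8 / 7) ^ s * 0.0000000139 ^ m * (0.0000000139 * (1 / 7)) := by
        simp only [div_pow, one_pow, pow_succ]; ring
    _ ≤ ((s : ℝ) ^ 2 + 1) * (6.8 / 7) ^ s * 0.0000000139 ^ m * 1 := by
        gcongr; norm_num
    _ = _ := mul_one _

theorem exists_pfForm_bound_of_pos {z : ℤ} (hz : 7 ≤ z) :
    ∃ ρ K : ℝ, 0 ≤ ρ ∧ ρ * Real.exp 18.08 < 1 ∧ ∀ m k r : ℕ, k < 3 → (r = 1 ∨ r = 2) →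
      |pfForm (1 / (z : ℝ)) (7 * (m + 1)) (3 * (m + 1)) (2 * (m + 1)) k r| ≤
        K * ((m + 1 : ℝ) ^ 2 * ρ ^ m) := by
  have hz' : (7 : ℝ) ≤ z := by exact_mod_cast hz
  have hz0 : (0 : ℝ) < z := by linarith
  have hx : |1 / (z : ℝ)| < 1 := by
    rw [abs_div, abs_one, abs_of_pos hz0, div_lt_one hz0]
    linarith
  have hμ : ((1 / z : ℝ) : ℂ) ∈ Complex.slitPlane :=
    Complex.ofReal_mem_slitPlane.2 (by positivity)
  have hρ : ∀ t ∈ Ioc (0 : ℝ) 1, ∀ v ∈ Ioi (0 : ℝ),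
      t ^ 7 * (1 - t) ^ (7 + (3 + 2)) * ‖((1 / z : ℝ) : ℂ) * v‖ ^ 3 /
        (‖1 + ((1 / z : ℝ) : ℂ) * v‖ ^ (3 + 2) * ‖t + (1 : ℂ) * v‖ ^ 7) ≤ 0.0000000139 := by
    rintro t ⟨h0, h1⟩ v hv
    have hv : 0 < v := hv
    have h1' : 0 ≤ 1 - t := sub_nonneg.2 h1
    rw [one_mul, ← Complex.ofReal_mul, ← Complex.ofReal_one, ← Complex.ofReal_add,
      ← Complex.ofReal_add, Complex.norm_real, Complex.norm_real, Complex.norm_real,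
      Real.norm_of_nonneg (by positivity), Real.norm_of_nonneg (by positivity),
      Real.norm_of_nonneg (by positivity)]
    have e1 := pow_mul_pow_mul_pow_le 4 3 0 h0.le hv.le le_rfl (by positivity)
    norm_num only [pow_zero, mul_one, add_zero, Nat.cast_ofNat, CharP.cast_eq_zero] at e1
    have e2 := one_sub_pow_mul_pow_le 12 3 h0.le h1
    rw [div_le_iff₀ (by positivity)]
    have e3 : 1 / (z : ℝ) ≤ 1 / 7 := by gcongr
    have e4 : 0 ≤ 1 / (z : ℝ) * v := by positivity
    calc t ^ 7 * (1 - t) ^ (7 + (3 + 2)) * (1 / z * v) ^ 3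
        = ((1 - t) ^ 12 * t ^ 3) * (1 / z) ^ 3 * (t ^ 4 * v ^ 3) := by ring
      _ ≤ (((12 : ℕ) : ℝ) ^ 12 * ((3 : ℕ) : ℝ) ^ 3 / (((12 : ℕ) : ℝ) + ((3 : ℕ) : ℝ)) ^ (12 + 3)) *
          (1 / 7) ^ 3 * (6912 / 823543 * (t + v) ^ 7) := by
          have e5 : t ^ 4 * v ^ 3 ≤ 6912 / 823543 * (t + v) ^ 7 := by linarith
          have e6 : 0 ≤ (1 - t) ^ 12 * t ^ 3 := by positivity
          refine mul_le_mul (mul_le_mul e2 ?_ (by positivity) (by positivity)) e5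
            (by positivity) (by positivity)
          gcongr
      _ ≤ 0.0000000139 * (t + v) ^ 7 := by
          rw [← mul_assoc]
          gcongr
          norm_num
      _ ≤ 0.0000000139 * ((1 + 1 / z * v) ^ (3 + 2) * (t + v) ^ 7) := by
          gcongr
          exact le_mul_of_one_le_left (by positivity) (one_le_pow₀ (by linarith))
  obtain ⟨K, hK, h⟩ := exists_norm_pfForm_add_le (Complex.one_mem_slitPlane) hμ hx
    (mul_one _).symm (by norm_num) (by norm_num) (by norm_num) hρ
  obtain ⟨K', hK', h'⟩ := exists_abs_pfForm_le_pos hz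
  set l := Complex.log 1 - Complex.log ((1 / z : ℝ) : ℂ)
  refine ⟨0.0000000139, K + K' + ‖l‖ * K', by norm_num, ?_, ?_⟩
  · refine lt_of_pow_lt_pow_left₀ 25 (by norm_num) ?_
    rw [one_pow, mul_pow, ← Real.exp_nat_mul]
    have : Real.exp ((25 : ℕ) * 18.08) = Real.exp 1 ^ 452 := by
      rw [← Real.exp_nat_mul]; norm_num
    rw [this]
    calc _ ≤ (0.0000000139 : ℝ) ^ 25 * 2.7182818286 ^ 452 := by
          gcongr
          exact Real.exp_one_lt_d9.le
      _ = (0.0000000139 * 2.7182818286 ^ 18) ^ 25 * 2.7182818286 ^ 2 := by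
          rw [mul_pow, ← pow_mul, mul_assoc, ← pow_add]
      _ < 1 := by norm_num
  · intro m k r hk hr
    have h3 := abs_le_of_norm_add_le (h m k hk)
    have h4 : (0.0000000139 : ℝ) ^ m ≤ (m + 1 : ℝ) ^ 2 * 0.0000000139 ^ m :=
      le_mul_of_one_le_left (by positivity)
        (one_le_pow₀ (by linarith [(Nat.cast_nonneg m : (0 : ℝ) ≤ m)]))
    have h2 := (h' m k hk).trans (mul_le_mul_of_nonneg_left h4 hK')
    have h5 : 0 ≤ (m + 1 : ℝ) ^ 2 * 0.0000000139 ^ m := by positivity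
    have h6 := mul_le_mul_of_nonneg_left h2 (norm_nonneg l)
    have h7 := mul_nonneg hK' h5
    have h8 := mul_nonneg hK h5
    have h9 := mul_nonneg (mul_nonneg (norm_nonneg l) hK') h5
    rcases hr with rfl | rfl
    · nlinarith
    · nlinarith
end positive

section endgame
open Filter Topology

theorem Int.relation_trivial_of_pfForm_bound {a b c : ℕ} (hb : 0 < b) (hba : b < a) {z : ℤ}
    (hz : 5 ≤ |(z : ℝ)|) {D : ℕ → ℝ} (hD0 : ∀ n, 0 < D n)
    (hD : ∀ n j i : ℕ, 1 ≤ i → i ≤ (a + b + c) * n + 2 → ∃ m : ℤ,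
      D n * pfCoeff (a * n) (b * n) (c * n) ((a + b + c) * n + 2) j / (i : ℝ) ^ 2 = m)
    {κ ρ K : ℝ} (hDκ : ∀ᶠ n : ℕ in atTop, D n ≤ Real.exp (κ * n)) (hρ0 : 0 ≤ ρ)
    (hρ : ρ * Real.exp κ < 1)
    (hK : ∀ m k r : ℕ, k < 3 → (r = 1 ∨ r = 2) →
      |pfForm (1 / (z : ℝ)) (a * (m + 1)) (b * (m + 1)) (c * (m + 1)) k r| ≤
        K * ((m + 1 : ℝ) ^ 2 * ρ ^ m))
    {α β γ : ℤ} (h : α + β * Li 1 (1 / z) + γ * Li 2 (1 / z) = 0) :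
    α = 0 ∧ β = 0 ∧ γ = 0 := by
  by_cases hβγ : β = 0 ∧ γ = 0
  · obtain ⟨rfl, rfl⟩ := hβγ
    simpa using h
  exfalso
  have hβγ' : (β : ℝ) ≠ 0 ∨ (γ : ℝ) ≠ 0 := by
    rw [Int.cast_ne_zero, Int.cast_ne_zero]; tauto
  set q := ρ * Real.exp κ with hq
  have hq0 : 0 ≤ q := by positivity
  have hlim : Tendsto (fun m : ℕ => (Real.exp κ * (|(β : ℝ)| + |(γ : ℝ)|) * K) *
      ((m : ℝ) ^ 2 * q ^ m + 2 * ((m : ℝ) ^ 1 * q ^ m) + q ^ m)) atTop (𝓝 0) := by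
    have h1 := tendsto_pow_const_mul_const_pow_of_abs_lt_one 2 (abs_lt.2 ⟨by linarith, hρ⟩)
    have h2 := tendsto_pow_const_mul_const_pow_of_abs_lt_one 1 (abs_lt.2 ⟨by linarith, hρ⟩)
    have h3 := tendsto_pow_atTop_nhds_zero_of_lt_one hq0 hρ
    simpa using ((h1.add (h2.const_mul 2)).add h3).const_mul
      (Real.exp κ * (|(β : ℝ)| + |(γ : ℝ)|) * K)
  obtain ⟨m, hm1, hm2⟩ := ((hlim.eventually (gt_mem_nhds one_pos)).and
    ((tendsto_add_atTop_nat 1).eventually hDκ)).exists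
  have hz0 : (z : ℝ) ≠ 0 := by rintro h; rw [h] at hz; norm_num at hz
  have hx : |1 / (z : ℝ)| ≤ 1 / 5 := by
    rw [abs_div, abs_one]
    gcongr
  obtain ⟨k, hk, hne⟩ := exists_linForm_ne_zero (a := a * (m + 1)) (b := b * (m + 1))
    (c := c * (m + 1)) (M := a * (m + 1) + (b * (m + 1) + c * (m + 1)) + 2)
    (by positivity) (by gcongr) (by omega) (one_div_ne_zero hz0) hx hβγ'
  obtain ⟨p, hp⟩ := exists_int_eq_linForm (z := z) (D := D (m + 1))
    (M := a * (m + 1) + (b * (m + 1) + c * (m + 1)) + 2)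
    (by linarith) (fun j => ratRes (a * (m + 1)) (b * (m + 1)) (c * (m + 1))
      (a * (m + 1) + (b * (m + 1) + c * (m + 1)) + 2) j * (-(j + 1)) ^ k)
    (fun j i h1 h2 => by
      rw [show a * (m + 1) + (b * (m + 1) + c * (m + 1)) + 2 = (a + b + c) * (m + 1) + 2 by ring]
        at h2 ⊢
      obtain ⟨p, hp⟩ := hD (m + 1) j i h1 h2
      refine ⟨p * ((-1) ^ (a * (m + 1) + b * (m + 1) + c * (m + 1) + j) * (-(j + 1)) ^ k), ?_⟩
      rw [ratRes]
      push_cast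
      rw [← hp]
      ring) (by omega) h
  push_cast at hp
  set x := 1 / (z : ℝ)
  have e1 := hK m k 1 hk (Or.inl rfl)
  have e2 := hK m k 2 hk (Or.inr rfl)
  rw [pfForm] at e1 e2
  set u := linForm x (fun j => ratRes (a * (m + 1)) (b * (m + 1)) (c * (m + 1))
      (a * (m + 1) + (b * (m + 1) + c * (m + 1)) + 2) j * (-(j + 1) : ℝ) ^ k)
    (a * (m + 1) + (b * (m + 1) + c * (m + 1)) + 2) 1
  set v := linForm x (fun j => ratRes (a * (m + 1)) (b * (m + 1)) (c * (m + 1))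
      (a * (m + 1) + (b * (m + 1) + c * (m + 1)) + 2) j * (-(j + 1) : ℝ) ^ k)
    (a * (m + 1) + (b * (m + 1) + c * (m + 1)) + 2) 2
  have hp0 : p ≠ 0 := by
    rintro rfl
    rw [Int.cast_zero] at hp
    exact mul_ne_zero (hD0 _).ne' hne hp
  have hp1 : (1 : ℝ) ≤ |(p : ℝ)| := by
    rw [← Int.cast_abs]
    exact_mod_cast Int.one_le_abs hp0
  refine absurd hp1 (not_le.2 (lt_of_le_of_lt ?_ hm1))
  have e3 : |(β : ℝ) * u + γ * v| ≤
      (|(β : ℝ)| + |(γ : ℝ)|) * (K * ((m + 1 : ℝ) ^ 2 * ρ ^ m)) := by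
    refine (abs_add_le _ _).trans ?_
    rw [abs_mul, abs_mul, add_mul]
    gcongr
  rw [← hp, abs_mul, abs_of_pos (hD0 _)]
  calc _ ≤ Real.exp (κ * (m + 1 : ℕ)) *
        ((|(β : ℝ)| + |(γ : ℝ)|) * (K * ((m + 1 : ℝ) ^ 2 * ρ ^ m))) := by gcongr
    _ = _ := by
      rw [hq, mul_pow, ← Real.exp_nat_mul]
      push_cast
      rw [mul_add, Real.exp_add, mul_one, mul_comm κ]
      ring

theorem Int.relation_trivial {z : ℤ} (hz : z ≤ -5 ∨ 7 ≤ z) {α β γ : ℤ}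
    (h : α + β * Li 1 (1 / z) + γ * Li 2 (1 / z) = 0) : α = 0 ∧ β = 0 ∧ γ = 0 := by
  rcases hz with hz | hz
  · obtain ⟨ρ, K, h1, h2, h3⟩ := exists_pfForm_bound_of_neg hz
    obtain ⟨D, h4, h5, h6⟩ := exists_denominator_neg
    have hz' : (z : ℝ) ≤ -5 := by exact_mod_cast hz
    exact Int.relation_trivial_of_pfForm_bound (a := 5) (b := 3) (c := 1) (by norm_num)
      (by norm_num) (by rw [abs_of_neg (by linarith)]; linarith) h4 h5 h6 h1 h2 h3 h
  · obtain ⟨ρ, K, h1, h2, h3⟩ := exists_pfForm_bound_of_pos hz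
    obtain ⟨D, h4, h5, h6⟩ := exists_denominator_pos
    have hz' : (7 : ℝ) ≤ z := by exact_mod_cast hz
    exact Int.relation_trivial_of_pfForm_bound (a := 7) (b := 3) (c := 2) (by norm_num)
      (by norm_num) (by rw [abs_of_pos (by linarith)]; linarith) h4 h5 h6 h1 h2 h3 h

end endgame

/-- (Hata) For every integer `z` with `z ≤ -5` or `z ≥ 7`, the numbers
`1, Li₁(1/z), Li₂(1/z)` are linearly independent over ℚ. -/
theorem hata (z : ℤ) (hz : z ≤ -5 ∨ 7 ≤ z) :
    LinearIndependent ℚ ![(1 : ℝ), Li 1 (1 / (z : ℝ)), Li 2 (1 / (z : ℝ))] := by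
  rw [← LinearIndependent.iff_fractionRing (R := ℤ) (K := ℚ), Fintype.linearIndependent_iff]
  intro g hg
  simp only [Fin.sum_univ_three, zsmul_eq_mul, Matrix.cons_val_zero, Matrix.cons_val_one,
    Matrix.cons_val, mul_one] at hg
  obtain ⟨h0, h1, h2⟩ := Int.relation_trivial hz hg
  intro i
  fin_cases i <;> assumption
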